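/- arXiv:2301.11033 — 4 statements merged into one kernel-verified Lean document; each statement's English description precedes it below -/
import Mathlib

section
/- Let R be a commutative Noetherian ring, I a locally complete intersection ideal of height n ≥ 2 with dim(R/I) ≤ 1. Then there exists a locally complete intersection ideal J of height n such that √I = √J and J/J² is a free R/J-module of rank n. -/
/-- The height of an ideal: the infimum of the heights (in the prime spectrum)
of the primes containing it. -/
noncomputable def idealHeight {R : Type*} [CommRing R] (I : Ideal R) : ℕ∞ :=
  ⨅ (p : PrimeSpectrum R) (_ : I ≤ p.asIdeal), Order.height p

/-- `I` is a locally complete intersection ideal of height `n`: `ht I = n` and for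
every prime `p ⊇ I`, `I_p` is generated by a regular sequence of length `n` in `R_p`. -/
def IsLocallyCompleteIntersection {R : Type*} [CommRing R] (I : Ideal R) (n : ℕ) : Prop :=
  idealHeight I = (n : ℕ∞) ∧
    ∀ (p : Ideal R) [p.IsPrime], I ≤ p →
      ∃ rs : List (Localization.AtPrime p), rs.length = n ∧
        RingTheory.Sequence.IsRegular (Localization.AtPrime p) rs ∧
        Ideal.map (algebraMap R (Localization.AtPrime p)) I = Ideal.span {x | x ∈ rs}


namespace FS
open Module

section Avoid
variable {A : Type*} [CommRing A] {P : Type*} [AddCommGroup P] [Module A P]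

/-- Avoidance of finitely many prime submodules inside a coset of a submodule. -/
lemma avoid_coset (B : Ideal A → Submodule A P) (x0 : P) (K : Submodule A P) (S : Finset (Ideal A)) :
    (∀ p ∈ S, p.IsPrime) → (∀ p ∈ S, ∀ r ∈ p, ∀ x, r • x ∈ B p) →
    (∀ p ∈ S, ∀ r ∉ p, ∀ x, r • x ∈ B p → x ∈ B p) →
    (∀ p ∈ S, x0 ∉ B p ∨ ∃ y ∈ K, y ∉ B p) →
    ∃ y ∈ K, ∀ p ∈ S, x0 + y ∉ B p := by
  classical
  induction S using Finset.strongInduction with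
  | H S ih =>
    intro h0 h1 h2 h3
    rcases S.eq_empty_or_nonempty with rfl | hne
    · exact ⟨0, K.zero_mem, by simp⟩
    obtain ⟨p, hp⟩ := S.exists_minimal hne
    have hpS : p ∈ S := hp.1
    have hsub : ∀ {q}, q ∈ S.erase p → q ∈ S := fun h => Finset.mem_of_mem_erase h
    obtain ⟨y, hyK, hy⟩ := ih (S.erase p) (Finset.erase_ssubset hpS)
      (fun q hq => h0 q (hsub hq)) (fun q hq => h1 q (hsub hq)) (fun q hq => h2 q (hsub hq))
      (fun q hq => h3 q (hsub hq))
    by_cases hx : x0 + y ∈ B p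
    swap
    · refine ⟨y, hyK, fun q hq => ?_⟩
      by_cases hqp : q = p
      · rwa [hqp]
      · exact hy q (Finset.mem_erase.2 ⟨hqp, hq⟩)
    obtain ⟨k, hkK, hk⟩ : ∃ k ∈ K, k ∉ B p := by
      rcases h3 p hpS with h | h
      · refine ⟨y, hyK, fun hy' => h ?_⟩
        simpa using (B p).sub_mem hx hy'
      · exact h
    have hpp := h0 p hpS
    have : ¬ (S.erase p).inf id ≤ p := by
      rw [hpp.inf_le']
      rintro ⟨q, hq, hqp⟩
      exact (Finset.mem_erase.1 hq).1 (le_antisymm hqp (hp.2 (hsub hq) hqp))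
    obtain ⟨t, ht, htp⟩ := SetLike.not_le_iff_exists.1 this
    refine ⟨y + t • k, K.add_mem hyK (K.smul_mem _ hkK), fun q hq hmem => ?_⟩
    by_cases hqp : q = p
    · subst hqp
      refine hk (h2 q hq t htp k ?_)
      have := (B q).sub_mem hmem hx
      rwa [← add_assoc, add_sub_cancel_left] at this
    · have hq' := Finset.mem_erase.2 ⟨hqp, hq⟩
      refine hy q hq' ?_
      have htq : t ∈ q := (Finset.inf_le hq' : (S.erase p).inf id ≤ id q) ht
      have := (B q).sub_mem hmem (h1 q hq t htq k)
      rwa [← add_assoc, add_sub_cancel_right] at this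

lemma avoid (B : Ideal A → Submodule A P) (S : Finset (Ideal A))
    (h0 : ∀ p ∈ S, p.IsPrime) (h1 : ∀ p ∈ S, ∀ r ∈ p, ∀ x, r • x ∈ B p)
    (h2 : ∀ p ∈ S, ∀ r ∉ p, ∀ x, r • x ∈ B p → x ∈ B p)
    (h3 : ∀ p ∈ S, ∃ y, y ∉ B p) :
    ∃ y, ∀ p ∈ S, y ∉ B p := by
  obtain ⟨y, -, hy⟩ := avoid_coset B 0 ⊤ S h0 h1 h2
    (fun p hp => Or.inr (by simpa using h3 p hp))
  exact ⟨y, by simpa using hy⟩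

lemma smul_top_h1 (m : Ideal A) : ∀ r ∈ m, ∀ x : P, r • x ∈ m • (⊤ : Submodule A P) :=
  fun _ hr _ => Submodule.smul_mem_smul hr trivial

lemma smul_top_h2 (m : Ideal A) [hm : m.IsMaximal] :
    ∀ r ∉ m, ∀ x : P, r • x ∈ m • (⊤ : Submodule A P) → x ∈ m • (⊤ : Submodule A P) := by
  intro r hr x hx
  obtain ⟨y, i, hi, h⟩ := hm.exists_inv hr
  have : x = y • (r • x) + i • x := by
    rw [smul_smul, ← add_smul, h, one_smul]
  rw [this]
  exact Submodule.add_mem _ (Submodule.smul_mem _ _ hx) (smul_top_h1 m i hi x)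

lemma finite_max [IsNoetherianRing A] [Ring.KrullDimLE 1 A] (b : Ideal A)
    (hb : ∀ p ∈ minimalPrimes A, ¬ b ≤ p) : {m : Ideal A | m.IsMaximal ∧ b ≤ m}.Finite := by
  refine (Ideal.finite_minimalPrimes_of_isNoetherianRing A b).subset ?_
  rintro m ⟨hm, hbm⟩
  refine ⟨⟨hm.isPrime, hbm⟩, ?_⟩
  rintro q ⟨hq, hbq⟩ hqm
  rcases Ring.krullDimLE_one_iff.1 ‹_› q hq with h | h
  · exact absurd hbq (hb q h)
  · exact (h.eq_of_le hm.ne_top hqm).ge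

lemma finite_minimalPrimes [IsNoetherianRing A] : (minimalPrimes A).Finite :=
  minimalPrimes.finite_of_isNoetherianRing A

lemma exists_dual [Projective A P] (m : Ideal A) (y : P) (hy : y ∉ m • (⊤ : Submodule A P)) :
    ∃ ψ : Dual A P, ψ y ∉ m := by
  by_contra! h
  obtain ⟨s, hs⟩ := Module.projective_def'.1 ‹Projective A P›
  apply hy
  have : y = Finsupp.linearCombination A id (s y) := (LinearMap.congr_fun hs y).symm
  rw [this, Finsupp.linearCombination_apply]
  refine Submodule.sum_mem _ fun z _ => ?_
  exact Submodule.smul_mem_smul (h (Finsupp.lapply z ∘ₗ s)) trivial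

/-- The order ideal. -/
def ord (x : P) : Ideal A := LinearMap.range (Dual.eval A P x)

lemma mem_ord (x : P) (a : A) : a ∈ ord x ↔ ∃ ψ : Dual A P, ψ x = a := by
  simp [ord]

/-- Serre splitting in dimension at most one. -/
theorem serre [IsNoetherianRing A] [Ring.KrullDimLE 1 A] [Projective A P]
    (hR : ∀ (m : Ideal A) [m.IsMaximal] (z : P),
      Submodule.span A {z} ⊔ m • (⊤ : Submodule A P) ≠ ⊤) :
    ∃ (x : P) (φ : Dual A P), φ x = 1 := by
  classical
  have hmP : ∀ (m : Ideal A) [m.IsMaximal], ∃ y : P, y ∉ m • (⊤ : Submodule A P) := by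
    intro m _
    by_contra! h
    apply hR m 0
    rw [eq_top_iff]
    exact fun y _ => Submodule.mem_sup_right (h y)
  have hex : ∀ p : Ideal A, p.IsPrime → ∃ φ : Dual A P, ∃ x, φ x ∉ p := by
    intro p hp
    obtain ⟨m, hm, hpm⟩ := p.exists_le_maximal hp.ne_top
    obtain ⟨y, hy⟩ := hmP m
    obtain ⟨ψ, hψ⟩ := exists_dual m y hy
    exact ⟨ψ, y, fun h => hψ (hpm h)⟩
  have hminp : ∀ p ∈ minimalPrimes A, p.IsPrime := fun p hp => hp.1.1
  -- choose φ
  obtain ⟨φ, hφ⟩ : ∃ φ : Dual A P, ∀ p ∈ minimalPrimes A, ∃ x, φ x ∉ p := by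
    let B : Ideal A → Submodule A (Dual A P) := fun p =>
      { carrier := {φ | ∀ x, φ x ∈ p}
        add_mem' := fun ha hb x => p.add_mem (ha x) (hb x)
        zero_mem' := fun x => p.zero_mem
        smul_mem' := fun c φ h x => p.mul_mem_left c (h x) }
    obtain ⟨φ, hφ⟩ := avoid B finite_minimalPrimes.toFinset (by simpa using hminp)
      (fun p hp r hr φ x => p.mul_mem_right _ hr)
      (fun p hp r hr φ h x => ((hminp p (by simpa using hp)).mem_or_mem (h x)).resolve_left hr)
      (fun p hp => by
        obtain ⟨φ, x, hx⟩ := hex p (hminp p (by simpa using hp))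
        exact ⟨φ, fun h => hx (h x)⟩)
    refine ⟨φ, fun p hp => ?_⟩
    have := hφ p (by simpa using hp)
    by_contra! h
    exact this h
  have hT1 := finite_max (LinearMap.range φ) (fun p hp h => by
    obtain ⟨x, hx⟩ := hφ p hp
    exact hx (h ⟨x, rfl⟩))
  -- choose x
  obtain ⟨x, hx1, hx2⟩ : ∃ x : P, (∀ p ∈ minimalPrimes A, φ x ∉ p) ∧
      ∀ m : Ideal A, m.IsMaximal → LinearMap.range φ ≤ m → x ∉ m • (⊤ : Submodule A P) := by
    let B : Ideal A → Submodule A P := fun p =>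
      if p ∈ minimalPrimes A then Submodule.comap φ p else p • ⊤
    have hS : ∀ p ∈ finite_minimalPrimes.toFinset ∪ hT1.toFinset,
        p ∈ minimalPrimes A ∨ (p ∉ minimalPrimes A ∧ p.IsMaximal ∧ LinearMap.range φ ≤ p) := by
      intro p hp
      simp only [Finset.mem_union, Set.Finite.mem_toFinset] at hp
      by_cases h : p ∈ minimalPrimes A
      · exact Or.inl h
      · exact Or.inr ⟨h, hp.resolve_left h⟩
    obtain ⟨x, hx⟩ := avoid B (finite_minimalPrimes.toFinset ∪ hT1.toFinset)
      (fun p hp => by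
        rcases hS p hp with h | ⟨-, h, -⟩
        · exact hminp p h
        · exact h.isPrime)
      (fun p hp r hr x => by
        rcases hS p hp with h | ⟨h', h, -⟩
        · simp only [B, if_pos h, Submodule.mem_comap, map_smul]
          exact p.mul_mem_right _ hr
        · simp only [B, if_neg h']
          exact smul_top_h1 p r hr x)
      (fun p hp r hr x => by
        rcases hS p hp with h | ⟨h', h, -⟩
        · simp only [B, if_pos h, Submodule.mem_comap, map_smul]
          exact fun h2 => ((hminp p h).mem_or_mem h2).resolve_left hr
        · simp only [B, if_neg h']
          exact smul_top_h2 p r hr x)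
      (fun p hp => by
        rcases hS p hp with h | ⟨h', h, -⟩
        · simp only [B, if_pos h, Submodule.mem_comap]
          exact hφ p h
        · simp only [B, if_neg h']
          exact hmP p)
    refine ⟨x, fun p hp => ?_, fun m hm hmr => ?_⟩
    · have := hx p (by simp [hp])
      simpa only [B, if_pos hp, Submodule.mem_comap] using this
    · have hmm : m ∉ minimalPrimes A := fun h => by
        obtain ⟨z, hz⟩ := hφ m h
        exact hz (hmr ⟨z, rfl⟩)
      have := hx m (by simp [hm, hmr])
      simpa only [B, if_neg hmm] using this
  have hT2 := finite_max (Ideal.span {φ x}) (fun p hp h => hx1 p hp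
    (h (Ideal.mem_span_singleton_self _)))
  have hT2m : ∀ m, m ∈ hT2.toFinset ↔ m.IsMaximal ∧ φ x ∈ m := by
    intro m; simp [Ideal.span_le]
  obtain ⟨y, hyK, hy⟩ := avoid_coset (fun m => m • (⊤ : Submodule A P)) x (LinearMap.ker φ)
    hT2.toFinset (fun p hp => ((hT2m p).1 hp).1.isPrime)
    (fun p hp => smul_top_h1 p)
    (fun p hp => by
      have := ((hT2m p).1 hp).1
      exact smul_top_h2 p)
    (fun m hm => by
      have hmm := ((hT2m m).1 hm).1
      by_cases hx : x ∈ m • (⊤ : Submodule A P)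
      swap
      · exact Or.inl hx
      right
      have : ¬ LinearMap.range φ ≤ m := fun h => hx2 m hmm h hx
      obtain ⟨_, ⟨z, rfl⟩, hz⟩ := SetLike.not_le_iff_exists.1 this
      obtain ⟨w, hw⟩ : ∃ w, w ∉ Submodule.span A {z} ⊔ m • (⊤ : Submodule A P) := by
        by_contra! h
        exact hR m z (eq_top_iff.2 fun w _ => h w)
      refine ⟨φ z • w - φ w • z, by simp [mul_comm], fun hmem => hw ?_⟩
      obtain ⟨u, i, hi, h⟩ := hmm.exists_inv hz
      have : w = (u * φ w) • z + (u • (φ z • w - φ w • z) + i • w) := by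
        rw [smul_sub, smul_smul, smul_smul]
        calc w = (u * φ z + i) • w := by rw [h, one_smul]
          _ = _ := by rw [add_smul]; abel
      rw [this]
      exact Submodule.add_mem_sup
        (Submodule.smul_mem _ _ (Submodule.mem_span_singleton_self z))
        (Submodule.add_mem _ (Submodule.smul_mem _ _ hmem) (smul_top_h1 m i hi w)))
  refine ⟨x + y, ?_⟩
  have : (ord (x + y) : Ideal A) = ⊤ := by
    by_contra hne
    obtain ⟨m, hm, hle⟩ := Ideal.exists_le_maximal _ hne
    have h1 : φ x ∈ m := hle ((mem_ord _ _).2 ⟨φ, by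
      rw [map_add, LinearMap.mem_ker.1 hyK, add_zero]⟩)
    obtain ⟨ψ, hψ⟩ := exists_dual m _ (hy m ((hT2m m).2 ⟨hm, h1⟩))
    exact hψ (hle ((mem_ord _ _).2 ⟨ψ, rfl⟩))
  exact (mem_ord (x + y) (1 : A)).1 (this ▸ trivial)

end Avoid

section Rank
open TensorProduct
variable {A : Type*} [CommRing A] {P : Type*} [AddCommGroup P] [Module A P]

lemma fiber_span (m : Ideal A) [m.IsPrime] (z : P)
    (h : Submodule.span A {z} ⊔ m • (⊤ : Submodule A P) = ⊤) :
    ∀ v : m.ResidueField ⊗[A] P, ∃ c : m.ResidueField, c • ((1 : m.ResidueField) ⊗ₜ[A] z) = v := by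
  intro v
  rw [← Submodule.mem_span_singleton]
  have key : ∀ w : P, (1 : m.ResidueField) ⊗ₜ[A] w ∈
      Submodule.span m.ResidueField {(1 : m.ResidueField) ⊗ₜ[A] z} := by
    intro w
    have hw : w ∈ Submodule.span A {z} ⊔ m • (⊤ : Submodule A P) := by
      rw [h]; trivial
    obtain ⟨u, hu, v, hv, rfl⟩ := Submodule.mem_sup.1 hw
    rw [TensorProduct.tmul_add]
    refine Submodule.add_mem _ ?_ ?_
    · obtain ⟨a, rfl⟩ := Submodule.mem_span_singleton.1 hu
      rw [TensorProduct.tmul_smul, ← algebraMap_smul m.ResidueField a]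
      exact Submodule.smul_mem _ _ (Submodule.mem_span_singleton_self _)
    · have : (1 : m.ResidueField) ⊗ₜ[A] v = 0 := by
        refine Submodule.smul_induction_on hv ?_ ?_
        · intro r hr n _
          rw [TensorProduct.tmul_smul, ← algebraMap_smul m.ResidueField r,
            Ideal.algebraMap_residueField_eq_zero.2 hr, zero_smul]
        · intro x y hx hy
          rw [TensorProduct.tmul_add, hx, hy, add_zero]
      rw [this]; exact Submodule.zero_mem _
  induction v with
  | zero => exact Submodule.zero_mem _
  | add x y hx hy => exact Submodule.add_mem _ hx hy
  | tmul c w =>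
    have : c ⊗ₜ[A] w = c • ((1 : m.ResidueField) ⊗ₜ[A] w) := by
      rw [TensorProduct.smul_tmul', smul_eq_mul, mul_one]
    rw [this]
    exact Submodule.smul_mem _ _ (key w)

variable [Module.Finite A P] [Projective A P]

lemma rank_le_one (m : Ideal A) [hm : m.IsPrime] (z : P)
    (h : Submodule.span A {z} ⊔ m • (⊤ : Submodule A P) = ⊤) :
    rankAtStalk P ⟨m, hm⟩ ≤ 1 := by
  rw [rankAtStalk_eq]
  exact finrank_le_one ((1 : m.ResidueField) ⊗ₜ[A] z) (fiber_span m z h)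

lemma rank_eq_zero (m : Ideal A) [hm : m.IsPrime]
    (h : m • (⊤ : Submodule A P) = ⊤) :
    rankAtStalk P ⟨m, hm⟩ = 0 := by
  rw [rankAtStalk_eq]
  have := fiber_span m (0 : P) (by rw [h]; simp)
  simp only [TensorProduct.tmul_zero, smul_zero, exists_const] at this
  have : Subsingleton (m.ResidueField ⊗[A] P) := ⟨fun x y => (this x).symm.trans (this y)⟩
  exact finrank_zero_of_subsingleton

lemma exists_not_smul_top (h : ∀ p : PrimeSpectrum A, rankAtStalk P p ≠ 0)
    (m : Ideal A) [hm : m.IsPrime] : ∃ y : P, y ∉ m • (⊤ : Submodule A P) := by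
  by_contra! h'
  exact h ⟨m, hm⟩ (rank_eq_zero m (eq_top_iff.2 fun y _ => h' y))

theorem split [IsNoetherianRing A] [Ring.KrullDimLE 1 A] (k : ℕ) :
    ∀ {P : Type*} [AddCommGroup P] [Module A P] [Module.Finite A P] [Projective A P],
    (∀ p : PrimeSpectrum A, rankAtStalk P p = k + 1) →
    ∃ (f : Fin k → P) (M : Submodule A P), Module.Finite A M ∧ Projective A M ∧
      (∀ p : PrimeSpectrum A, rankAtStalk M p = 1) ∧
      Submodule.span A (Set.range f) ⊔ M = ⊤ := by
  induction k with
  | zero =>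
    intro P _ _ _ _ h
    refine ⟨Fin.elim0, ⊤, inferInstance, Projective.of_equiv Submodule.topEquiv.symm, fun p => ?_,
      by simp⟩
    rw [rankAtStalk_eq_of_equiv Submodule.topEquiv, h]
  | succ k ih =>
    intro P _ _ _ _ h
    obtain ⟨x, φ, hx⟩ := serre (A := A) (P := P) (fun m hm z hz => by
      have := rank_le_one m z hz
      rw [h] at this
      omega)
    let K := LinearMap.ker φ
    let e : P ≃ₗ[A] A × K := LinearEquiv.ofLinearMap
      (φ.prod ((LinearMap.id - φ.smulRight x).codRestrict K (fun z => by simp [K, hx])))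
      ((LinearMap.toSpanSingleton A P x).coprod K.subtype)
      (by
        ext
        · simp [hx]
        · simp [hx]
        · rename_i z
          have : φ z = 0 := z.2
          simp [this]
        · rename_i z
          have : φ z = 0 := z.2
          simp [this])
      (by ext; simp)
    have hK1 : Module.Finite A K := Module.Finite.of_surjective ((LinearMap.snd A A K) ∘ₗ e.toLinearMap)
      (fun k => ⟨e.symm (0, k), by simp⟩)
    have hK2 : Projective A K := Projective.of_split (e.symm.toLinearMap ∘ₗ LinearMap.inr A A K)
      ((LinearMap.snd A A K) ∘ₗ e.toLinearMap) (by ext; simp)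
    obtain ⟨f, M, h1, h2, h3, h4⟩ := ih (P := K) (fun p => by
      have h5 := h p
      have : Nontrivial A := p.nontrivial
      rw [rankAtStalk_eq_of_equiv e, rankAtStalk_prod, rankAtStalk_self, Pi.add_apply,
        Pi.one_apply] at h5
      omega)
    let eM := Submodule.equivMapOfInjective K.subtype K.injective_subtype M
    refine ⟨Fin.cons x (fun i => (f i : P)), M.map K.subtype, Module.Finite.equiv eM,
      Projective.of_equiv eM, fun p => ?_, ?_⟩
    · rw [← rankAtStalk_eq_of_equiv eM, h3]
    · have h5 := congrArg (Submodule.map K.subtype) h4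
      rw [Submodule.map_sup, Submodule.map_span, Submodule.map_top, Submodule.range_subtype] at h5
      rw [Fin.range_cons, Submodule.span_insert, sup_assoc]
      have : (Set.range fun i => (f i : P)) = K.subtype '' Set.range f := by
        ext; simp
      rw [this, h5, eq_top_iff]
      intro z _
      have : z = φ z • x + (z - φ z • x) := by abel
      rw [this]
      exact Submodule.add_mem_sup (Submodule.smul_mem _ _ (Submodule.mem_span_singleton_self x))
        (by simp [K, hx])

/-- In a rank one module, `φ z • w = φ w • z`. -/
lemma rank_one_comm (h : ∀ p : PrimeSpectrum A, rankAtStalk P p = 1) (φ : Dual A P) (z w : P) :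
    φ z • w = φ w • z := by
  refine Module.eq_of_localization_maximal
    (R := A) (Mₚ := fun m _ => LocalizedModule m.primeCompl P)
    (fun m _ => LocalizedModule.mkLinearMap m.primeCompl P) _ _ fun m hm => ?_
  have hr := h ⟨m, hm.isPrime⟩
  have : Module.Free (Localization.AtPrime m) (LocalizedModule m.primeCompl P) :=
    free_of_flat_of_isLocalRing
  let b := Module.finBasisOfFinrankEq (Localization.AtPrime m) (LocalizedModule m.primeCompl P) hr
  let g := LocalizedModule.mkLinearMap m.primeCompl P
  let Φ : LocalizedModule m.primeCompl P →ₗ[Localization.AtPrime m] Localization.AtPrime m :=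
    IsLocalizedModule.mapExtendScalars m.primeCompl g
      (Algebra.linearMap A (Localization.AtPrime m)) (Localization.AtPrime m) φ
  have hΦ : ∀ y, Φ (g y) = algebraMap A _ (φ y) := fun y => by
    simp [Φ, IsLocalizedModule.map_apply]
  have hb : ∀ y, y = (b.repr y 0) • b 0 := fun y => by
    conv_lhs => rw [← b.sum_repr y]
    simp
  change g (φ z • w) = g (φ w • z)
  rw [map_smul, map_smul, ← algebraMap_smul (Localization.AtPrime m) (φ z),
    ← algebraMap_smul (Localization.AtPrime m) (φ w), ← hΦ, ← hΦ, hb (g z), hb (g w)]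
  simp only [map_smul, smul_smul, smul_eq_mul]
  congr 1
  ring

theorem rank_one_data [IsNoetherianRing A] [Ring.KrullDimLE 1 A]
    (h : ∀ p : PrimeSpectrum A, rankAtStalk P p = 1) :
    ∃ (f g : P) (a b c d : A), Submodule.span A {f, g} = ⊤ ∧ d • f = c • g ∧ b • f = a • g ∧
      a + d = 1 ∧ a * d = b * c := by
  have hne : ∀ (m : Ideal A), m.IsPrime → ∃ y : P, y ∉ m • (⊤ : Submodule A P) :=
    fun m hm => exists_not_smul_top (fun p => by rw [h]; simp) m
  have hcomm := rank_one_comm h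
  have hminp : ∀ p ∈ minimalPrimes A, p.IsPrime := fun p hp => hp.1.1
  obtain ⟨f, hf⟩ : ∃ f : P, ∀ p ∈ minimalPrimes A, ∃ ψ : Dual A P, ψ f ∉ p := by
    let B : Ideal A → Submodule A P := fun p =>
      { carrier := {x | ∀ φ : Dual A P, φ x ∈ p}
        add_mem' := fun ha hb φ => by rw [map_add]; exact p.add_mem (ha φ) (hb φ)
        zero_mem' := fun φ => by simp
        smul_mem' := fun c x h φ => by rw [map_smul]; exact p.mul_mem_left c (h φ) }
    obtain ⟨x, hx⟩ := avoid B finite_minimalPrimes.toFinset (by simpa using hminp)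
      (fun p hp r hr x φ => by rw [map_smul]; exact p.mul_mem_right _ hr)
      (fun p hp r hr x h φ => by
        have := h φ
        rw [map_smul] at this
        exact ((hminp p (by simpa using hp)).mem_or_mem this).resolve_left hr)
      (fun p hp => by
        obtain ⟨y, hy⟩ := hne p (hminp p (by simpa using hp))
        obtain ⟨ψ, hψ⟩ := exists_dual p y hy
        exact ⟨y, fun h => hψ (h ψ)⟩)
    refine ⟨x, fun p hp => ?_⟩
    have := hx p (by simpa using hp)
    by_contra! h
    exact this h
  have hT := finite_max (ord f : Ideal A) (fun p hp hle => by
    obtain ⟨ψ, hψ⟩ := hf p hp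
    exact hψ (hle ((mem_ord _ _).2 ⟨ψ, rfl⟩)))
  obtain ⟨g, hg⟩ := avoid (fun m => m • (⊤ : Submodule A P)) hT.toFinset
    (fun p hp => by
      have : p.IsMaximal ∧ ord f ≤ p := by simpa using hp
      exact this.1.isPrime)
    (fun p hp => smul_top_h1 p)
    (fun p hp => by
      have : p.IsMaximal ∧ ord f ≤ p := by simpa using hp
      have := this.1
      exact smul_top_h2 p)
    (fun p hp => by
      have : p.IsMaximal ∧ ord f ≤ p := by simpa using hp
      exact hne p this.1.isPrime)
  have hspan : Submodule.span A {f, g} = ⊤ := by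
    rw [eq_top_iff]
    intro w _
    let c : Ideal A := Submodule.comap (LinearMap.toSpanSingleton A P w) (Submodule.span A {f, g})
    have hc : ∀ r, r ∈ c ↔ r • w ∈ Submodule.span A {f, g} := fun r => by simp [c]
    have : c = ⊤ := by
      by_contra hne
      obtain ⟨m, hm, hle⟩ := Ideal.exists_le_maximal _ hne
      have hkey : ∀ y ∈ ({f, g} : Set P), ∀ ψ : Dual A P, ψ y ∈ m := by
        intro y hy ψ
        apply hle
        rw [hc, hcomm]
        exact Submodule.smul_mem _ _ (Submodule.subset_span hy)
      have h1 : ord f ≤ m := by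
        intro r hr
        obtain ⟨ψ, rfl⟩ := (mem_ord _ _).1 hr
        exact hkey f (by simp) ψ
      obtain ⟨ψ, hψ⟩ := exists_dual m g (hg m (by simp [hm, h1]))
      exact hψ (hkey g (by simp) ψ)
    have h1 : (1 : A) ∈ c := this ▸ trivial
    simpa using (hc 1).1 h1
  let π : A × A →ₗ[A] P := (LinearMap.toSpanSingleton A P f).coprod (LinearMap.toSpanSingleton A P g)
  have hπ : Function.Surjective π := by
    intro w
    have : w ∈ Submodule.span A {f, g} := hspan ▸ trivial
    obtain ⟨a, b, rfl⟩ := Submodule.mem_span_pair.1 this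
    exact ⟨(a, b), by simp [π]⟩
  obtain ⟨s, hs⟩ := Module.projective_lifting_property π LinearMap.id hπ
  let φ₁ : Dual A P := LinearMap.fst A A A ∘ₗ s
  let φ₂ : Dual A P := LinearMap.snd A A A ∘ₗ s
  have hs' : ∀ w, φ₁ w • f + φ₂ w • g = w := fun w => by
    have := LinearMap.congr_fun hs w
    simpa [π, φ₁, φ₂] using this
  have faith : ∀ r : A, r • f = 0 → r • g = 0 → r = 0 := by
    intro r hrf hrg
    have hr : ∀ w : P, r • w = 0 := fun w => by
      rw [← hs' w, smul_add, smul_comm, hrf, smul_comm, hrg]; simp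
    have : (LinearMap.ker (LinearMap.toSpanSingleton A A r) : Ideal A) = ⊤ := by
      by_contra hne'
      obtain ⟨m, hm, hle⟩ := Ideal.exists_le_maximal _ hne'
      obtain ⟨y, hy⟩ := hne m hm.isPrime
      obtain ⟨ψ, hψ⟩ := exists_dual m y hy
      apply hψ
      apply hle
      have := congrArg ψ (hr y)
      rw [map_smul, map_zero, smul_eq_mul, mul_comm] at this
      simpa using this
    have h1 : (1 : A) ∈ (LinearMap.ker (LinearMap.toSpanSingleton A A r) : Ideal A) := this ▸ trivial
    simpa using h1
  have e1 : φ₂ g • f = φ₂ f • g := hcomm φ₂ g f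
  have e2 : φ₁ g • f = φ₁ f • g := hcomm φ₁ g f
  refine ⟨f, g, φ₁ f, φ₁ g, φ₂ f, φ₂ g, hspan, e1, e2, ?_, ?_⟩
  · rw [← sub_eq_zero]
    apply faith
    · rw [sub_smul, add_smul, e1, hs', one_smul, sub_self]
    · rw [sub_smul, add_smul, ← e2, hs', one_smul, sub_self]
  · rw [← sub_eq_zero]
    apply faith
    · rw [sub_smul, mul_smul, e1, mul_comm (φ₁ g), mul_smul, e2, smul_comm, sub_self]
    · rw [sub_smul, mul_comm, mul_smul, ← e2, mul_smul, ← e1, smul_comm, sub_self]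

end Rank

section Local
open RingTheory.Sequence
variable {S : Type*} [CommRing S]

lemma rel_mem (n : ℕ) : ∀ (x : Fin n → S)
    (_ : ∀ i t, t * x i ∈ Ideal.span (x '' Set.Iio i) → t ∈ Ideal.span (x '' Set.Iio i))
    (t : Fin n → S) (_ : ∑ i, t i * x i = 0), ∀ i, t i ∈ Ideal.span (Set.range x) := by
  induction n with
  | zero => intro x _ t _ i; exact i.elim0
  | succ n ih =>
    intro x h t ht
    let xx : Fin n → S := fun i => x i.castSucc
    have e1 : x '' Set.Iio (Fin.last n) = Set.range xx := by
      ext y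
      constructor
      · rintro ⟨i, hi, rfl⟩
        exact ⟨i.castPred (ne_of_lt hi), by simp [xx]⟩
      · rintro ⟨i, rfl⟩
        exact ⟨i.castSucc, Fin.castSucc_lt_last i, rfl⟩
    have e2 : ∀ i : Fin n, x '' Set.Iio i.castSucc = xx '' Set.Iio i := by
      intro i
      ext y
      constructor
      · rintro ⟨j, hj, rfl⟩
        have hj' : j ≠ Fin.last n := ne_of_lt (lt_trans hj (Fin.castSucc_lt_last i))
        refine ⟨j.castPred hj', ?_, by simp [xx]⟩
        simpa [Fin.castPred_lt_iff] using hj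
      · rintro ⟨j, hj, rfl⟩
        exact ⟨j.castSucc, by simpa using hj, rfl⟩
    have hsub : Ideal.span (Set.range xx) ≤ Ideal.span (Set.range x) :=
      Ideal.span_mono (by rintro _ ⟨i, rfl⟩; exact ⟨_, rfl⟩)
    rw [Fin.sum_univ_castSucc] at ht
    have hl : t (Fin.last n) ∈ Ideal.span (Set.range xx) := by
      rw [← e1]
      apply h
      rw [e1, eq_neg_of_add_eq_zero_right ht]
      exact neg_mem (Ideal.sum_mem _ fun i _ => Ideal.mul_mem_left _ _
        (Ideal.subset_span ⟨i, rfl⟩))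
    obtain ⟨u, hu⟩ := (Submodule.mem_span_range_iff_exists_fun S).1 hl
    have hx' := ih xx (fun i s => by rw [← e2]; exact h _ _)
      (fun i => t i.castSucc + u i * x (Fin.last n)) (by
        rw [← ht, ← hu, Finset.sum_mul, ← Finset.sum_add_distrib]
        refine Finset.sum_congr rfl fun i _ => ?_
        simp only [xx, smul_eq_mul]
        ring)
    intro i
    refine Fin.lastCases (hsub hl) (fun i => ?_) i
    have := Ideal.sub_mem _ (hsub (hx' i)) (Ideal.mul_mem_left _ (u i)
      (Ideal.subset_span ⟨Fin.last n, rfl⟩ : x (Fin.last n) ∈ Ideal.span (Set.range x)))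
    simpa using this

lemma range_get (rs : List S) : Set.range rs.get = {x | x ∈ rs} := by
  simp

lemma rel_list (rs : List S) (h : IsWeaklyRegular S rs) (t : Fin rs.length → S)
    (ht : ∑ i, t i * rs.get i = 0) : ∀ i, t i ∈ Ideal.span {x | x ∈ rs} := by
  rw [← range_get]
  refine rel_mem _ rs.get (fun i t hit => ?_) t ht
  have hi := (isWeaklyRegular_iff_Fin S rs).1 h i
  have e : Ideal.span (rs.get '' Set.Iio i) = (Ideal.ofList (rs.take i) • ⊤ : Submodule S S) := by
    rw [smul_eq_mul, Ideal.mul_top, Ideal.ofList]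
    congr 1
    ext y
    simp only [Set.mem_image, Set.mem_Iio, Set.mem_ofPred_eq, List.mem_take_iff_getElem]
    constructor
    · rintro ⟨j, hj, rfl⟩
      exact ⟨j, by simp; omega, rfl⟩
    · rintro ⟨j, hj, rfl⟩
      have : j < i ∧ j < rs.length := by omega
      exact ⟨⟨j, this.2⟩, this.1, rfl⟩
  rw [e] at hit ⊢
  rw [← Submodule.Quotient.mk_eq_zero] at hit ⊢
  apply hi
  change rs[i] • _ = rs[i] • _
  rw [smul_zero, ← Submodule.Quotient.mk_smul, smul_eq_mul]
  rw [mul_comm] at hit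
  exact hit

lemma length_le (rs bs : List S) (h : IsRegular S rs)
    (hs : Ideal.span {x | x ∈ rs} = Ideal.span {x | x ∈ bs}) : rs.length ≤ bs.length := by
  set I := Ideal.span {x | x ∈ rs} with hI
  have hIne : I ≠ ⊤ := by
    intro hh
    apply h.top_ne_smul
    rw [smul_eq_mul, Ideal.mul_top]
    exact hh.symm
  have : Nontrivial (S ⧸ I) := Ideal.Quotient.nontrivial_iff.2 hIne
  have h1 : ∀ i, ∃ v : Fin bs.length → S, ∑ j, v j • bs.get j = rs.get i := by
    intro i
    rw [← Submodule.mem_span_range_iff_exists_fun, range_get]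
    change _ ∈ Ideal.span _
    rw [← hs]
    exact Ideal.subset_span (List.get_mem _ _)
  have h2 : ∀ j, ∃ w : Fin rs.length → S, ∑ i, w i • rs.get i = bs.get j := by
    intro i
    rw [← Submodule.mem_span_range_iff_exists_fun, range_get]
    change _ ∈ I
    rw [hs]
    exact Ideal.subset_span (List.get_mem _ _)
  choose V hV using h1
  choose W hW using h2
  let V' : Matrix (Fin rs.length) (Fin bs.length) (S ⧸ I) := fun i j => Ideal.Quotient.mk I (V i j)
  let W' : Matrix (Fin bs.length) (Fin rs.length) (S ⧸ I) := fun i j => Ideal.Quotient.mk I (W i j)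
  have hVW : V' * W' = 1 := by
    ext i k
    have := rel_list rs h.toIsWeaklyRegular
      (fun k => ∑ j, V i j * W j k - (if i = k then 1 else 0)) (by
        simp only [sub_mul, Finset.sum_sub_distrib]
        rw [sub_eq_zero]
        have : ∑ k, (if i = k then (1 : S) else 0) * rs.get k = rs.get i := by simp
        rw [this, ← hV i]
        simp_rw [← hW, Finset.sum_mul, smul_eq_mul, Finset.mul_sum]
        rw [Finset.sum_comm]
        simp_rw [mul_assoc]) k
    rw [← Ideal.Quotient.eq_zero_iff_mem, map_sub, sub_eq_zero] at this
    rw [Matrix.mul_apply, Matrix.one_apply]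
    simp only [V', W', ← map_mul, ← map_sum]
    rw [this]
    split <;> simp
  have := card_le_of_surjective (S ⧸ I) (Matrix.vecMulLinear W') (fun u => ⟨Matrix.vecMul u V', by
    simp [Matrix.vecMul_vecMul, hVW]⟩)
  simpa using this

lemma replace_last (l : List S) (y x u : S) (hu : IsUnit u) (h : IsWeaklyRegular S (l ++ [y]))
    (hx : x - u * y ∈ Ideal.ofList l) : IsWeaklyRegular S (l ++ [x]) := by
  rw [isWeaklyRegular_append_iff, isWeaklyRegular_singleton_iff] at h ⊢
  refine ⟨h.1, ?_⟩
  have hreg := h.2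
  have key : ∀ q : S ⧸ (Ideal.ofList l • ⊤ : Submodule S S), x • q = u • (y • q) := by
    intro q
    obtain ⟨z, rfl⟩ := Submodule.Quotient.mk_surjective _ q
    rw [← Submodule.Quotient.mk_smul, ← Submodule.Quotient.mk_smul, ← Submodule.Quotient.mk_smul,
      Submodule.Quotient.eq]
    simp only [smul_eq_mul, Ideal.mul_top]
    have := Ideal.mul_mem_right z _ hx
    convert this using 1
    ring
  intro q q' hq
  simp only [key] at hq
  exact hreg (hu.isSMulRegular _ hq)

lemma last_sq (l : List S) (y : S) (h : IsWeaklyRegular S (l ++ [y])) :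
    IsWeaklyRegular S (l ++ [y ^ 2]) := by
  rw [isWeaklyRegular_append_iff, isWeaklyRegular_singleton_iff] at h ⊢
  exact ⟨h.1, h.2.pow 2⟩

variable [IsLocalRing S]

lemma find_unit (B : List S) : ∀ (L : List S) (x : S), x ∈ Ideal.ofList B ⊔ Ideal.ofList L →
    x ∈ Ideal.ofList B ⊔ IsLocalRing.maximalIdeal S * Ideal.ofList L ∨
    ∃ L1 y L2 u, L = L1 ++ y :: L2 ∧ IsUnit u ∧ x - u * y ∈ Ideal.ofList (B ++ (L1 ++ L2)) := by
  intro L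
  induction L with
  | nil => intro x hx; left; simpa using hx
  | cons l L ih =>
    intro x hx
    rw [Ideal.ofList_cons, sup_left_comm] at hx
    obtain ⟨_, hr, y, hy, rfl⟩ := Submodule.mem_sup.1 hx
    obtain ⟨r, rfl⟩ := Ideal.mem_span_singleton'.1 hr
    by_cases hru : IsUnit r
    · right
      refine ⟨[], l, L, r, rfl, hru, ?_⟩
      simpa using hy
    · have hrm : r ∈ IsLocalRing.maximalIdeal S := hru
      rcases ih y hy with h | ⟨L1, z, L2, u, rfl, hu, h⟩
      · left
        refine Ideal.add_mem _ ?_ ?_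
        · exact Ideal.mem_sup_right (Ideal.mul_mem_mul hrm (by
            rw [Ideal.ofList_cons]
            exact Ideal.mem_sup_left (Ideal.mem_span_singleton_self l)))
        · have hle : Ideal.ofList B ⊔ IsLocalRing.maximalIdeal S * Ideal.ofList L ≤
              Ideal.ofList B ⊔ IsLocalRing.maximalIdeal S * Ideal.ofList (l :: L) := by
            refine sup_le_sup le_rfl (Ideal.mul_mono_right ?_)
            rw [Ideal.ofList_cons]; exact le_sup_right
          exact hle h
      · right
        refine ⟨l :: L1, z, L2, u, rfl, hu, ?_⟩
        have e : r * l + y - u * z = r * l + (y - u * z) := by ring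
        rw [e]
        have hsub : Ideal.ofList (B ++ (L1 ++ L2)) ≤ Ideal.ofList (B ++ (l :: L1 ++ L2)) := by
          apply Ideal.span_mono
          intro w hw
          simp only [List.mem_append, Set.mem_ofPred_eq, List.cons_append, List.mem_cons] at hw ⊢
          tauto
        exact Ideal.add_mem _ (Ideal.mul_mem_left _ _ (Ideal.subset_span (by simp))) (hsub h)

variable [IsNoetherianRing S]

/-- Any generating family of length `n` of an ideal generated by a regular sequence of length `n`
in a Noetherian local ring is a regular sequence. -/
theorem exchange (rs bs : List S) (h : IsRegular S rs)
    (hs : Ideal.ofList rs = Ideal.ofList bs) (hl : bs.length = rs.length) :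
    IsRegular S bs := by
  have hlt : Ideal.ofList rs ≤ IsLocalRing.maximalIdeal S := by
    apply IsLocalRing.le_maximalIdeal
    intro hh
    apply h.top_ne_smul
    rw [smul_eq_mul, Ideal.mul_top, hh]
  have key : ∀ i ≤ bs.length, ∃ L, IsRegular S (bs.take i ++ L) ∧
      (bs.take i ++ L).length = rs.length ∧ Ideal.ofList (bs.take i ++ L) = Ideal.ofList rs := by
    intro i
    induction i with
    | zero => intro _; exact ⟨rs, by simpa using h, by simp, by simp⟩
    | succ i ih =>
      intro hi
      obtain ⟨L, h1, h2, h3⟩ := ih (by omega)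
      have hi' : i < bs.length := hi
      have hx : bs[i] ∈ Ideal.ofList rs := by
        rw [hs]; exact Ideal.subset_span (List.getElem_mem _)
      have htake : bs.take (i + 1) = bs.take i ++ [bs[i]] := by simp
      have hbs : bs = bs.take i ++ bs[i] :: bs.drop (i + 1) := by simp
      rcases find_unit (bs.take i) L bs[i] (by rw [← Ideal.ofList_append, h3]; exact hx) with
        hbad | ⟨L1, y, L2, u, rfl, hu, hmem⟩
      · exfalso
        have hgen : Ideal.ofList rs = Ideal.ofList (bs.take i ++ bs.drop (i + 1)) := by
          apply le_antisymm
          · apply Submodule.le_of_le_smul_of_le_jacobson_bot (I := IsLocalRing.maximalIdeal S)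
              (IsNoetherian.noetherian _) (IsLocalRing.maximalIdeal_le_jacobson _)
            conv_lhs => rw [hs, hbs]
            rw [Ideal.ofList_append, Ideal.ofList_cons, Ideal.ofList_append]
            refine sup_le (le_sup_of_le_left le_sup_left) (sup_le ?_
              (le_sup_of_le_left le_sup_right))
            rw [Ideal.span_singleton_le_iff_mem]
            have hle : Ideal.ofList (bs.take i) ⊔ IsLocalRing.maximalIdeal S * Ideal.ofList L ≤
                Ideal.ofList (bs.take i) ⊔ Ideal.ofList (bs.drop (i + 1)) ⊔
                  IsLocalRing.maximalIdeal S • Ideal.ofList rs := by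
              refine sup_le_sup le_sup_left ?_
              rw [smul_eq_mul]
              apply Ideal.mul_mono_right
              rw [← h3, Ideal.ofList_append]
              exact le_sup_right
            exact hle hbad
          · rw [hs]
            apply Ideal.span_mono
            intro w hw
            rw [Set.mem_ofPred_eq, List.mem_append] at hw
            exact hw.elim (fun h => List.mem_of_mem_take h) (fun h => List.mem_of_mem_drop h)
        have := length_le rs _ h hgen
        simp at this
        omega
      · refine ⟨L1 ++ L2, ?_, ?_, ?_⟩
        · have p1 : (bs.take i ++ (L1 ++ y :: L2)).Perm ((bs.take i ++ (L1 ++ L2)) ++ [y]) := by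
            rw [List.append_assoc]
            refine List.Perm.append_left _ ?_
            refine List.perm_middle.trans ?_
            exact (List.perm_append_singleton y (L1 ++ L2)).symm
          have p2 : ((bs.take i ++ (L1 ++ L2)) ++ [bs[i]]).Perm (bs.take (i + 1) ++ (L1 ++ L2)) := by
            rw [htake, List.append_assoc (bs.take i) (L1 ++ L2), List.append_assoc (bs.take i) [bs[i]]]
            exact List.Perm.append_left _ List.perm_append_comm
          have r1 := IsLocalRing.isRegular_of_perm h1 p1
          have r2 := replace_last _ y _ u hu r1.toIsWeaklyRegular hmem
          refine IsLocalRing.isRegular_of_perm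
            (IsRegular.of_isWeaklyRegular_of_mem_maximalIdeal S ?_ r2) p2
          intro r hr
          apply hlt
          rw [List.mem_append, List.mem_singleton] at hr
          rcases hr with hr | rfl
          · rw [← h3]
            apply Ideal.subset_span
            simp only [List.mem_append, Set.mem_ofPred_eq, List.mem_cons] at hr ⊢
            tauto
          · exact hx
        · rw [← h2]; simp; omega
        · have hyy : ∀ K : Ideal S, Ideal.ofList (bs.take i ++ (L1 ++ L2)) ≤ K → (bs[i] ∈ K ↔ y ∈ K) := by
            intro K hK
            have hd := hK hmem
            constructor
            · intro hb
              have := K.sub_mem hb hd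
              rw [sub_sub_cancel] at this
              exact (Ideal.unit_mul_mem_iff_mem K hu).1 this
            · intro hy
              have := K.add_mem hd (K.mul_mem_left u hy)
              simpa using this
          have e1 : Ideal.ofList (bs.take (i + 1) ++ (L1 ++ L2)) =
              Ideal.span {bs[i]} ⊔ Ideal.ofList (bs.take i ++ (L1 ++ L2)) := by
            rw [htake]
            simp only [Ideal.ofList_append, Ideal.ofList_singleton]
            ac_rfl
          have e2 : Ideal.ofList rs =
              Ideal.span {y} ⊔ Ideal.ofList (bs.take i ++ (L1 ++ L2)) := by
            rw [← h3]
            simp only [Ideal.ofList_append, Ideal.ofList_cons]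
            ac_rfl
          rw [e1, e2]
          apply le_antisymm
          · refine sup_le ?_ le_sup_right
            rw [Ideal.span_singleton_le_iff_mem, hyy _ le_sup_right]
            exact Ideal.mem_sup_left (Ideal.mem_span_singleton_self _)
          · refine sup_le ?_ le_sup_right
            rw [Ideal.span_singleton_le_iff_mem, ← hyy _ le_sup_right]
            exact Ideal.mem_sup_left (Ideal.mem_span_singleton_self _)
  obtain ⟨L, h1, h2, h3⟩ := key bs.length le_rfl
  simp at h1 h2
  have : L = [] := by
    apply List.eq_nil_of_length_eq_zero; omega
  simpa [this] using h1

end Local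

section Cot
open RingTheory.Sequence
variable {R : Type*} [CommRing R]

lemma local_gens (I p : Ideal R) [p.IsPrime] (n : ℕ) (rs : List (Localization.AtPrime p))
    (hl : rs.length = n) (hr : IsRegular (Localization.AtPrime p) rs)
    (hI : Ideal.map (algebraMap R (Localization.AtPrime p)) I = Ideal.span {x | x ∈ rs}) :
    ∃ y : Fin n → R, (∀ i, y i ∈ I) ∧
      (∀ z ∈ I, ∃ t ∉ p, t * z ∈ Ideal.span (Set.range y)) ∧
      (∀ r : Fin n → R, ∑ i, r i * y i ∈ I ^ 2 → ∀ i, ∃ t ∉ p, t * r i ∈ I) := by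
  subst hl
  let φ := algebraMap R (Localization.AtPrime p)
  have h1 : ∀ i, ∃ y ∈ I, ∃ s ∉ p, rs.get i * φ s = φ y := by
    intro i
    have : rs.get i ∈ Ideal.map φ I := by
      rw [hI]; exact Ideal.subset_span (List.get_mem _ _)
    obtain ⟨⟨y, s⟩, h⟩ := (IsLocalization.mem_map_algebraMap_iff p.primeCompl _).1 this
    exact ⟨y, y.2, s, s.2, h⟩
  choose y hy s hs hys using h1
  have hu : ∀ i, IsUnit (φ (s i)) := fun i =>
    IsLocalization.map_units (Localization.AtPrime p) (⟨s i, hs i⟩ : p.primeCompl)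
  refine ⟨y, hy, ?_, ?_⟩
  · intro z hz
    have hle : Ideal.map φ I ≤ Ideal.map φ (Ideal.span (Set.range y)) := by
      rw [hI, Ideal.span_le, ← range_get]
      rintro _ ⟨i, rfl⟩
      have h2 : rs.get i * φ (s i) ∈ Ideal.map φ (Ideal.span (Set.range y)) := by
        rw [hys]
        exact Ideal.mem_map_of_mem _ (Ideal.subset_span ⟨i, rfl⟩)
      exact (Ideal.mul_unit_mem_iff_mem _ (hu i)).1 h2
    obtain ⟨t, ht, h⟩ := (IsLocalization.algebraMap_mem_map_algebraMap_iff p.primeCompl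
      (Localization.AtPrime p) _ _).1 (hle (Ideal.mem_map_of_mem φ hz))
    exact ⟨t, ht, h⟩
  · intro r hr2 i
    have h3 : φ (∑ i, r i * y i) ∈ (Ideal.map φ I) •
        Submodule.span (Localization.AtPrime p) (Set.range rs.get) := by
      rw [range_get]
      change _ ∈ Ideal.map φ I • Ideal.span _
      rw [← hI, smul_eq_mul, ← Ideal.map_mul, ← pow_two]
      exact Ideal.mem_map_of_mem _ hr2
    obtain ⟨w, hw, he⟩ := (Submodule.mem_ideal_smul_span_iff_exists_sum _ _ _).1 h3
    rw [Finsupp.sum_fintype _ _ (by simp)] at he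
    have h4 := rel_list rs hr.toIsWeaklyRegular (fun i => φ (r i) * φ (s i) - w i) (by
      simp only [sub_mul, Finset.sum_sub_distrib, sub_eq_zero]
      rw [map_sum] at he
      simp only [smul_eq_mul] at he
      rw [he]
      refine Finset.sum_congr rfl fun i _ => ?_
      rw [map_mul, ← hys]; ring) i
    rw [← hI] at h4
    have h5 := Ideal.add_mem _ h4 (hw i)
    rw [sub_add_cancel, Ideal.mul_unit_mem_iff_mem _ (hu i)] at h5
    obtain ⟨t, ht, h⟩ := (IsLocalization.algebraMap_mem_map_algebraMap_iff p.primeCompl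
      (Localization.AtPrime p) _ _).1 h5
    exact ⟨t, ht, h⟩

lemma loc_bij {A M N : Type*} [CommRing A] [AddCommGroup M] [Module A M] [AddCommGroup N]
    [Module A N] (m : Ideal A) [m.IsPrime] (f : M →ₗ[A] N)
    (h1 : ∀ z, ∃ t ∉ m, ∃ x, f x = t • z) (h2 : ∀ x, f x = 0 → ∃ t ∉ m, t • x = 0) :
    Function.Bijective (LocalizedModule.map m.primeCompl f) := by
  constructor
  · rw [← LinearMap.ker_eq_bot, LinearMap.ker_eq_bot']
    intro q
    induction q using LocalizedModule.induction_on with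
    | h x s =>
      intro h
      rw [LocalizedModule.map_mk, ← LocalizedModule.zero_mk s, LocalizedModule.mk_eq] at h
      obtain ⟨u, hu⟩ := h
      simp only [smul_zero] at hu
      rw [← smul_assoc, ← f.map_smul_of_tower] at hu
      obtain ⟨t, ht, h⟩ := h2 _ hu
      rw [← LocalizedModule.zero_mk s, LocalizedModule.mk_eq]
      refine ⟨⟨t, ht⟩ * u, ?_⟩
      simp only [smul_zero, mul_smul]
      rw [← smul_assoc u]
      exact h
  · intro q
    induction q using LocalizedModule.induction_on with
    | h z s =>
      obtain ⟨t, ht, x, hx⟩ := h1 z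
      refine ⟨LocalizedModule.mk x (⟨t, ht⟩ * s), ?_⟩
      rw [LocalizedModule.map_mk, LocalizedModule.mk_eq]
      refine ⟨1, ?_⟩
      rw [hx, mul_smul, one_smul, one_smul, smul_comm]
      rfl

lemma cot_local (I : Ideal R) (m : Ideal (R ⧸ I)) [m.IsPrime] (n : ℕ)
    (hm : ∃ rs : List (Localization.AtPrime (m.comap (Ideal.Quotient.mk I))), rs.length = n ∧
        RingTheory.Sequence.IsRegular (Localization.AtPrime (m.comap (Ideal.Quotient.mk I))) rs ∧
        Ideal.map (algebraMap R (Localization.AtPrime (m.comap (Ideal.Quotient.mk I)))) I =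
          Ideal.span {x | x ∈ rs}) :
    ∃ f : (Fin n → R ⧸ I) →ₗ[R ⧸ I] I.Cotangent,
      Function.Bijective (LocalizedModule.map m.primeCompl f) := by
  obtain ⟨rs, h1, h2, h3⟩ := hm
  obtain ⟨y, hy, hz, hr⟩ := local_gens I _ n rs h1 h2 h3
  have hsum : ∀ r : Fin n → R, Fintype.linearCombination (R ⧸ I)
      (fun i => I.toCotangent ⟨y i, hy i⟩) (fun i => Ideal.Quotient.mk I (r i)) =
      I.toCotangent ⟨∑ i, r i * y i, I.sum_mem fun i _ => I.mul_mem_left _ (hy i)⟩ := by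
    intro r
    rw [Fintype.linearCombination_apply]
    have : (⟨∑ i, r i * y i, I.sum_mem fun i _ => I.mul_mem_left _ (hy i)⟩ : I) =
        ∑ i, r i • (⟨y i, hy i⟩ : I) := by
      ext; simp
    rw [this, map_sum]
    refine Finset.sum_congr rfl fun i _ => ?_
    rw [map_smul]
    rfl
  refine ⟨Fintype.linearCombination (R ⧸ I) (fun i => I.toCotangent ⟨y i, hy i⟩),
    loc_bij m _ ?_ ?_⟩
  · intro z
    obtain ⟨⟨z, hzI⟩, rfl⟩ := I.toCotangent_surjective z
    obtain ⟨t, ht, h⟩ := hz z hzI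
    obtain ⟨c, hc⟩ := (Submodule.mem_span_range_iff_exists_fun R).1 h
    refine ⟨Ideal.Quotient.mk I t, ht, fun i => Ideal.Quotient.mk I (c i), ?_⟩
    rw [hsum]
    change _ = t • I.toCotangent _
    rw [← map_smul]
    congr 1
    ext
    simpa using hc
  · intro x hx
    choose r hr' using fun i => Ideal.Quotient.mk_surjective (x i)
    obtain rfl : (fun i => Ideal.Quotient.mk I (r i)) = x := funext hr'
    rw [hsum, Ideal.toCotangent_eq_zero] at hx
    choose t ht htr using hr r hx
    refine ⟨Ideal.Quotient.mk I (∏ i, t i), ?_, ?_⟩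
    · change ∏ i, t i ∉ m.comap (Ideal.Quotient.mk I)
      rw [Ideal.IsPrime.prod_mem_iff]
      rintro ⟨i, _, h⟩
      exact ht i h
    · funext i
      simp only [Pi.smul_apply, smul_eq_mul, ← map_mul, Pi.zero_apply]
      rw [Ideal.Quotient.eq_zero_iff_mem, ← Finset.prod_erase_mul _ _ (Finset.mem_univ i), mul_assoc]
      exact I.mul_mem_left _ (htr i)

theorem cot_proj [IsNoetherianRing R] (I : Ideal R) (n : ℕ)
    (h : ∀ (p : Ideal R) [p.IsPrime], I ≤ p →
      ∃ rs : List (Localization.AtPrime p), rs.length = n ∧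
        RingTheory.Sequence.IsRegular (Localization.AtPrime p) rs ∧
        Ideal.map (algebraMap R (Localization.AtPrime p)) I = Ideal.span {x | x ∈ rs}) :
    Module.Finite (R ⧸ I) I.Cotangent ∧ Projective (R ⧸ I) I.Cotangent ∧
      ∀ p : PrimeSpectrum (R ⧸ I), rankAtStalk I.Cotangent p = n := by
  have hfin : Module.Finite (R ⧸ I) I.Cotangent := by
    have : Module.Finite R I := Module.Finite.iff_fg.2 (IsNoetherian.noetherian I)
    have : Module.Finite R I.Cotangent :=
      Module.Finite.of_surjective I.toCotangent I.toCotangent_surjective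
    exact Module.Finite.of_restrictScalars_finite R (R ⧸ I) I.Cotangent
  have hfp : FinitePresentation (R ⧸ I) I.Cotangent :=
    Module.finitePresentation_of_finite _ _
  have hle : ∀ m : Ideal (R ⧸ I), I ≤ m.comap (Ideal.Quotient.mk I) := by
    intro m x hx
    rw [Ideal.mem_comap, Ideal.Quotient.eq_zero_iff_mem.2 hx]
    exact m.zero_mem
  have key : ∀ (m : Ideal (R ⧸ I)) [m.IsPrime], Nonempty
      (LocalizedModule m.primeCompl (Fin n → R ⧸ I) ≃ₗ[Localization.AtPrime m]
        LocalizedModule m.primeCompl I.Cotangent) := by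
    intro m _
    obtain ⟨f, hf⟩ := cot_local I m n (h _ (hle m))
    exact ⟨LinearEquiv.ofBijective (LocalizedModule.map m.primeCompl f) hf⟩
  have hproj : Projective (R ⧸ I) I.Cotangent := by
    refine Module.projective_of_localization_maximal fun m hm => ?_
    obtain ⟨e⟩ := key m
    exact Projective.of_equiv e
  refine ⟨hfin, hproj, fun p => ?_⟩
  obtain ⟨e⟩ := key p.asIdeal
  have : Nontrivial (R ⧸ I) := by
    refine ⟨0, 1, fun h => p.2.ne_top ((Ideal.eq_top_iff_one _).2 (h ▸ p.asIdeal.zero_mem))⟩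
  have h1 : rankAtStalk (R := R ⧸ I) (Fin n → R ⧸ I) p = n := by
    rw [rankAtStalk_eq_finrank_of_free]; simp
  rw [← h1]
  unfold rankAtStalk
  exact e.symm.finrank_eq

end Cot

section Global
variable {R : Type*} [CommRing R]

/-- The ideal `J` attached to the data. -/
def JJ (I K : Ideal R) (a b c d e f g : R) : Ideal R :=
  I ^ 2 ⊔ K ⊔ Ideal.span {c ^ 2 * e - a * f, d ^ 2 * e - b * g}

/-- The data. -/
structure Data (I K : Ideal R) (a b c d e f g : R) : Prop where
  hK : K ≤ I
  he : e ∈ I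
  hf : f ∈ I
  hg : g ∈ I
  gen : I ≤ K ⊔ Ideal.span {e, f, g} ⊔ I ^ 2
  r1 : d * f - c * g ∈ I ^ 2
  r2 : b * f - a * g ∈ I ^ 2
  r3 : a + d - 1 ∈ I
  r4 : a * d - b * c ∈ I

namespace Data
variable {I K : Ideal R} {a b c d e f g : R}

lemma map {S : Type*} [CommRing S] (D : Data I K a b c d e f g) (φ : R →+* S) :
    Data (I.map φ) (K.map φ) (φ a) (φ b) (φ c) (φ d) (φ e) (φ f) (φ g) where
  hK := Ideal.map_mono D.hK
  he := Ideal.mem_map_of_mem _ D.he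
  hf := Ideal.mem_map_of_mem _ D.hf
  hg := Ideal.mem_map_of_mem _ D.hg
  gen := by
    have := Ideal.map_mono (f := φ) D.gen
    simpa [Ideal.map_sup, Ideal.map_pow, Ideal.map_span, Set.image_insert_eq] using this
  r1 := by
    have := Ideal.mem_map_of_mem φ D.r1
    simpa [Ideal.map_pow] using this
  r2 := by
    have := Ideal.mem_map_of_mem φ D.r2
    simpa [Ideal.map_pow] using this
  r3 := by
    have := Ideal.mem_map_of_mem φ D.r3
    simpa using this
  r4 := by
    have := Ideal.mem_map_of_mem φ D.r4
    simpa using this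

lemma map_JJ {S : Type*} [CommRing S] (φ : R →+* S) :
    (JJ I K a b c d e f g).map φ =
      JJ (I.map φ) (K.map φ) (φ a) (φ b) (φ c) (φ d) (φ e) (φ f) (φ g) := by
  simp [JJ, Ideal.map_sup, Ideal.map_pow, Ideal.map_span, Set.image_pair]


lemma memG (D : Data I K a b c d e f g) : c * e + g ∈ I := I.add_mem (I.mul_mem_left _ D.he) D.hg

lemma sq (_D : Data I K a b c d e f g) {x y : R} (hx : x ∈ I) (hy : y ∈ I) : x * y ∈ I ^ 2 := by
  rw [pow_two]; exact Ideal.mul_mem_mul hx hy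

lemma k1I (D : Data I K a b c d e f g) : c ^ 2 * e - a * f ∈ I := I.sub_mem (I.mul_mem_left _ D.he) (I.mul_mem_left _ D.hf)
lemma k2I (D : Data I K a b c d e f g) : d ^ 2 * e - b * g ∈ I := I.sub_mem (I.mul_mem_left _ D.he) (I.mul_mem_left _ D.hg)

lemma J_le (D : Data I K a b c d e f g) : JJ I K a b c d e f g ≤ I := by
  refine sup_le (sup_le (Ideal.pow_le_self two_ne_zero) D.hK) ?_
  rw [Ideal.span_le]
  rintro x (rfl | rfl)
  · exact D.k1I
  · exact D.k2I

lemma le_J (_D : Data I K a b c d e f g) : I ^ 2 ≤ JJ I K a b c d e f g := le_sup_left.trans le_sup_left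
lemma K_le (_D : Data I K a b c d e f g) : K ≤ JJ I K a b c d e f g := le_sup_right.trans le_sup_left
lemma k1J (_D : Data I K a b c d e f g) : c ^ 2 * e - a * f ∈ JJ I K a b c d e f g :=
  Ideal.mem_sup_right (Ideal.subset_span (by simp))
lemma k2J (_D : Data I K a b c d e f g) : d ^ 2 * e - b * g ∈ JJ I K a b c d e f g :=
  Ideal.mem_sup_right (Ideal.subset_span (by simp))

lemma alpha0 (D : Data I K a b c d e f g) : (c * e - a * (c * e + g)) - b * (c ^ 2 * e - a * f) - c * (d ^ 2 * e - b * g)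
    ∈ I ^ 2 := by
  have h1 := D.sq D.r3 D.he
  have h2 := D.sq D.r4 D.he
  have h3 := D.sq D.r3 D.hg
  have h4 := D.sq D.r4 D.hg
  have := Ideal.add_mem _ (Ideal.add_mem _ (Ideal.add_mem _ (Ideal.add_mem _
    (Ideal.mul_mem_left _ (-c * (1 + d)) h1) (Ideal.mul_mem_left _ c h2))
    (Ideal.mul_mem_left _ a h3)) (Ideal.mul_mem_left _ (-1) h4)) (Ideal.mul_mem_left _ a D.r2)
  convert this using 1
  ring

lemma beta0 (D : Data I K a b c d e f g) : (d * e - b * (c * e + g)) - (d ^ 2 * e - b * g) ∈ I ^ 2 := by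
  have h1 := D.sq D.r3 D.he
  have h2 := D.sq D.r4 D.he
  have := Ideal.add_mem _ h2 (Ideal.mul_mem_left _ (-d) h1)
  convert this using 1
  ring

lemma alpha (D : Data I K a b c d e f g) : c * e - a * (c * e + g) ∈ JJ I K a b c d e f g := by
  have := Ideal.add_mem _ (Ideal.add_mem _ (D.le_J D.alpha0) (Ideal.mul_mem_left _ b D.k1J))
    (Ideal.mul_mem_left _ c D.k2J)
  convert this using 1
  ring

lemma beta (D : Data I K a b c d e f g) : d * e - b * (c * e + g) ∈ JJ I K a b c d e f g := by
  have := Ideal.add_mem _ (D.le_J D.beta0) D.k2J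
  convert this using 1
  ring

lemma kk1 (D : Data I K a b c d e f g) : c ^ 2 * (d ^ 2 * e - b * g) - d ^ 2 * (c ^ 2 * e - a * f) ∈ I ^ 2 := by
  have := Ideal.add_mem _ (Ideal.mul_mem_left _ (a * d) D.r1)
    (Ideal.mul_mem_left _ c (D.sq D.r4 D.hg))
  convert this using 1
  ring

lemma kk2 (D : Data I K a b c d e f g) : b ^ 2 * (c ^ 2 * e - a * f) - a ^ 2 * (d ^ 2 * e - b * g) ∈ I ^ 2 := by
  have := Ideal.add_mem _ (Ideal.mul_mem_left _ (-(a * b)) D.r2)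
    (Ideal.mul_mem_left _ (-(a * d + b * c)) (D.sq D.r4 D.he))
  convert this using 1
  ring

/-- A general criterion for containing `I`. -/
lemma I_le (D : Data I K a b c d e f g) (T : Ideal R) (hK : K ≤ T) (h2 : I ^ 2 ≤ T) (he : e ∈ T) (hG : c * e + g ∈ T)
    (hk : c ^ 2 * e - a * f ∈ T) : I ≤ T := by
  have hg : g ∈ T := by
    have := Ideal.sub_mem _ hG (Ideal.mul_mem_left _ c he)
    simpa using this
  refine D.gen.trans (sup_le (sup_le hK ?_) h2)
  rw [Ideal.span_le]
  rintro x (rfl | rfl | rfl)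
  · exact he
  · have := Ideal.add_mem _ (Ideal.add_mem _ (Ideal.add_mem _ (Ideal.mul_mem_left _ c hG)
      (Ideal.mul_mem_left _ (-1) hk)) (h2 D.r1)) (Ideal.mul_mem_left _ (-1) (h2 (D.sq D.r3 D.hf)))
    change x ∈ T
    convert this using 1
    ring
  · exact hg

lemma I_sq_le (D : Data I K a b c d e f g) (T : Ideal R) (hT : I * JJ I K a b c d e f g ≤ T) (h1 : e ^ 2 ∈ T)
    (h2 : (c * e + g) ^ 2 ∈ T) : I ^ 2 ≤ T := by
  have hI : I ≤ Ideal.span {e, c * e + g} ⊔ JJ I K a b c d e f g :=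
    D.I_le _ (D.K_le.trans le_sup_right) (D.le_J.trans le_sup_right)
      (Ideal.mem_sup_left (Ideal.subset_span (by simp)))
      (Ideal.mem_sup_left (Ideal.subset_span (by simp)))
      (Ideal.mem_sup_right D.k1J)
  have hsp : Ideal.span {e, c * e + g} ≤ I := by
    rw [Ideal.span_le]
    rintro x (rfl | rfl)
    · exact D.he
    · exact D.memG
  have h3 : e * (c * e + g) ∈ T := by
    have t1 : e * (c * e - a * (c * e + g)) ∈ T := hT (Ideal.mul_mem_mul D.he D.alpha)
    have t2 : (c * e + g) * (d * e - b * (c * e + g)) ∈ T :=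
      hT (Ideal.mul_mem_mul D.memG D.beta)
    have t3 : (a + d - 1) * (e * (c * e + g)) ∈ T :=
      hT (Ideal.mul_mem_mul D.r3 (D.le_J (D.sq D.he D.memG)))
    have := Ideal.add_mem _ (Ideal.add_mem _ (Ideal.add_mem _ (Ideal.add_mem _
      (Ideal.mul_mem_left _ (-1) t1) t2) (Ideal.mul_mem_left _ (-1) t3))
      (Ideal.mul_mem_left _ c h1)) (Ideal.mul_mem_left _ b h2)
    convert this using 1
    ring
  calc I ^ 2 = I * I := pow_two I
    _ ≤ I * (Ideal.span {e, c * e + g} ⊔ JJ I K a b c d e f g) := Ideal.mul_mono_right hI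
    _ = I * Ideal.span {e, c * e + g} ⊔ I * JJ I K a b c d e f g := Ideal.mul_sup _ _ _
    _ ≤ T := by
      refine sup_le ?_ hT
      refine (Ideal.mul_mono_left hI).trans ?_
      rw [Ideal.sup_mul]
      refine sup_le ?_ (le_trans ?_ hT)
      · rw [Ideal.span_mul_span', Ideal.span_le]
        rintro _ ⟨x, (rfl | rfl), y, (rfl | rfl), rfl⟩
        · simpa [pow_two] using h1
        · exact h3
        · simpa [mul_comm] using h3
        · simpa [pow_two] using h2
      · rw [mul_comm]
        exact Ideal.mul_mono_left hsp

lemma cG (D : Data I K a b c d e f g) : (c * e) ^ 2 - (a * (c * e + g)) ^ 2 ∈ I * JJ I K a b c d e f g := by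
  have := Ideal.mul_mem_mul (I.add_mem (I.mul_mem_left c D.he) (I.mul_mem_left a D.memG)) D.alpha
  convert this using 1
  ring

lemma dG (D : Data I K a b c d e f g) : (d * e) ^ 2 - (b * (c * e + g)) ^ 2 ∈ I * JJ I K a b c d e f g := by
  have := Ideal.mul_mem_mul (I.add_mem (I.mul_mem_left d D.he) (I.mul_mem_left b D.memG)) D.beta
  convert this using 1
  ring

lemma cube (D : Data I K a b c d e f g) : (a + 3 * d) * a ^ 2 + (d + 3 * a) * d ^ 2 - 1 ∈ I := by
  have := I.mul_mem_left ((a + d) ^ 2 + (a + d) + 1) D.r3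
  convert this using 1
  ring

/-- Main computation: `J` is generated by `n` elements modulo `I J`. -/
lemma main (D : Data I K a b c d e f g) : ∃ u v : R, u ∈ JJ I K a b c d e f g ∧ v ∈ JJ I K a b c d e f g ∧
    JJ I K a b c d e f g ≤ K ⊔ Ideal.span {u, v} ⊔ I * JJ I K a b c d e f g := by
  obtain ⟨G, hG⟩ : ∃ G, G = c * e + g := ⟨_, rfl⟩
  obtain ⟨k, hk⟩ : ∃ k, k = c ^ 2 * e - a * f := ⟨_, rfl⟩
  obtain ⟨l, hl⟩ : ∃ l, l = d ^ 2 * e - b * g := ⟨_, rfl⟩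
  obtain ⟨p, hp⟩ : ∃ p, p = a + 3 * d := ⟨_, rfl⟩
  obtain ⟨q, hq⟩ : ∃ q, q = d + 3 * a := ⟨_, rfl⟩
  have hFI := D.he
  have hGI := D.memG
  have hkJ := D.k1J
  have hlJ := D.k2J
  have c1 := D.cG
  have c2 := D.dG
  have cu := D.cube
  have kk1 := D.kk1
  have kk2 := D.kk2
  have hsq := D.I_sq_le
  have hJ : JJ I K a b c d e f g = I ^ 2 ⊔ K ⊔ Ideal.span {c ^ 2 * e - a * f, d ^ 2 * e - b * g} :=
    rfl
  rw [← hG] at c1 c2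
  rw [← hp, ← hq] at cu
  rw [← hG] at hsq
  rw [← hG] at hGI
  rw [← hk, ← hl] at kk1 kk2
  rw [← hk] at hkJ
  rw [← hl] at hlJ
  rw [← hk, ← hl] at hJ
  have r4 := D.r4
  have le_J := D.le_J
  have K_le := D.K_le
  have sq := D.sq hFI hFI
  have sq' := D.sq hGI hGI
  generalize JJ I K a b c d e f g = J at *
  refine ⟨p * a ^ 2 * k + q * c ^ 2 * l + q * G ^ 2, p * b ^ 2 * k + q * d ^ 2 * l - p * e ^ 2,
    ?_, ?_, ?_⟩
  · refine J.add_mem (J.add_mem (J.mul_mem_left _ hkJ) (J.mul_mem_left _ hlJ))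
      (J.mul_mem_left _ (le_J ?_))
    rw [pow_two G]; exact sq'
  · refine J.sub_mem (J.add_mem (J.mul_mem_left _ hkJ) (J.mul_mem_left _ hlJ))
      (J.mul_mem_left _ (le_J ?_))
    rw [pow_two e]; exact sq
  · set h := p * a ^ 2 * k + q * c ^ 2 * l + q * G ^ 2 with hh
    set h' := p * b ^ 2 * k + q * d ^ 2 * l - p * e ^ 2 with hh'
    set T := K ⊔ Ideal.span {h, h'} ⊔ I * J with hT
    have hT1 : I * J ≤ T := le_sup_right
    have hm1 : h ∈ T := Ideal.mem_sup_left (Ideal.mem_sup_right (Ideal.subset_span (by simp)))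
    have hm2 : h' ∈ T := Ideal.mem_sup_left (Ideal.mem_sup_right (Ideal.subset_span (by simp)))
    have hk' : p * a ^ 2 * k + q * c ^ 2 * l ∈ J :=
      J.add_mem (J.mul_mem_left _ hkJ) (J.mul_mem_left _ hlJ)
    have hl' : p * b ^ 2 * k + q * d ^ 2 * l ∈ J :=
      J.add_mem (J.mul_mem_left _ hkJ) (J.mul_mem_left _ hlJ)
    have hkT : p * a ^ 2 * k + q * c ^ 2 * l ∈ T := by
      have := T.add_mem (T.add_mem (T.add_mem (T.add_mem (T.mul_mem_left (p * a ^ 2) hm1)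
        (T.mul_mem_left (q * c ^ 2) hm2))
        (T.mul_mem_left (-1) (hT1 (Ideal.mul_mem_mul cu hk'))))
        (T.mul_mem_left (q * (p * (a * d + b * c))) (hT1 (Ideal.mul_mem_mul r4 hkJ))))
        (T.mul_mem_left (p * q) (hT1 c1))
      convert this using 1
      rw [hh, hh']
      ring
    have hlT : p * b ^ 2 * k + q * d ^ 2 * l ∈ T := by
      have := T.add_mem (T.add_mem (T.add_mem (T.add_mem (T.mul_mem_left (p * b ^ 2) hm1)
        (T.mul_mem_left (q * d ^ 2) hm2))
        (T.mul_mem_left (-1) (hT1 (Ideal.mul_mem_mul cu hl'))))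
        (T.mul_mem_left (p * (q * (a * d + b * c))) (hT1 (Ideal.mul_mem_mul r4 hlJ))))
        (T.mul_mem_left (p * q) (hT1 c2))
      convert this using 1
      rw [hh, hh']
      ring
    have hqG : q * G ^ 2 ∈ T := by
      have := T.sub_mem hm1 hkT
      convert this using 1
      rw [hh]; ring
    have hpF : p * e ^ 2 ∈ T := by
      have := T.sub_mem hlT hm2
      convert this using 1
      rw [hh']; ring
    have hGT : G ^ 2 ∈ T := by
      have := T.add_mem (T.add_mem (T.add_mem (T.mul_mem_left (c ^ 2) hpF)
        (T.mul_mem_left (d ^ 2) hqG))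
        (T.mul_mem_left (-1) (hT1 (Ideal.mul_mem_mul cu (le_J sq')))))
        (T.mul_mem_left (-p) (hT1 c1))
      convert this using 1
      ring
    have hFT : e ^ 2 ∈ T := by
      have := T.add_mem (T.add_mem (T.add_mem (T.mul_mem_left (a ^ 2) hpF)
        (T.mul_mem_left (b ^ 2) hqG))
        (T.mul_mem_left (-1) (hT1 (Ideal.mul_mem_mul cu (le_J sq)))))
        (T.mul_mem_left q (hT1 c2))
      convert this using 1
      ring
    have hI2 : I ^ 2 ≤ T := hsq T hT1 hFT hGT
    rw [hJ]
    refine sup_le (sup_le hI2 (le_sup_left.trans le_sup_left)) ?_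
    rw [Ideal.span_le]
    rintro x (rfl | rfl)
    · have := T.add_mem (T.add_mem hkT
        (T.mul_mem_left (-1) (hT1 (Ideal.mul_mem_mul cu hkJ))))
        (T.mul_mem_left (-q) (hI2 kk1))
      change x ∈ T
      convert this using 1
      ring
    · have := T.add_mem (T.add_mem hlT
        (T.mul_mem_left (-1) (hT1 (Ideal.mul_mem_mul cu hlJ))))
        (T.mul_mem_left (-p) (hI2 kk2))
      change x ∈ T
      convert this using 1
      ring

/-- The local computation. -/
lemma locl (D : Data I K a b c d e f g) (hu : IsUnit a ∨ IsUnit d) : ∃ k x : R, k ∈ JJ I K a b c d e f g ∧ x ∈ I ∧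
    I ≤ K ⊔ Ideal.span {k, x} ⊔ I ^ 2 ∧
    JJ I K a b c d e f g ≤ K ⊔ Ideal.span {k, x ^ 2} ⊔ I * JJ I K a b c d e f g := by
  rcases hu with hu | hu
  · obtain ⟨a', ha'⟩ := hu.exists_right_inv
    refine ⟨c ^ 2 * e - a * f, e, D.k1J, D.he, ?_, ?_⟩
    · set T := K ⊔ Ideal.span {c ^ 2 * e - a * f, e} ⊔ I ^ 2 with hT
      have m1 : c ^ 2 * e - a * f ∈ T :=
        Ideal.mem_sup_left (Ideal.mem_sup_right (Ideal.subset_span (by simp)))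
      have m2 : e ∈ T :=
        Ideal.mem_sup_left (Ideal.mem_sup_right (Ideal.subset_span (by simp)))
      have m3 : I ^ 2 ≤ T := le_sup_right
      refine D.I_le T (le_sup_left.trans le_sup_left) m3 m2 ?_ m1
      have hk2 : d ^ 2 * e - b * g ∈ T := by
        rw [← Ideal.unit_mul_mem_iff_mem T (hu.pow 2)]
        have := T.sub_mem (T.mul_mem_left (b ^ 2) m1) (m3 D.kk2)
        simpa using this
      rw [← Ideal.unit_mul_mem_iff_mem T hu]
      have := T.add_mem (T.add_mem (T.add_mem (T.mul_mem_left c m2)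
        (T.mul_mem_left (-b) m1)) (T.mul_mem_left (-c) hk2)) (T.mul_mem_left (-1) (m3 D.alpha0))
      convert this using 1
      ring
    · set T := K ⊔ Ideal.span {c ^ 2 * e - a * f, e ^ 2} ⊔ I * JJ I K a b c d e f g with hT
      have m1 : c ^ 2 * e - a * f ∈ T :=
        Ideal.mem_sup_left (Ideal.mem_sup_right (Ideal.subset_span (by simp)))
      have m2 : e ^ 2 ∈ T :=
        Ideal.mem_sup_left (Ideal.mem_sup_right (Ideal.subset_span (by simp)))
      have m3 : I * JJ I K a b c d e f g ≤ T := le_sup_right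
      have m4 : I ^ 2 ≤ T := by
        refine D.I_sq_le T m3 m2 ?_
        rw [← Ideal.unit_mul_mem_iff_mem T (hu.pow 2)]
        have := T.sub_mem (T.mul_mem_left (c ^ 2) m2) (m3 D.cG)
        convert this using 1
        ring
      refine sup_le (sup_le m4 (le_sup_left.trans le_sup_left)) ?_
      rw [Ideal.span_le]
      rintro x (rfl | rfl)
      · exact m1
      · change _ ∈ T
        rw [← Ideal.unit_mul_mem_iff_mem T (hu.pow 2)]
        have := T.sub_mem (T.mul_mem_left (b ^ 2) m1) (m4 D.kk2)
        simpa using this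
  · refine ⟨d ^ 2 * e - b * g, c * e + g, D.k2J, D.memG, ?_, ?_⟩
    · set T := K ⊔ Ideal.span {d ^ 2 * e - b * g, c * e + g} ⊔ I ^ 2 with hT
      have m1 : d ^ 2 * e - b * g ∈ T :=
        Ideal.mem_sup_left (Ideal.mem_sup_right (Ideal.subset_span (by simp)))
      have m2 : c * e + g ∈ T :=
        Ideal.mem_sup_left (Ideal.mem_sup_right (Ideal.subset_span (by simp)))
      have m3 : I ^ 2 ≤ T := le_sup_right
      refine D.I_le T (le_sup_left.trans le_sup_left) m3 ?_ m2 ?_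
      · rw [← Ideal.unit_mul_mem_iff_mem T hu]
        have := T.add_mem (T.add_mem (T.mul_mem_left b m2) m1) (m3 D.beta0)
        convert this using 1
        ring
      · rw [← Ideal.unit_mul_mem_iff_mem T (hu.pow 2)]
        have := T.sub_mem (T.mul_mem_left (c ^ 2) m1) (m3 D.kk1)
        simpa using this
    · set T := K ⊔ Ideal.span {d ^ 2 * e - b * g, (c * e + g) ^ 2} ⊔
        I * JJ I K a b c d e f g with hT
      have m1 : d ^ 2 * e - b * g ∈ T :=
        Ideal.mem_sup_left (Ideal.mem_sup_right (Ideal.subset_span (by simp)))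
      have m2 : (c * e + g) ^ 2 ∈ T :=
        Ideal.mem_sup_left (Ideal.mem_sup_right (Ideal.subset_span (by simp)))
      have m3 : I * JJ I K a b c d e f g ≤ T := le_sup_right
      have m4 : I ^ 2 ≤ T := by
        refine D.I_sq_le T m3 ?_ m2
        rw [← Ideal.unit_mul_mem_iff_mem T (hu.pow 2)]
        have := T.add_mem (T.mul_mem_left (b ^ 2) m2) (m3 D.dG)
        convert this using 1
        ring
      refine sup_le (sup_le m4 (le_sup_left.trans le_sup_left)) ?_
      rw [Ideal.span_le]
      rintro x (rfl | rfl)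
      · change _ ∈ T
        rw [← Ideal.unit_mul_mem_iff_mem T (hu.pow 2)]
        have := T.sub_mem (T.mul_mem_left (c ^ 2) m1) (m4 D.kk1)
        simpa using this
      · exact m1

end Data
end Global

section Final
variable {R : Type*} [CommRing R]
open RingTheory.Sequence

lemma lift_gen (I : Ideal R) (s : Set I)
    (h : Submodule.span (R ⧸ I) (I.toCotangent '' s) = ⊤) :
    I ≤ Ideal.span ((↑) '' s) ⊔ I ^ 2 := by
  have key : ∀ z ∈ Submodule.span (R ⧸ I) (I.toCotangent '' s), ∃ y : I,
      (y : R) ∈ Ideal.span ((↑) '' s : Set R) ∧ I.toCotangent y = z := by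
    intro z hz
    induction hz using Submodule.span_induction with
    | mem x hx =>
      obtain ⟨y, hy, rfl⟩ := hx
      exact ⟨y, Ideal.subset_span ⟨y, hy, rfl⟩, rfl⟩
    | zero => exact ⟨0, by simp, by simp⟩
    | add x y _ _ hx hy =>
      obtain ⟨x', h1, rfl⟩ := hx
      obtain ⟨y', h2, rfl⟩ := hy
      exact ⟨x' + y', Ideal.add_mem _ h1 h2, map_add _ _ _⟩
    | smul r x _ hx =>
      obtain ⟨x', h1, rfl⟩ := hx
      obtain ⟨r, rfl⟩ := Ideal.Quotient.mk_surjective r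
      exact ⟨r • x', Ideal.mul_mem_left _ r h1, map_smul _ _ _⟩
  intro x hx
  obtain ⟨y, hy, he⟩ := key (I.toCotangent ⟨x, hx⟩) (by rw [h]; trivial)
  rw [Ideal.toCotangent_eq] at he
  have := Ideal.sub_mem _ (Ideal.mem_sup_left hy) (Ideal.mem_sup_right he : _ ∈
    Ideal.span ((↑) '' s : Set R) ⊔ I ^ 2)
  simpa using this

lemma nak {S : Type*} [CommRing S] [IsLocalRing S] [IsNoetherianRing S] (I J T : Ideal S)
    (hI : I ≤ IsLocalRing.maximalIdeal S) (hT : T ≤ J) (h : J ≤ T ⊔ I * J) : J = T := by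
  refine le_antisymm ?_ hT
  apply Submodule.le_of_le_smul_of_le_jacobson_bot (I := I)
    (IsNoetherian.noetherian _) (hI.trans (IsLocalRing.maximalIdeal_le_jacobson _))
  exact h

lemma lci_J [IsNoetherianRing R] (I : Ideal R) (l : List R) (a b c d e f g : R)
    (D : Data I (Ideal.ofList l) a b c d e f g)
    (h : ∀ (p : Ideal R) [p.IsPrime], I ≤ p →
      ∃ rs : List (Localization.AtPrime p), rs.length = l.length + 2 ∧
        RingTheory.Sequence.IsRegular (Localization.AtPrime p) rs ∧
        Ideal.map (algebraMap R (Localization.AtPrime p)) I = Ideal.span {x | x ∈ rs})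
    (p : Ideal R) [p.IsPrime] (hp : JJ I (Ideal.ofList l) a b c d e f g ≤ p) :
      ∃ rs : List (Localization.AtPrime p), rs.length = l.length + 2 ∧
        RingTheory.Sequence.IsRegular (Localization.AtPrime p) rs ∧
        Ideal.map (algebraMap R (Localization.AtPrime p)) (JJ I (Ideal.ofList l) a b c d e f g) =
          Ideal.span {x | x ∈ rs} := by
  have hIp : I ≤ p := (Ideal.IsPrime.pow_le_iff two_ne_zero).1 (D.le_J.trans hp)
  obtain ⟨rs, h1, h2, h3⟩ := h p hIp
  have : IsNoetherianRing (Localization.AtPrime p) :=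
    IsLocalization.isNoetherianRing p.primeCompl _ inferInstance
  have D' := D.map (algebraMap R (Localization.AtPrime p))
  rw [Data.map_JJ]
  rw [Ideal.map_ofList] at D' ⊢
  have hImax : I.map (algebraMap R (Localization.AtPrime p)) ≤
      IsLocalRing.maximalIdeal (Localization.AtPrime p) := by
    rw [← Localization.AtPrime.map_eq_maximalIdeal]
    exact Ideal.map_mono hIp
  have hu : IsUnit (algebraMap R (Localization.AtPrime p) a) ∨
      IsUnit (algebraMap R (Localization.AtPrime p) d) := by
    rw [IsLocalization.AtPrime.isUnit_to_map_iff _ p, IsLocalization.AtPrime.isUnit_to_map_iff _ p]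
    by_contra hcon
    simp only [Ideal.mem_primeCompl_iff, not_or, not_not] at hcon
    have := p.sub_mem (p.add_mem hcon.1 hcon.2) (hIp D.r3)
    rw [sub_sub_cancel] at this
    exact Ideal.IsPrime.ne_top ‹_› ((Ideal.eq_top_iff_one _).2 this)
  obtain ⟨k, x, hk, hx, t1, t2⟩ := D'.locl hu
  have hle := D'.J_le
  have hKJ := D'.K_le
  have hsq : x ^ 2 ∈ JJ (I.map (algebraMap R (Localization.AtPrime p)))
      (Ideal.ofList (l.map (algebraMap R (Localization.AtPrime p)))) _ _ _ _ _ _ _ :=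
    D'.le_J (Ideal.pow_mem_pow hx 2)
  have hKI := D'.hK
  generalize JJ (I.map (algebraMap R (Localization.AtPrime p))) _ _ _ _ _ _ _ _ = J at *
  set L := l.map (algebraMap R (Localization.AtPrime p)) with hL
  generalize I.map (algebraMap R (Localization.AtPrime p)) = I' at *
  have eL : ∀ z, Ideal.ofList (L ++ [k] ++ [z]) = Ideal.ofList L ⊔ Ideal.span {k, z} := by
    intro z
    rw [Ideal.ofList_append, Ideal.ofList_append, Ideal.ofList_singleton, Ideal.ofList_singleton,
      sup_assoc, ← Ideal.span_union]
    rfl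
  have hI' : I' = Ideal.ofList (L ++ [k] ++ [x]) := by
    rw [eL]
    refine nak I' I' _ hImax (sup_le hKI ?_) ?_
    · rw [Ideal.span_le]
      rintro y (rfl | rfl)
      · exact hle hk
      · exact hx
    · rwa [← pow_two]
  have hJ' : J = Ideal.ofList (L ++ [k] ++ [x ^ 2]) := by
    rw [eL]
    refine nak I' J _ hImax (sup_le hKJ ?_) t2
    rw [Ideal.span_le]
    rintro y (rfl | rfl)
    · exact hk
    · exact hsq
  have hreg := exchange rs (L ++ [k] ++ [x]) h2 (h3.symm.trans hI') (by simp [h1, hL])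
  refine ⟨L ++ [k] ++ [x ^ 2], by simp [hL], ?_, hJ'⟩
  refine IsRegular.of_isWeaklyRegular_of_mem_maximalIdeal _ ?_ (last_sq _ _ hreg.toIsWeaklyRegular)
  intro r hr
  apply hImax
  apply hle
  rw [hJ']
  exact Ideal.subset_span hr

lemma free_J [IsNoetherianRing R] (J : Ideal R) (hJne : J ≠ ⊤) (hs : List R)
    (hmem : ∀ x ∈ hs, x ∈ J) (hgen : J ≤ Ideal.ofList hs ⊔ J ^ 2)
    (h : ∀ (p : Ideal R) [p.IsPrime], J ≤ p →
      ∃ rs : List (Localization.AtPrime p), rs.length = hs.length ∧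
        RingTheory.Sequence.IsRegular (Localization.AtPrime p) rs ∧
        Ideal.map (algebraMap R (Localization.AtPrime p)) J = Ideal.span {x | x ∈ rs}) :
    Module.Free (R ⧸ J) J.Cotangent ∧ Module.rank (R ⧸ J) J.Cotangent = hs.length := by
  obtain ⟨i1, i2, hr⟩ := cot_proj J hs.length h
  have : Nontrivial (R ⧸ J) := Ideal.Quotient.nontrivial_iff.2 hJne
  let v : Fin hs.length → J.Cotangent := fun i => J.toCotangent ⟨hs.get i, hmem _ (List.get_mem _ _)⟩
  let F := Fintype.linearCombination (R ⧸ J) v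
  have hsurj : Function.Surjective F := by
    intro z
    obtain ⟨⟨z, hz⟩, rfl⟩ := J.toCotangent_surjective z
    obtain ⟨y, hy, w, hw, hyw⟩ := Submodule.mem_sup.1 (hgen hz)
    rw [Ideal.ofList, ← range_get] at hy
    obtain ⟨r, hr⟩ := (Submodule.mem_span_range_iff_exists_fun R).1 hy
    refine ⟨fun i => Ideal.Quotient.mk J (r i), ?_⟩
    rw [Fintype.linearCombination_apply]
    have e1 : ∑ i, Ideal.Quotient.mk J (r i) • v i =
        J.toCotangent (∑ i, r i • ⟨hs.get i, hmem _ (List.get_mem _ _)⟩) := by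
      rw [map_sum]
      refine Finset.sum_congr rfl fun i _ => ?_
      rw [map_smul]
      rfl
    rw [e1, Ideal.toCotangent_eq]
    have e2 : ((∑ i, r i • (⟨hs.get i, hmem _ (List.get_mem _ _)⟩ : J) : J) : R) = y := by
      rw [← hr]; simp
    rw [e2]
    change y - z ∈ _
    rw [← hyw, sub_add_cancel_left]
    exact neg_mem hw
  have hbij : Function.Bijective F := by
    refine Module.bijective_of_surjective_of_rankAtStalk_eq hsurj fun m _ => ?_
    rw [hr, rankAtStalk_eq_finrank_of_free]; simp
  let eq := LinearEquiv.ofBijective F hbij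
  refine ⟨Module.Free.of_equiv eq, ?_⟩
  have := eq.lift_rank_eq
  rw [rank_fin_fun] at this
  simpa using this.symm

theorem main_thm [IsNoetherianRing R] (I : Ideal R) (n : ℕ) (hn : 2 ≤ n) (hI : I ≠ ⊤)
    (h : ∀ (p : Ideal R) [p.IsPrime], I ≤ p →
      ∃ rs : List (Localization.AtPrime p), rs.length = n ∧
        RingTheory.Sequence.IsRegular (Localization.AtPrime p) rs ∧
        Ideal.map (algebraMap R (Localization.AtPrime p)) I = Ideal.span {x | x ∈ rs})
    (hdim : Ring.KrullDimLE 1 (R ⧸ I)) :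
    ∃ J : Ideal R, I ^ 2 ≤ J ∧ J ≤ I ∧ (∀ (p : Ideal R) [p.IsPrime], J ≤ p →
      ∃ rs : List (Localization.AtPrime p), rs.length = n ∧
        RingTheory.Sequence.IsRegular (Localization.AtPrime p) rs ∧
        Ideal.map (algebraMap R (Localization.AtPrime p)) J = Ideal.span {x | x ∈ rs}) ∧
      Module.Free (R ⧸ J) J.Cotangent ∧ Module.rank (R ⧸ J) J.Cotangent = n := by
  obtain ⟨m, rfl⟩ : ∃ m, n = m + 2 := ⟨n - 2, by omega⟩
  obtain ⟨i1, i2, hr⟩ := cot_proj I _ h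
  obtain ⟨v, M, j1, j2, hM, hsup⟩ := split (A := R ⧸ I) (m + 1) (P := I.Cotangent) hr
  obtain ⟨f0, g0, a0, b0, c0, d0, hspan, q1, q2, q3, q4⟩ := rank_one_data (P := M) hM
  choose y hy using fun i => I.toCotangent_surjective (v i)
  obtain ⟨f, hf⟩ := I.toCotangent_surjective (f0 : I.Cotangent)
  obtain ⟨g, hg⟩ := I.toCotangent_surjective (g0 : I.Cotangent)
  obtain ⟨a, rfl⟩ := Ideal.Quotient.mk_surjective a0
  obtain ⟨b, rfl⟩ := Ideal.Quotient.mk_surjective b0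
  obtain ⟨c, rfl⟩ := Ideal.Quotient.mk_surjective c0
  obtain ⟨d, rfl⟩ := Ideal.Quotient.mk_surjective d0
  let l : List R := List.ofFn (fun i : Fin m => (y i.succ : R))
  have hl : l.length = m := by simp [l]
  have hlI : ∀ x ∈ l, x ∈ I := by
    intro x hx
    obtain ⟨i, rfl⟩ := (List.mem_ofFn' _ _).1 hx
    exact (y i.succ).2
  have hMs : Submodule.span (R ⧸ I) {(f0 : I.Cotangent), (g0 : I.Cotangent)} = M := by
    have := congrArg (Submodule.map M.subtype) hspan
    rw [Submodule.map_span, Submodule.map_top, Submodule.range_subtype, Set.image_pair] at this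
    exact this
  have hgen : I ≤ Ideal.span ((↑) '' (Set.range y ∪ {f, g})) ⊔ I ^ 2 := by
    apply lift_gen
    rw [Set.image_union, Set.image_pair, hf, hg, ← Set.range_comp, Submodule.span_union, hMs]
    have : (I.toCotangent ∘ y) = v := funext hy
    rw [this, hsup]
  have hrel : ∀ r s : R, Ideal.Quotient.mk I r • f0 = Ideal.Quotient.mk I s • g0 →
      r * f - s * g ∈ I ^ 2 := by
    intro r s hrs
    have h1 : Ideal.Quotient.mk I r • (f0 : I.Cotangent) = Ideal.Quotient.mk I s • (g0 : I.Cotangent) :=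
      congrArg (Subtype.val) hrs
    rw [← hf, ← hg] at h1
    change r • I.toCotangent f = s • I.toCotangent g at h1
    rw [← map_smul, ← map_smul, Ideal.toCotangent_eq] at h1
    simpa using h1
  have D : Data I (Ideal.ofList l) a b c d (y 0) f g :=
    { hK := Ideal.span_le.2 hlI
      he := (y 0).2
      hf := f.2
      hg := g.2
      gen := by
        refine hgen.trans (sup_le_sup ?_ le_rfl)
        rw [Ideal.span_le]
        rintro _ ⟨x, (⟨i, rfl⟩ | rfl | rfl), rfl⟩
        · refine Fin.cases ?_ (fun i => ?_) i
          · exact Ideal.mem_sup_right (Ideal.subset_span (by simp))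
          · refine Ideal.mem_sup_left (Ideal.subset_span ?_)
            exact (List.mem_ofFn' _ _).2 ⟨i, rfl⟩
        · exact Ideal.mem_sup_right (Ideal.subset_span (by simp))
        · exact Ideal.mem_sup_right (Ideal.subset_span (by simp))
      r1 := hrel _ _ q1
      r2 := hrel _ _ q2
      r3 := by
        rw [← Ideal.Quotient.eq_zero_iff_mem]
        simp [q3]
      r4 := by
        rw [← Ideal.Quotient.eq_zero_iff_mem]
        simp [q4] }
  have hlci := lci_J I l a b c d _ _ _ D (by rw [hl]; exact h)
  rw [hl] at hlci
  obtain ⟨u, w, hu, hw, hmain⟩ := D.main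
  have le_J := D.le_J
  have J_le := D.J_le
  have K_le := D.K_le
  generalize JJ I (Ideal.ofList l) a b c d (y 0) f g = J at *
  have hlen : (u :: w :: l).length = m + 2 := by simp [hl]
  have hofl : Ideal.ofList (u :: w :: l) = Ideal.ofList l ⊔ Ideal.span {u, w} := by
    rw [Ideal.ofList_cons, Ideal.ofList_cons, Ideal.span_insert]
    ac_rfl
  have hmem : ∀ x ∈ (u :: w :: l), x ∈ J := by
    intro x hx
    simp only [List.mem_cons] at hx
    rcases hx with rfl | rfl | hx
    · exact hu
    · exact hw
    · exact K_le (Ideal.subset_span hx)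
  refine ⟨J, le_J, J_le, fun p _ => hlci p, ?_⟩
  rw [← hlen]
  refine free_J J (fun hh => hI (top_le_iff.1 (hh ▸ J_le))) _ hmem ?_ (fun p _ hp => ?_)
  · rw [← hofl] at hmain
    have h1 : I * J ≤ Ideal.ofList (u :: w :: l) ⊔ J ^ 2 := by
      calc I * J ≤ I * (Ideal.ofList (u :: w :: l) ⊔ I * J) := Ideal.mul_mono_right hmain
        _ = I * Ideal.ofList (u :: w :: l) ⊔ I ^ 2 * J := by rw [Ideal.mul_sup, pow_two, mul_assoc]
        _ ≤ _ := by
          refine sup_le_sup Ideal.mul_le_right ?_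
          rw [pow_two J]
          exact Ideal.mul_mono_left le_J
    exact hmain.trans (sup_le le_sup_left h1)
  · rw [hlen]; exact hlci p hp

end Final
end FS

/-- Ferrand–Szpiro: for a locally complete intersection ideal `I` of height `n ≥ 2`
with `dim (R/I) ≤ 1`, there is a locally complete intersection ideal `J` of height `n`
with `√I = √J` and `J/J²` free of rank `n` over `R/J`. -/
theorem stmt_15 {R : Type*} [CommRing R] [IsNoetherianRing R]
    (I : Ideal R) (n : ℕ) (hn : 2 ≤ n)
    (hlci : IsLocallyCompleteIntersection I n)
    (hdim : ringKrullDim (R ⧸ I) ≤ (1 : WithBot ℕ∞)) :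
    ∃ J : Ideal R, IsLocallyCompleteIntersection J n ∧
      I.radical = J.radical ∧
      Module.Free (R ⧸ J) J.Cotangent ∧
      Module.rank (R ⧸ J) J.Cotangent = n := by
  have hI : I ≠ ⊤ := by
    rintro rfl
    have h1 := hlci.1
    have h2 : idealHeight (⊤ : Ideal R) = ⊤ := by
      unfold idealHeight
      rw [iInf_eq_top]
      intro p
      rw [iInf_eq_top]
      intro hp
      exact absurd (top_le_iff.1 hp) p.2.ne_top
    rw [h2] at h1
    exact ENat.top_ne_natCast n h1
  obtain ⟨J, h1, h2, h3, h4, h5⟩ := FS.main_thm I n hn hI hlci.2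
    ((Order.krullDimLE_iff 1 _).2 hdim)
  refine ⟨J, ⟨?_, h3⟩, ?_, h4, h5⟩
  · rw [← hlci.1]
    unfold idealHeight
    refine iInf_congr fun p => ?_
    have : J ≤ p.asIdeal ↔ I ≤ p.asIdeal :=
      ⟨fun h => (p.2.pow_le_iff two_ne_zero).1 (h1.trans h), fun h => h2.trans h⟩
    simp only [this]
  · apply le_antisymm
    · rw [← Ideal.radical_pow I two_ne_zero]
      exact Ideal.radical_mono h1
    · exact Ideal.radical_mono h2
end

section
/- Let A be a commutative Noetherian ring of dimension d+1 that contains a commutative Noetherian ring R of dimension d ≥ 1 with R ⊆ A ⊆ R[T], and suppose there exists a non-zerodivisor s ∈ R with A_s = R_s[T]. Let I ⊆ A be an ideal with ht(I) ≥ 2 and suppose I = (f₀,…,f_d) + I². Then there exist F₀,…,F_d ∈ I with I = (F₀,…,F_d) and Fᵢ − fᵢ ∈ I² for all i. -/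
section Helpers
open Polynomial

/-- Coset prime avoidance. -/
lemma gs_coset_avoid {A : Type*} [CommRing A] (S : Set (Ideal A)) (hS : S.Finite)
    (hp : ∀ P ∈ S, P.IsPrime) (J : Ideal A) (hJ : ∀ P ∈ S, ¬ J ≤ P) (x : A) :
    ∃ h ∈ J, ∀ P ∈ S, x + h ∉ P := by
  classical
  set S' : Set (Ideal A) := {P | Maximal (· ∈ S) P} with hS'
  have hsub : S' ⊆ S := fun P hP => hP.1
  have hfin : S'.Finite := hS.subset hsub
  set U : Finset (Ideal A) := hfin.toFinset.filter (fun P => x ∉ P) with hU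
  set J' : Ideal A := J ⊓ U.inf id with hJ'
  have key : ¬ ((J' : Set A) ⊆ ⋃ P ∈ {P | P ∈ S' ∧ x ∈ P}, ((id P : Ideal A) : Set A)) := by
    rw [Ideal.subset_union_prime_finite (f := id) (hfin.subset fun P hP => hP.1) ⊤ ⊤
      (fun P hP _ _ => hp P (hsub hP.1))]
    rintro ⟨P, ⟨hP, hxP⟩, hle⟩
    have hPp := hp P (hsub hP)
    rcases (Ideal.IsPrime.inf_le hPp).1 hle with h | h
    · exact hJ P (hsub hP) h
    · obtain ⟨P', hP', hle'⟩ := (Ideal.IsPrime.inf_le' hPp).1 h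
      simp only [hU, Finset.mem_filter, Set.Finite.mem_toFinset] at hP'
      have : P ≤ P' := hP'.1.2 (hsub hP) hle'
      exact hP'.2 (this hxP)
  rw [Set.not_subset] at key
  obtain ⟨h, hhJ, hh⟩ := key
  refine ⟨h, hhJ.1, fun P hP hmem => ?_⟩
  obtain ⟨P', hle, hmax⟩ := hS.exists_le_maximal hP
  have hm := hle hmem
  by_cases hx : x ∈ P'
  · apply hh
    simp only [Set.mem_iUnion]
    exact ⟨P', ⟨hmax, hx⟩, (Ideal.add_mem_iff_right _ hx).1 hm⟩
  · have : h ∈ P' := by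
      have : U.inf id ≤ P' := Finset.inf_le (f := id) (by simp [hU, hx, hS']; exact hmax)
      exact this hhJ.2
    exact hx ((Ideal.add_mem_iff_left _ this).1 hm)

/-- Genericity of the first `k` elements along a ring map. -/
def GsGood {A C : Type*} [CommRing A] [CommRing C] (φ : A →+* C) (I : Ideal A) (F : ℕ → A)
    (k : ℕ) : Prop :=
  ∀ Q : Ideal C, Q.IsPrime → (∀ i < k, φ (F i) ∈ Q) → ¬ I ≤ Q.comap φ → (k : ℕ∞) ≤ Q.height

lemma gs_step {A C : Type*} [CommRing A] [CommRing C] [IsNoetherianRing C] (φ : A →+* C)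
    (I : Ideal A) (F : ℕ → A) (k : ℕ) (h : GsGood φ I F k) :
    ∃ S : Set (Ideal A), S.Finite ∧ (∀ P ∈ S, P.IsPrime ∧ ¬ I ≤ P) ∧
      ∀ F' : ℕ → A, (∀ i < k, F' i = F i) → (∀ P ∈ S, F' k ∉ P) → GsGood φ I F' (k + 1) := by
  set J : Ideal C := Ideal.span ((fun i => φ (F i)) '' {i | i < k})
  refine ⟨(Ideal.comap φ) '' {Q | Q ∈ J.minimalPrimes ∧ ¬ I ≤ Q.comap φ},
    ((Ideal.finite_minimalPrimes_of_isNoetherianRing C J).subset fun Q hQ => hQ.1).image _, ?_, ?_⟩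
  · rintro _ ⟨Q, ⟨hQ, hI⟩, rfl⟩
    have := hQ.1.1
    exact ⟨inferInstance, hI⟩
  · intro F' hF' hS Q hQ hmem hI
    have hJ : J ≤ Q := by
      rw [Ideal.span_le]
      rintro _ ⟨i, hi, rfl⟩
      have := hmem i (Nat.lt_succ_of_lt hi)
      rwa [hF' i hi] at this
    obtain ⟨Q', hQ', hle⟩ := Ideal.exists_minimalPrimes_le hJ
    have hI' : ¬ I ≤ Q'.comap φ := fun hh => hI (hh.trans (Ideal.comap_mono hle))
    have hQp := hQ'.1.1
    have h1 : (k : ℕ∞) ≤ Q'.height := h Q' hQp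
      (fun i hi => hQ'.1.2 (Ideal.subset_span ⟨i, hi, rfl⟩)) hI'
    have hlt : Q' < Q := by
      refine lt_of_le_of_ne hle fun he => ?_
      apply hS _ ⟨Q', ⟨hQ', hI'⟩, rfl⟩
      rw [Ideal.mem_comap, he]
      exact hmem k (Nat.lt_succ_self k)
    have h2 := Ideal.height_add_one_le_of_lt_of_isPrime hlt
    push_cast
    exact (add_le_add_left h1 1).trans h2

lemma gs_moving {A C₁ C₂ C₃ : Type*} [CommRing A] [CommRing C₁] [CommRing C₂] [CommRing C₃]
    [IsNoetherianRing C₁] [IsNoetherianRing C₂] [IsNoetherianRing C₃]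
    (φ₁ : A →+* C₁) (φ₂ : A →+* C₂) (φ₃ : A →+* C₃) (I : Ideal A) (f : ℕ → A) (k : ℕ) :
    ∃ F : ℕ → A, (∀ i, F i - f i ∈ I ^ 2) ∧ GsGood φ₁ I F k ∧ GsGood φ₂ I F k ∧
      GsGood φ₃ I F k := by
  induction k with
  | zero => exact ⟨f, by simp, by simp [GsGood], by simp [GsGood], by simp [GsGood]⟩
  | succ k ih =>
    obtain ⟨F, hF, h1, h2, h3⟩ := ih
    obtain ⟨S1, f1, p1, g1⟩ := gs_step φ₁ I F k h1
    obtain ⟨S2, f2, p2, g2⟩ := gs_step φ₂ I F k h2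
    obtain ⟨S3, f3, p3, g3⟩ := gs_step φ₃ I F k h3
    have hp : ∀ P ∈ S1 ∪ S2 ∪ S3, P.IsPrime ∧ ¬ I ≤ P := by
      rintro P ((h | h) | h)
      exacts [p1 P h, p2 P h, p3 P h]
    obtain ⟨h, hh, hav⟩ := gs_coset_avoid (S1 ∪ S2 ∪ S3) ((f1.union f2).union f3)
      (fun P hP => (hp P hP).1) (I ^ 2)
      (fun P hP hle => (hp P hP).2 (((hp P hP).1.pow_le_iff (by norm_num)).1 hle)) (F k)
    have hlt : ∀ i < k, Function.update F k (F k + h) i = F i := fun i hi =>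
      Function.update_of_ne hi.ne _ _
    refine ⟨Function.update F k (F k + h), ?_, g1 _ hlt ?_, g2 _ hlt ?_, g3 _ hlt ?_⟩
    · intro i
      by_cases hi : i = k
      · subst hi
        rw [Function.update_self, add_sub_right_comm]
        exact Ideal.add_mem _ (hF i) hh
      · rw [Function.update_of_ne hi]; exact hF i
    all_goals
      intro P hP
      rw [Function.update_self]
      apply hav
      simp [hP]

lemma gs_dim_quot {R : Type*} [CommRing R] (r : R) (hr : ∀ p ∈ minimalPrimes R, r ∉ p) :
    ringKrullDim (R ⧸ Ideal.span {r}) + 1 ≤ ringKrullDim R := by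
  by_cases hr' : Ideal.span {r} = ⊤
  · rw [hr', ringKrullDim_eq_bot_of_subsingleton]
    simp
  have : Nonempty (PrimeSpectrum.zeroLocus (R := R) (Ideal.span {r})) := by
    rwa [Set.nonempty_coe_sort, Set.nonempty_iff_ne_empty, ne_eq,
      PrimeSpectrum.zeroLocus_empty_iff_eq_top]
  have := Ideal.Quotient.nontrivial_iff.mpr hr'
  have := (Ideal.Quotient.mk (Ideal.span {r})).domain_nontrivial
  rw [ringKrullDim_quotient, Order.krullDim_eq_iSup_length, ringKrullDim,
    Order.krullDim_eq_iSup_length, ← WithBot.coe_one, ← WithBot.coe_add,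
    ENat.iSup_add, WithBot.coe_le_coe, iSup_le_iff]
  intro l
  obtain ⟨p, hp, hp'⟩ := Ideal.exists_minimalPrimes_le (J := l.head.1.asIdeal) bot_le
  let p' : PrimeSpectrum R := ⟨p, hp.1.1⟩
  have hp' : p' < l.head.1 := lt_of_le_of_ne hp' fun h ↦ hr p hp (by
    have h2 := l.head.2
    rw [← h] at h2
    have h3 := (PrimeSpectrum.mem_zeroLocus _ _).1 h2
    exact h3 (Ideal.subset_span rfl))
  refine le_trans ?_ (le_iSup _ ((l.map Subtype.val (Subtype.strictMono_coe _)).cons p' hp'))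
  have hcl := RelSeries.cons_length (l.map Subtype.val (Subtype.strictMono_coe _)) p' hp'
  exact le_of_eq ((Nat.cast_succ _).symm.trans (congrArg Nat.cast hcl.symm))

/-- Geometric subring localizes to a polynomial ring. -/
lemma gs_isLoc {R : Type*} [CommRing R] (A : Subalgebra R R[X]) (s : R)
    (hloc : ∀ g : R[X], ∃ n : ℕ, (C s) ^ n * g ∈ A) (M : Submonoid R) (hs : s ∈ M)
    (R' : Type*) [CommRing R'] [Algebra R R'] [IsLocalization M R'] :
    letI : Algebra A R'[X] := ((mapRingHom (algebraMap R R')).comp A.val.toRingHom).toAlgebra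
    IsLocalization (M.map (algebraMap R A)) R'[X] := by
  let _ : Algebra A R'[X] := ((mapRingHom (algebraMap R R')).comp A.val.toRingHom).toAlgebra
  have halg : ∀ a : A, algebraMap A R'[X] a = (a : R[X]).map (algebraMap R R') := fun a => rfl
  let _ : Algebra R[X] R'[X] := (mapRingHom (algebraMap R R')).toAlgebra
  have hL : IsLocalization (M.map (C : R →+* R[X])) R'[X] := Polynomial.isLocalization M R'
  have halg' : ∀ a : R[X], algebraMap R[X] R'[X] a = a.map (algebraMap R R') := fun a => rfl
  refine ⟨?_, ?_, ?_⟩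
  · rintro ⟨_, m, hm, rfl⟩
    rw [halg]
    have := IsLocalization.map_units R'[X] (⟨C m, m, hm, rfl⟩ : M.map (C : R →+* R[X]))
    exact this
  · intro z
    obtain ⟨⟨p, _, m, hm, rfl⟩, hz⟩ := IsLocalization.surj (M.map (C : R →+* R[X])) z
    obtain ⟨n, hn⟩ := hloc p
    refine ⟨⟨⟨_, hn⟩, ⟨algebraMap R A (s ^ n * m), s ^ n * m,
      M.mul_mem (M.pow_mem hs n) hm, rfl⟩⟩, ?_⟩
    simp only [halg, halg'] at hz ⊢
    have h1 : ((algebraMap R A (s ^ n * m) : A) : R[X]) = C (s ^ n * m) := rfl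
    rw [h1]
    simp only [Polynomial.map_mul, Polynomial.map_pow, C_mul, C_pow] at hz ⊢
    rw [← hz]
    ring_nf
  · intro x y hxy
    have h2 : algebraMap R[X] R'[X] x = algebraMap R[X] R'[X] y := hxy
    obtain ⟨⟨_, m, hm, rfl⟩, h⟩ := IsLocalization.exists_of_eq (M := M.map (C : R →+* R[X])) h2
    exact ⟨⟨_, m, hm, rfl⟩, Subtype.ext h⟩

lemma gs_descend {R : Type*} [CommRing R] (A : Subalgebra R R[X]) (s : R)
    (hloc : ∀ g : R[X], ∃ n : ℕ, (C s) ^ n * g ∈ A) (J : Ideal A) (x : R[X])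
    (hx : x ∈ J.map A.val.toRingHom) :
    ∃ N : ℕ, ∃ y ∈ J, (y : R[X]) = (C s) ^ N * x := by
  have hpow : ∀ n : ℕ, ((algebraMap R A s ^ n : A) : R[X]) = (C s) ^ n := fun n => rfl
  refine Submodule.span_induction (p := fun x _ => ∃ N : ℕ, ∃ y ∈ J, (y : R[X]) = (C s) ^ N * x)
    ?_ ?_ ?_ ?_ hx
  · rintro _ ⟨y, hy, rfl⟩
    exact ⟨0, y, hy, by simp⟩
  · exact ⟨0, 0, J.zero_mem, by simp⟩
  · rintro x x' - - ⟨N, y, hy, h⟩ ⟨N', y', hy', h'⟩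
    refine ⟨N + N', algebraMap R A s ^ N' * y + algebraMap R A s ^ N * y',
      J.add_mem (J.mul_mem_left _ hy) (J.mul_mem_left _ hy'), ?_⟩
    rw [A.coe_add, A.coe_mul, A.coe_mul, hpow, hpow, h, h']
    ring
  · rintro a x - ⟨N, y, hy, h⟩
    obtain ⟨n, hn⟩ := hloc a
    refine ⟨n + N, ⟨_, hn⟩ * y, J.mul_mem_left _ hy, ?_⟩
    push_cast
    rw [h, smul_eq_mul]
    ring

lemma gs_height_le_one {R : Type*} [CommRing R] [IsNoetherianRing R] (A : Subalgebra R R[X]) (s : R)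
    (hloc : ∀ g : R[X], ∃ n : ℕ, (C s) ^ n * g ∈ A) (P : Ideal A) [P.IsPrime]
    (hP : P.comap (algebraMap R A) ∈ minimalPrimes R) (hs : algebraMap R A s ∉ P) :
    P.height ≤ 1 := by
  set q := P.comap (algebraMap R A) with hq
  let R' := Localization.AtPrime q
  let _ : Algebra A R'[X] := ((mapRingHom (algebraMap R R')).comp A.val.toRingHom).toAlgebra
  have hL : IsLocalization (q.primeCompl.map (algebraMap R A)) R'[X] :=
    gs_isLoc A s hloc q.primeCompl hs R'
  have hd : Disjoint ((q.primeCompl.map (algebraMap R A) : Submonoid A) : Set A) (P : Set A) := by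
    rw [Set.disjoint_left]
    rintro _ ⟨m, hm, rfl⟩ h
    exact hm h
  rw [← IsLocalization.height_map_of_disjoint (S := R'[X]) _ P hd]
  have hne : P.map (algebraMap A R'[X]) ≠ ⊤ :=
    (IsLocalization.map_algebraMap_ne_top_iff_disjoint (q.primeCompl.map (algebraMap R A))
      R'[X] P).2 hd
  have h1 := Ideal.height_le_ringKrullDim_of_ne_top hne
  rw [Polynomial.ringKrullDim_of_isNoetherianRing,
    IsLocalization.AtPrime.ringKrullDim_eq_height q R', (Ideal.height_eq_zero_iff).2 hP] at h1
  simpa using WithBot.coe_le_coe.1 h1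

lemma gs_exists_s {R : Type*} [CommRing R] [IsNoetherianRing R]
    (A : Subalgebra R R[X]) (s : R) (hs : s ∈ nonZeroDivisors R)
    (hloc : ∀ g : R[X], ∃ n : ℕ, (C s) ^ n * g ∈ A)
    (I : Ideal A) (hI : ∀ P : Ideal A, P.IsPrime → I ≤ P → 2 ≤ P.height) :
    ∃ s₁ : R, algebraMap R A s₁ ∈ I ∧ (∀ g : R[X], ∃ n : ℕ, (C s₁) ^ n * g ∈ A) ∧
      ∀ p ∈ minimalPrimes A, algebraMap R A s₁ ∉ p := by
  have hfin : (minimalPrimes R).Finite := minimalPrimes.finite_of_isNoetherianRing R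
  have h1 : ∀ q ∈ minimalPrimes R, ¬ I.comap (algebraMap R A) ≤ q := by
    intro q hq hle
    have hq' : q ∈ (I.comap (algebraMap R A)).minimalPrimes :=
      ⟨⟨hq.1.1, hle⟩, fun p hp hpq => hq.2 ⟨hp.1, bot_le⟩ hpq⟩
    obtain ⟨P, hP, hIP, hPq⟩ := Ideal.exists_comap_eq_of_mem_minimalPrimes (algebraMap R A) q hq'
    have h2 := gs_height_le_one A s hloc P (hPq ▸ hq) (fun h => by
      have h3 : s ∈ P.comap (algebraMap R A) := h
      rw [hPq] at h3
      exact notMem_nonZeroDivisors_of_mem_mem_minimalPrimes h3 hq hs)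
    exact absurd ((hI P hP hIP).trans h2) (by norm_num)
  obtain ⟨a, haI, ha⟩ := gs_coset_avoid (minimalPrimes R) hfin (fun q hq => hq.1.1) _ h1 0
  simp only [zero_add] at ha
  refine ⟨s * a, ?_, ?_, ?_⟩
  · rw [map_mul]; exact I.mul_mem_left _ haI
  · intro g
    obtain ⟨n, hn⟩ := hloc g
    refine ⟨n, ?_⟩
    have : (C (s * a)) ^ n * g = C (a ^ n) * (C s ^ n * g) := by simp [mul_pow]; ring
    rw [this]
    exact A.mul_mem (A.algebraMap_mem _) hn
  · intro p hp hmem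
    have hpp := hp.1.1
    have hsA : algebraMap R A s ∈ nonZeroDivisors A := by
      rw [mem_nonZeroDivisors_iff_right]
      intro x hx
      have h2 : (x : R[X]) * C s = 0 := congrArg Subtype.val hx
      apply Subtype.ext
      ext k
      have h3 := congrArg (fun g => g.coeff k) h2
      simp only [coeff_mul_C, coeff_zero] at h3
      simpa using (mem_nonZeroDivisors_iff_right.1 hs) _ h3
    have hsp : algebraMap R A s ∉ p := fun h =>
      notMem_nonZeroDivisors_of_mem_mem_minimalPrimes h hp hsA
    rw [map_mul] at hmem
    have hap := (hpp.mem_or_mem hmem).resolve_left hsp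
    obtain ⟨q, hq, hqp⟩ := Ideal.exists_minimalPrimes_le
      (I := (⊥ : Ideal R)) (J := p.comap (algebraMap R A)) bot_le
    have hqq := hq.1.1
    have hCq : (q.map (C : R →+* R[X])).IsPrime := Ideal.isPrime_map_C_of_isPrime
    have hmap : (q.map (algebraMap R A)).map A.val.toRingHom = q.map (C : R →+* R[X]) := by
      rw [Ideal.map_map]; rfl
    have hle : (q.map (C : R →+* R[X])).comap A.val.toRingHom ≤ p := by
      intro x hx
      rw [Ideal.mem_comap, ← hmap] at hx
      obtain ⟨N, y, hy, hyx⟩ := gs_descend A s hloc _ _ hx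
      have hyp : y ∈ p := (Ideal.map_le_iff_le_comap.2 hqp) hy
      have : y = algebraMap R A s ^ N * x := Subtype.ext hyx
      rw [this] at hyp
      exact (hpp.mem_or_mem hyp).resolve_left fun h => hsp (hpp.mem_of_pow_mem _ h)
    have hge := hp.2 ⟨Ideal.IsPrime.comap _, bot_le⟩ hle
    have h4 : C a ∈ q.map (C : R →+* R[X]) := hge hap
    have h5 := Ideal.mem_map_C_iff.1 h4 0
    rw [coeff_C_zero] at h5
    exact ha q hq h5

/-- The multiplicative set of the `s ^ k * (1 + s * r)`. -/
def gsM {R : Type*} [CommRing R] (s : R) : Submonoid R where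
  carrier := {m | ∃ (k : ℕ) (r : R), m = s ^ k * (1 + s * r)}
  one_mem' := ⟨0, 0, by simp⟩
  mul_mem' := by
    rintro _ _ ⟨k, r, rfl⟩ ⟨k', r', rfl⟩
    exact ⟨k + k', r + r' + s * r * r', by ring⟩

lemma gs_dimM {R : Type*} [CommRing R] (s : R) (e : ℕ)
    (hR : ringKrullDim R ≤ ((e + 1 : ℕ) : WithBot ℕ∞)) :
    ringKrullDim (Localization (gsM s)) ≤ (e : WithBot ℕ∞) := by
  rw [ringKrullDim_le_iff_height_le]
  intro Q hQ
  rw [← IsLocalization.height_under (gsM s) Q]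
  set q := Q.under R with hq
  have hqp : q.IsPrime := Ideal.IsPrime.comap _
  have hdis : ∀ m ∈ gsM s, m ∉ q := fun m hm hmq =>
    hQ.ne_top (Ideal.eq_top_of_isUnit_mem _ hmq (IsLocalization.map_units _ ⟨m, hm⟩))
  have hne : q ⊔ Ideal.span {s} ≠ ⊤ := by
    intro h
    rw [Ideal.eq_top_iff_one, Submodule.mem_sup] at h
    obtain ⟨x, hx, y, hy, hxy⟩ := h
    obtain ⟨r, rfl⟩ := Ideal.mem_span_singleton'.1 hy
    refine hdis x ⟨0, -r, ?_⟩ hx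
    linear_combination hxy
  obtain ⟨m, hm, hle⟩ := Ideal.exists_le_maximal _ hne
  have hlt : q < m := by
    refine lt_of_le_of_ne (le_sup_left.trans hle) fun h => ?_
    have : s ∈ q := h ▸ hle (Ideal.mem_sup_right (Ideal.mem_span_singleton_self s))
    exact hdis s ⟨1, 0, by simp⟩ this
  have hmp := hm.isPrime
  have h1 := Ideal.height_add_one_le_of_lt_of_isPrime hlt
  have h2 : m.height ≤ ((e + 1 : ℕ) : ℕ∞) := by
    have := (ringKrullDim_le_iff_height_le _).1 hR hmp
    exact_mod_cast this
  have h3 : q.height + 1 ≤ (e : ℕ∞) + 1 := by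
    refine h1.trans (h2.trans ?_); push_cast; exact le_rfl
  have h4 : q.height ≤ (e : ℕ∞) := (ENat.add_le_add_iff_right (by simp)).1 h3
  exact_mod_cast h4

lemma gs_dimLoc {R : Type*} [CommRing R] (M : Submonoid R) (n : WithBot ℕ∞)
    (hR : ringKrullDim R ≤ n) : ringKrullDim (Localization M) ≤ n := by
  rw [ringKrullDim_le_iff_height_le]
  intro Q hQ
  rw [← IsLocalization.height_under M Q]
  have hqp : (Q.under R).IsPrime := Ideal.IsPrime.comap _
  exact (ringKrullDim_le_iff_height_le _).1 hR hqp

lemma gs_fin {A C : Type*} [CommRing A] [CommRing C] (φ : A →+* C) (I : Ideal A) (F : ℕ → A)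
    (d : ℕ) (h : GsGood φ I F (d + 1)) (hC : ringKrullDim C ≤ (d : WithBot ℕ∞))
    (Q : Ideal C) (hQ : Q.IsPrime) (hF : ∀ i < d + 1, φ (F i) ∈ Q) : I ≤ Q.comap φ := by
  by_contra hI
  have h1 := h Q hQ hF hI
  have h2 : Q.height ≤ (d : ℕ∞) := by
    have := (ringKrullDim_le_iff_height_le _).1 hC hQ
    exact_mod_cast this
  have h3 := h1.trans h2
  norm_cast at h3
  omega

lemma gs_scale {R : Type*} [CommRing R] (A : Subalgebra R R[X]) (s : R)
    (hloc : ∀ g : R[X], ∃ n : ℕ, (C s) ^ n * g ∈ A) (g : R[X]) :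
    ∃ N₀ : ℕ, ∀ N ≥ N₀, ∀ c y : R, c - 1 = s ^ N * y →
      ∃ a : A, aeval (C c * X) g - g = (C s) ^ 2 * (a : R[X]) := by
  induction g using Polynomial.induction_on' with
  | add p q hp hq =>
    obtain ⟨N1, h1⟩ := hp
    obtain ⟨N2, h2⟩ := hq
    refine ⟨max N1 N2, fun N hN c y hc => ?_⟩
    obtain ⟨a, ha⟩ := h1 N (le_of_max_le_left hN) c y hc
    obtain ⟨b, hb⟩ := h2 N (le_of_max_le_right hN) c y hc
    refine ⟨a + b, ?_⟩
    rw [map_add]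
    push_cast
    linear_combination ha + hb
  | monomial k r =>
    obtain ⟨n, hn⟩ := hloc (X ^ k)
    refine ⟨n + 2, fun N hN c y hc => ?_⟩
    obtain ⟨M, rfl⟩ := Nat.exists_eq_add_of_le hN
    obtain ⟨z, hz⟩ := sub_one_dvd_pow_sub_one c k
    refine ⟨algebraMap R A (r * s ^ M * y * z) * ⟨_, hn⟩, ?_⟩
    have h1 : ((algebraMap R A (r * s ^ M * y * z) * ⟨_, hn⟩ : A) : R[X]) =
      C (r * s ^ M * y * z) * (C s ^ n * X ^ k) := rfl
    have hz' : c ^ k = 1 + s ^ (n + 2 + M) * y * z := by rw [← hc, ← hz]; ring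
    rw [h1, aeval_monomial, ← C_mul_X_pow_eq_monomial, mul_pow, ← C_pow, hz']
    simp only [C_mul, C_pow, C_add, C_1, Polynomial.algebraMap_eq]
    ring

theorem stmt_core {R : Type*} [CommRing R] [IsNoetherianRing R]
    (d : ℕ) (hd1 : 1 ≤ d) (hR : ringKrullDim R = (d : WithBot ℕ∞))
    (A : Subalgebra R (Polynomial R)) [IsNoetherianRing A]
    (hA : ringKrullDim A = ((d + 1 : ℕ) : WithBot ℕ∞))
    (s : R)
    (hloc : ∀ g : Polynomial R, ∃ n : ℕ, (Polynomial.C s) ^ n * g ∈ A)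
    (I : Ideal A) (hsI : algebraMap R A s ∈ I)
    (hmin : ∀ p ∈ minimalPrimes A, algebraMap R A s ∉ p)
    (f : Fin (d + 1) → A) (hf : ∀ i, f i ∈ I)
    (hgen : I = Ideal.span (Set.range f) ⊔ I ^ 2) :
    ∃ F : Fin (d + 1) → A,
      I = Ideal.span (Set.range F) ∧ ∀ i, F i - f i ∈ I ^ 2 := by
  classical
  set σ : A := algebraMap R A s with hσ
  have hσpow : ∀ n : ℕ, ((σ ^ n : A) : R[X]) = (C s) ^ n := fun n => rfl
  -- dimensions
  have dim1 : ringKrullDim (A ⧸ Ideal.span {σ}) ≤ (d : WithBot ℕ∞) := by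
    have h := gs_dim_quot σ hmin
    rw [hA] at h
    have h' : ringKrullDim (A ⧸ Ideal.span {σ}) + 1 ≤ (d : WithBot ℕ∞) + 1 := by
      refine h.trans ?_; push_cast; exact le_rfl
    generalize ringKrullDim (A ⧸ Ideal.span {σ}) = z at h'
    induction z using WithBot.recBotCoe with
    | bot => exact bot_le
    | coe z =>
      have h2 : z + 1 ≤ (d : ℕ∞) + 1 := by exact_mod_cast h'
      exact_mod_cast (ENat.add_le_add_iff_right (by simp)).1 h2
  have dim2 : ringKrullDim (Localization (gsM s))[X] ≤ (d : WithBot ℕ∞) := by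
    obtain ⟨e, rfl⟩ := Nat.exists_eq_add_of_le' hd1
    have h := gs_dimM s e hR.le
    have : IsNoetherianRing (Localization (gsM s)) :=
      IsLocalization.isNoetherianRing (gsM s) _ inferInstance
    rw [Polynomial.ringKrullDim_of_isNoetherianRing]
    push_cast
    gcongr
  have dim3 : ringKrullDim (Localization (Submonoid.powers s)) ≤ (d : WithBot ℕ∞) :=
    gs_dimLoc _ _ hR.le
  have noeth2 : IsNoetherianRing (Localization (gsM s)) :=
    IsLocalization.isNoetherianRing (gsM s) _ inferInstance
  have noeth3 : IsNoetherianRing (Localization (Submonoid.powers s)) :=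
    IsLocalization.isNoetherianRing (Submonoid.powers s) _ inferInstance
  let _ : Algebra A (Localization (gsM s))[X] :=
    ((mapRingHom (algebraMap R (Localization (gsM s)))).comp A.val.toRingHom).toAlgebra
  have hsM : s ∈ gsM s := ⟨1, 0, by simp⟩
  have hL : IsLocalization ((gsM s).map (algebraMap R A)) (Localization (gsM s))[X] :=
    gs_isLoc A s hloc (gsM s) hsM _
  -- the generic lift
  obtain ⟨F, hF, g1, g2, g3⟩ := gs_moving (C₁ := A ⧸ Ideal.span {σ}) (Ideal.Quotient.mk (Ideal.span {σ}))
    (algebraMap A (Localization (gsM s))[X])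
    ((algebraMap R (Localization (Submonoid.powers s))).comp
      ((evalRingHom (0 : R)).comp A.val.toRingHom)) I
    (fun i => if h : i < d + 1 then f ⟨i, h⟩ else 0) (d + 1)
  have hF' : ∀ i : Fin (d + 1), F i - f i ∈ I ^ 2 := by
    intro i
    have h : F i - (if h : (i : ℕ) < d + 1 then f ⟨i, h⟩ else 0) ∈ I ^ 2 := hF i
    rwa [dif_pos i.2] at h
  have hI2 : I ^ 2 ≤ I := Ideal.pow_le_self two_ne_zero
  have hFI : ∀ i : Fin (d + 1), F i ∈ I := fun i => by
    have := I.add_mem (hI2 (hF' i)) (hf i)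
    simpa using this
  set J : Ideal A := Ideal.span (Set.range fun i : Fin (d + 1) => F i) with hJ
  have hFJ : ∀ i < d + 1, F i ∈ J := fun i hi => Ideal.subset_span ⟨⟨i, hi⟩, rfl⟩
  have hIJ : I ≤ J ⊔ I • I := by
    rw [smul_eq_mul, ← sq]
    conv_lhs => rw [hgen]
    refine sup_le (Ideal.span_le.2 ?_) le_sup_right
    rintro _ ⟨i, rfl⟩
    have : f i = F i - (F i - f i) := by ring
    rw [this]
    exact Ideal.sub_mem _ (Ideal.mem_sup_left (hFJ i i.2)) (Ideal.mem_sup_right (hF' i))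
  obtain ⟨r, hr1, hr2⟩ := Submodule.exists_sub_one_mem_and_smul_le_of_fg_of_le_sup
    (IsNoetherian.noetherian I) le_rfl hIJ
  have hr3 : ∀ x ∈ I, r * x ∈ J := fun x hx =>
    hr2 (Submodule.smul_mem_pointwise_smul x r I hx)
  have hK : ∃ k a : A, (∀ x ∈ I, k * x ∈ J) ∧ k + a * σ = 1 := by
    let K : Ideal A :=
      { carrier := {k | ∀ x ∈ I, k * x ∈ J}
        add_mem' := fun {a b} ha hb x hx => by
          rw [add_mul]; exact J.add_mem (ha x hx) (hb x hx)
        zero_mem' := fun x _ => by simp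
        smul_mem' := fun c a ha x hx => by
          rw [smul_eq_mul, mul_assoc]; exact J.mul_mem_left _ (ha x hx) }
    have htop : K ⊔ Ideal.span {σ} = ⊤ := by
      by_contra hne
      obtain ⟨Q, hQ, hle⟩ := Ideal.exists_le_maximal _ hne
      have hQp := hQ.isPrime
      have hJK : J ≤ K := fun j hj x _ => J.mul_mem_right _ hj
      have hker : RingHom.ker (Ideal.Quotient.mk (Ideal.span {σ})) ≤ Q := by
        rw [Ideal.mk_ker]; exact le_sup_right.trans hle
      have hQ' : (Q.map (Ideal.Quotient.mk (Ideal.span {σ}))).IsPrime :=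
        Ideal.map_isPrime_of_surjective Ideal.Quotient.mk_surjective hker
      have h1 := gs_fin _ I F d g1 dim1 _ hQ' (fun i hi => Ideal.mem_map_of_mem _
        (hle (Ideal.mem_sup_left (hJK (hFJ i hi)))))
      rw [Ideal.comap_map_of_surjective' _ Ideal.Quotient.mk_surjective, sup_eq_left.2 hker] at h1
      have h2 : r ∈ Q := hle (Ideal.mem_sup_left hr3)
      have h3 := Q.sub_mem h2 (h1 hr1)
      rw [sub_sub_cancel] at h3
      exact hQp.ne_top ((Ideal.eq_top_iff_one _).2 h3)
    rw [Ideal.eq_top_iff_one, Submodule.mem_sup] at htop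
    obtain ⟨k, hk, y, hy, hky⟩ := htop
    obtain ⟨a, rfl⟩ := Ideal.mem_span_singleton'.1 hy
    exact ⟨k, a, hk, hky⟩
  -- unimodularity over the second localization
  have hU2 : ∃ (k : ℕ) (r : R), algebraMap R A (s ^ k * (1 + s * r)) ∈ J := by
    have h := (IsLocalization.map_algebraMap_ne_top_iff_disjoint ((gsM s).map (algebraMap R A))
      (Localization (gsM s))[X] J).not
    have htop : J.map (algebraMap A (Localization (gsM s))[X]) = ⊤ := by
      by_contra hne
      obtain ⟨Q, hQ, hle⟩ := Ideal.exists_le_maximal _ hne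
      have h1 := gs_fin _ I F d g2 dim2 Q hQ.isPrime
        (fun i hi => hle (Ideal.mem_map_of_mem _ (hFJ i hi)))
      exact hQ.ne_top (Ideal.eq_top_of_isUnit_mem _ (h1 hsI)
        (IsLocalization.map_units _ (⟨σ, s, hsM, rfl⟩ : (gsM s).map (algebraMap R A))))
    have h2 := h.1 (by simpa using htop)
    rw [Set.not_disjoint_iff] at h2
    obtain ⟨_, ⟨_, ⟨k, r, rfl⟩, rfl⟩, hm⟩ := h2
    exact ⟨k, r, hm⟩
  -- unimodularity at `T = 0`
  have hU3 : ∃ m : ℕ, s ^ m ∈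
      Ideal.span (Set.range fun i : Fin (d + 1) => eval 0 (F i : R[X])) := by
    set J0 : Ideal R := Ideal.span (Set.range fun i : Fin (d + 1) => eval 0 (F i : R[X]))
    have h := (IsLocalization.map_algebraMap_ne_top_iff_disjoint (Submonoid.powers s)
      (Localization (Submonoid.powers s)) J0).not
    have htop : J0.map (algebraMap R (Localization (Submonoid.powers s))) = ⊤ := by
      by_contra hne
      obtain ⟨Q, hQ, hle⟩ := Ideal.exists_le_maximal _ hne
      have h1 := gs_fin _ I F d g3 dim3 Q hQ.isPrime
        (fun i hi => hle (Ideal.mem_map_of_mem _ (Ideal.subset_span ⟨⟨i, hi⟩, rfl⟩)))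
      have h2 := h1 hsI
      have h3 : algebraMap R (Localization (Submonoid.powers s)) s ∈ Q := by
        have h4 : eval 0 ((σ : A) : R[X]) = s := eval_C
        rw [Ideal.mem_comap] at h2
        change algebraMap R _ (eval 0 ((σ : A) : R[X])) ∈ Q at h2
        rwa [h4] at h2
      exact hQ.ne_top (Ideal.eq_top_of_isUnit_mem _ h3
        (IsLocalization.map_units _ (⟨s, Submonoid.mem_powers s⟩ : Submonoid.powers s)))
    have h2 := h.1 (by simpa using htop)
    rw [Set.not_disjoint_iff] at h2
    obtain ⟨_, ⟨m, rfl⟩, hm⟩ := h2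
    exact ⟨m, hm⟩
  obtain ⟨k₀, r₀, hU2⟩ := hU2
  obtain ⟨m₀, hU3⟩ := hU3
  set t : R := 1 + s * r₀ with ht
  -- the scaling
  choose N₀ hN₀ using fun i : Fin (d + 1) => gs_scale A s hloc (F i : R[X])
  set N : ℕ := Finset.univ.sup N₀ with hN
  have hcop : IsCoprime t (s ^ N) := by
    apply IsCoprime.pow_right
    exact ⟨1, -r₀, by rw [ht]; ring⟩
  obtain ⟨u, v, huv⟩ := hcop
  set c : R := u * t with hc
  have hc1 : c - 1 = s ^ N * (-v) := by rw [hc]; linear_combination huv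
  choose a ha using fun i : Fin (d + 1) =>
    hN₀ i N (Finset.le_sup (Finset.mem_univ i)) c (-v) hc1
  set G : Fin (d + 1) → A := fun i => F i + σ ^ 2 * a i with hG
  have hGcoe : ∀ i, (G i : R[X]) = aeval (C c * X) (F i : R[X]) := by
    intro i
    have h1 : (G i : R[X]) = (F i : R[X]) + C s ^ 2 * (a i : R[X]) := rfl
    rw [h1, ← ha i]; ring
  have hσ2 : ∀ x : A, σ ^ 2 * x ∈ I ^ 2 := fun x =>
    Ideal.mul_mem_right _ _ (Ideal.pow_mem_pow hsI 2)
  set L : Ideal A := Ideal.span (Set.range G) with hLdef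
  have hGL : ∀ i, G i ∈ L := fun i => Ideal.subset_span ⟨i, rfl⟩
  have hGI : ∀ i, G i ∈ I := fun i => I.add_mem (hFI i) (hI2 (hσ2 _))
  -- a power of s lies in L
  have hpow : ∃ n : ℕ, σ ^ n ∈ L := by
    have hrad : C s ∈ (L.map A.val.toRingHom).radical := by
      rw [Ideal.radical_eq_sInf, Ideal.mem_sInf]
      rintro Q ⟨hQ, hQp⟩
      have hGQ : ∀ i : Fin (d + 1), aeval (C c * X) (F i : R[X]) ∈ Q := fun i => by
        rw [← hGcoe]
        exact hQ (Ideal.mem_map_of_mem A.val.toRingHom (hGL i))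
      by_contra hsQ
      have h1 : J ≤ Q.comap (((aeval (C c * X) : R[X] →ₐ[R] R[X]).toRingHom).comp
          A.val.toRingHom) := by
        rw [hJ, Ideal.span_le]
        rintro _ ⟨i, rfl⟩
        exact hGQ i
      have h2 : C (s ^ k₀ * t) ∈ Q := by
        have h3 := h1 hU2
        rw [Ideal.mem_comap] at h3
        have h4 : ((aeval (C c * X) : R[X] →ₐ[R] R[X]).toRingHom).comp
          A.val.toRingHom (algebraMap R A (s ^ k₀ * t)) = C (s ^ k₀ * t) :=
          aeval_C (C c * X) (s ^ k₀ * t)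
        rwa [h4] at h3
      rw [C_mul, C_pow] at h2
      have h5 : C t ∈ Q := (hQp.mem_or_mem h2).resolve_left
        fun h => hsQ (hQp.mem_of_pow_mem _ h)
      have h6 : C c ∈ Q := by rw [hc, C_mul]; exact Q.mul_mem_left _ h5
      have h7 : Ideal.span (Set.range fun i : Fin (d + 1) => eval 0 (F i : R[X])) ≤
          Q.comap C := by
        rw [Ideal.span_le]
        rintro _ ⟨i, rfl⟩
        change C (eval 0 (F i : R[X])) ∈ Q
        have h8 := hGQ i
        rw [← divX_mul_X_add (F i : R[X]), map_add, map_mul, aeval_X, aeval_C] at h8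
        have h9 : aeval (C c * X) (divX (F i : R[X])) * (C c * X) ∈ Q :=
          Q.mul_mem_left _ (Q.mul_mem_right _ h6)
        have h10 := (Ideal.add_mem_iff_right _ h9).1 h8
        rwa [← coeff_zero_eq_eval_zero]
      have h11 : C (s ^ m₀) ∈ Q := h7 hU3
      rw [C_pow] at h11
      exact hsQ (hQp.mem_of_pow_mem _ h11)
    obtain ⟨n, hn⟩ := hrad
    obtain ⟨M, y, hy, hyx⟩ := gs_descend A s hloc L _ hn
    refine ⟨M + n, ?_⟩
    have : y = σ ^ (M + n) := Subtype.ext (by rw [hyx, hσpow, pow_add])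
    rwa [← this]
  -- conclusion
  have hstep : ∀ x ∈ I, ∃ l ∈ L, ∃ y ∈ I, x = l + σ * y := by
    have hJL : J ≤ L ⊔ Ideal.span {σ} * I := by
      rw [hJ, Ideal.span_le]
      rintro _ ⟨i, rfl⟩
      have : F i = G i - σ * (σ * a i) := by simp only [hG]; ring
      change F i ∈ _
      rw [this]
      exact Ideal.sub_mem _ (Ideal.mem_sup_left (hGL i)) (Ideal.mem_sup_right
        (Ideal.mul_mem_mul (Ideal.mem_span_singleton_self σ) (I.mul_mem_right _ hsI)))
    obtain ⟨k, b, hk, hkb⟩ := hK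
    intro x hx
    obtain ⟨l, hl, z, hz, hlz⟩ := Submodule.mem_sup.1 (hJL (hk x hx))
    obtain ⟨y, hy, rfl⟩ := Ideal.mem_span_singleton_mul.1 hz
    refine ⟨l, hl, y + b * x, I.add_mem hy (I.mul_mem_left _ hx), ?_⟩
    linear_combination (-x) * hkb - hlz
  have hiter : ∀ n : ℕ, ∀ x ∈ I, ∃ l ∈ L, ∃ y ∈ I, x = l + σ ^ n * y := by
    intro n
    induction n with
    | zero => exact fun x hx => ⟨0, L.zero_mem, x, hx, by simp⟩
    | succ n ih =>
      intro x hx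
      obtain ⟨l, hl, y, hy, rfl⟩ := ih x hx
      obtain ⟨l', hl', y', hy', rfl⟩ := hstep y hy
      exact ⟨l + σ ^ n * l', L.add_mem hl (L.mul_mem_left _ hl'), y', hy', by ring⟩
  refine ⟨G, le_antisymm ?_ ?_, ?_⟩
  · intro x hx
    obtain ⟨n, hn⟩ := hpow
    obtain ⟨l, hl, y, hy, rfl⟩ := hiter n x hx
    exact L.add_mem hl (L.mul_mem_right _ hn)
  · rw [Ideal.span_le]
    rintro _ ⟨i, rfl⟩
    exact hGI i
  · intro i
    have : G i - f i = (F i - f i) + σ ^ 2 * a i := by simp only [hG]; ring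
    rw [this]
    exact Ideal.add_mem _ (hF' i) (hσ2 _)

end Helpers

/-- Efficient generation in a geometric subring `A` of `R[T]` (Noetherian of
dimension `d+1`, `R ⊆ A ⊆ R[T]`, `A_s = R_s[T]` for a non-zerodivisor `s ∈ R`):
an ideal `I` of height `≥ 2` with `I = (f₀,…,f_d) + I²` satisfies
`I = (F₀,…,F_d)` with `Fᵢ - fᵢ ∈ I²`. -/
theorem stmt_17 {R : Type*} [CommRing R] [IsNoetherianRing R]
    (d : ℕ) (hd1 : 1 ≤ d) (hR : ringKrullDim R = (d : WithBot ℕ∞))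
    (A : Subalgebra R (Polynomial R)) [IsNoetherianRing A]
    (hA : ringKrullDim A = ((d + 1 : ℕ) : WithBot ℕ∞))
    (s : R) (hs : s ∈ nonZeroDivisors R)
    (hloc : ∀ g : Polynomial R, ∃ n : ℕ, (Polynomial.C s) ^ n * g ∈ A)
    (I : Ideal A) (hht : 2 ≤ idealHeight I)
    (f : Fin (d + 1) → A) (hf : ∀ i, f i ∈ I)
    (hgen : I = Ideal.span (Set.range f) ⊔ I ^ 2) :
    ∃ F : Fin (d + 1) → A,
      I = Ideal.span (Set.range F) ∧ ∀ i, F i - f i ∈ I ^ 2 := by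
  have hI : ∀ P : Ideal A, P.IsPrime → I ≤ P → 2 ≤ P.height := by
    intro P hP hle
    have h1 : idealHeight I ≤ Order.height (⟨P, hP⟩ : PrimeSpectrum A) :=
      iInf₂_le (⟨P, hP⟩ : PrimeSpectrum A) hle
    have h2 := PrimeSpectrum.height_eq_orderHeight (⟨P, hP⟩ : PrimeSpectrum A)
    exact (hht.trans h1).trans h2.ge
  obtain ⟨s₁, h1, h2, h3⟩ := gs_exists_s A s hs hloc I hI
  exact stmt_core d hd1 hR A hA s₁ h2 I h1 h3 f hf hgen
end

section
/- Let A be a commutative Noetherian ring of dimension d+1 with R ⊆ A ⊆ R[T] where R is Noetherian of dimension d ≥ 1, and A_s = R_s[T] for some non-zerodivisor s ∈ R. Then every ideal I of A with ht(I) = d+1 such that I/I² is generated by d+1 elements is generated by d+1 elements (I is a complete intersection ideal). -/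
open Polynomial

lemma coset_avoid {A : Type*} [CommRing A] (T : Set (Ideal A)) (hT : T.Finite)
    (hp : ∀ Q ∈ T, Q.IsPrime) (e f : A) (he : ∀ Q ∈ T, e ∉ Q) :
    ∃ b, ∀ Q ∈ T, f + e * b ∉ Q := by
  classical
  lift T to Finset (Ideal A) using hT
  simp only [Finset.mem_coe] at *
  let M := T.filter (fun Q => Maximal (· ∈ T) Q)
  let M1 := M.filter (fun Q => f ∉ Q)
  let M2 := M.filter (fun Q => f ∈ Q)
  have hav : ¬ (((M1.inf id : Ideal A) : Set A) ⊆ ⋃ Q ∈ (M2 : Set (Ideal A)), (Q : Set A)) := by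
    intro h
    have hpr : ∀ Q ∈ (M2 : Set (Ideal A)), Q ≠ (⊥ : Ideal A) → Q ≠ (⊥ : Ideal A) →
        (id Q : Ideal A).IsPrime := by
      intro Q hQ _ _
      exact hp Q (Finset.mem_filter.1 (Finset.mem_filter.1 hQ).1).1
    obtain ⟨Q, hQ, hle⟩ := (Ideal.subset_union_prime_finite (M2.finite_toSet) (f := id)
      ⊥ ⊥ hpr).1 h
    have hQ' := Finset.mem_filter.1 hQ
    have hQM := Finset.mem_filter.1 hQ'.1
    obtain ⟨Q', hQ'1, hle'⟩ := (Ideal.IsPrime.inf_le' (hp Q hQM.1)).1 hle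
    have h1 := Finset.mem_filter.1 hQ'1
    have h1M := Finset.mem_filter.1 h1.1
    exact h1.2 (h1M.2.2 hQM.1 hle' hQ'.2)
  obtain ⟨b, hb1, hb2⟩ := Set.not_subset.1 hav
  refine ⟨b, fun Q hQ hmem => ?_⟩
  obtain ⟨Q', hle, hmax⟩ := Finset.exists_le_maximal T hQ
  have hM : Q' ∈ M := Finset.mem_filter.2 ⟨hmax.1, hmax⟩
  have hm' := hle hmem
  have hpr := hp Q' hmax.1
  by_cases hf : f ∈ Q'
  · have : e * b ∈ Q' := (Ideal.add_mem_iff_right _ hf).1 hm'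
    rcases hpr.mem_or_mem this with h | h
    · exact he Q' hmax.1 h
    · apply hb2
      simp only [Set.mem_iUnion]
      exact ⟨Q', Finset.mem_filter.2 ⟨hM, hf⟩, h⟩
  · have hbQ : b ∈ Q' := by
      have : M1.inf id ≤ Q' := Finset.inf_le (f := id) (Finset.mem_filter.2 ⟨hM, hf⟩)
      exact this hb1
    exact hf ((Ideal.add_mem_iff_left _ (Q'.mul_mem_left _ hbQ)).1 hm')

lemma gen_pos {A B C : Type*} [CommRing A] [CommRing B] [CommRing C]
    [IsNoetherianRing B] [IsNoetherianRing C] (φ : A →+* B) (ψ : A →+* C) (e : A)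
    (J : Ideal B) (k : ℕ) (hJ : ∀ P : Ideal B, P.IsPrime → J ≤ P → φ e ∉ P → (k : ℕ∞) ≤ P.height)
    (n : ℕ) (f : Fin n → A) :
    ∃ b : Fin n → A,
      (∀ P : Ideal B, P.IsPrime → J ≤ P → (∀ i, φ (f i + e * b i) ∈ P) → φ e ∉ P →
        ((k + n : ℕ) : ℕ∞) ≤ P.height) ∧
      (∀ P : Ideal C, P.IsPrime → (∀ i, ψ (f i + e * b i) ∈ P) → ψ e ∉ P →
        (n : ℕ∞) ≤ P.height) := by
  induction n with
  | zero => exact ⟨fun _ => 0, fun P hP h1 _ h2 => by simpa using hJ P hP h1 h2, by simp⟩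
  | succ n ih =>
    obtain ⟨b, hb1, hb2⟩ := ih (fun i => f i.castSucc)
    let K : Ideal B := J ⊔ Ideal.span (Set.range fun i => φ (f i.castSucc + e * b i))
    let K' : Ideal C := Ideal.span (Set.range fun i => ψ (f i.castSucc + e * b i))
    let T1 : Set (Ideal A) := Ideal.comap φ '' {Q | Q ∈ K.minimalPrimes ∧ φ e ∉ Q}
    let T2 : Set (Ideal A) := Ideal.comap ψ '' {Q | Q ∈ K'.minimalPrimes ∧ ψ e ∉ Q}
    have hT1 : T1.Finite := ((Ideal.finite_minimalPrimes_of_isNoetherianRing B K).subset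
      (fun _ h => h.1)).image _
    have hT2 : T2.Finite := ((Ideal.finite_minimalPrimes_of_isNoetherianRing C K').subset
      (fun _ h => h.1)).image _
    obtain ⟨c, hc⟩ := coset_avoid (T1 ∪ T2) (hT1.union hT2) (by
      rintro _ (⟨Q, ⟨hQ, _⟩, rfl⟩ | ⟨Q, ⟨hQ, _⟩, rfl⟩)
      · have := hQ.1.1
        infer_instance
      · have := hQ.1.1
        infer_instance) e (f (Fin.last n)) (by
      rintro _ (⟨Q, ⟨_, h⟩, rfl⟩ | ⟨Q, ⟨_, h⟩, rfl⟩)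
      · exact h
      · exact h)
    refine ⟨Fin.snoc b c, ?_, ?_⟩
    · intro P hP hJP hPf heP
      have hKP : K ≤ P := by
        refine sup_le hJP (Ideal.span_le.2 ?_)
        rintro _ ⟨i, rfl⟩
        simpa using hPf i.castSucc
      obtain ⟨Q, hQ, hQP⟩ := Ideal.exists_minimalPrimes_le hKP
      have hQp := hQ.1.1
      have heQ : φ e ∉ Q := fun h => heP (hQP h)
      have h1 := hb1 Q hQp (le_sup_left.trans hQ.1.2) (fun i => hQ.1.2
        (Ideal.mem_sup_right (Ideal.subset_span ⟨i, rfl⟩))) heQ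
      have h2 := hc _ (Or.inl ⟨Q, ⟨hQ, heQ⟩, rfl⟩)
      have hlt : Q < P := by
        refine lt_of_le_of_ne hQP ?_
        rintro rfl
        apply h2
        simpa using hPf (Fin.last n)
      refine le_trans ?_ (Ideal.height_add_one_le_of_lt_of_isPrime hlt)
      rw [← add_assoc, Nat.cast_add]
      exact add_le_add_left h1 1
    · intro P hP hPf heP
      have hKP : K' ≤ P := by
        refine (Ideal.span_le.2 ?_)
        rintro _ ⟨i, rfl⟩
        simpa using hPf i.castSucc
      obtain ⟨Q, hQ, hQP⟩ := Ideal.exists_minimalPrimes_le hKP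
      have hQp := hQ.1.1
      have heQ : ψ e ∉ Q := fun h => heP (hQP h)
      have h1 := hb2 Q hQp (fun i => hQ.1.2
        ((Ideal.subset_span ⟨i, rfl⟩))) heQ
      have h2 := hc _ (Or.inr ⟨Q, ⟨hQ, heQ⟩, rfl⟩)
      have hlt : Q < P := by
        refine lt_of_le_of_ne hQP ?_
        rintro rfl
        apply h2
        simpa using hPf (Fin.last n)
      refine le_trans ?_ (Ideal.height_add_one_le_of_lt_of_isPrime hlt)
      rw [Nat.cast_add]
      exact add_le_add_left h1 1

/-- Nakayama: an idempotent-like element. -/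
lemma exists_e {A : Type*} [CommRing A] (I N : Ideal A) (hI : I.FG) (h : I ≤ N ⊔ I ^ 2) :
    ∃ e ∈ I ^ 2, ∀ x ∈ I, (1 - e) * x ∈ N := by
  obtain ⟨r, hr, hrN⟩ := Submodule.exists_sub_one_mem_and_smul_le_of_fg_of_le_sup (I := I)
    (N := N) (N' := I) (P := I) hI le_rfl (by simpa [pow_two] using h)
  refine ⟨(r - 1) ^ 2, Ideal.pow_mem_pow hr 2, fun x hx => ?_⟩
  have : r * x ∈ N := hrN (Submodule.smul_mem_pointwise_smul x r I hx)
  have e : (1 - (r - 1) ^ 2) * x = (2 - r) * (r * x) := by ring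
  rw [e]
  exact N.mul_mem_left _ this

lemma nak {A : Type*} [CommRing A] (I N : Ideal A) (hI : I.FG) (h : I ≤ N ⊔ I ^ 2)
    (hP : ∀ P : Ideal A, P.IsPrime → N ≤ P → I ≤ P) : I ≤ N := by
  obtain ⟨e, he, heN⟩ := exists_e I N hI h
  have htop : N ⊔ Ideal.span {1 - e} = ⊤ := by
    by_contra hne
    obtain ⟨m, hm, hle⟩ := Ideal.exists_le_maximal _ hne
    have h1 := hP m hm.isPrime (le_sup_left.trans hle)
    have h2 : e ∈ m := h1 (Ideal.pow_le_self two_ne_zero he)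
    have h3 : 1 - e ∈ m := hle (Ideal.mem_sup_right (Ideal.mem_span_singleton_self _))
    exact hm.ne_top ((Ideal.eq_top_iff_one _).2 (by simpa using add_mem h3 h2))
  intro x hx
  have h1 : (1 : A) ∈ N ⊔ Ideal.span {1 - e} := htop ▸ trivial
  obtain ⟨y, hy, z, hz, hyz⟩ := Submodule.mem_sup.1 h1
  obtain ⟨w, rfl⟩ := Ideal.mem_span_singleton'.1 hz
  have : x = y * x + w * ((1 - e) * x) := by linear_combination (-x) * hyz
  rw [this]
  exact add_mem (N.mul_mem_right _ hy) (N.mul_mem_left _ (heN x hx))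

section
variable {R : Type*} [CommRing R]

lemma denom (A : Subalgebra R R[X]) (s : R) (hloc : ∀ g : R[X], ∃ n : ℕ, (C s) ^ n * g ∈ A)
    (D : ℕ) : ∃ N : ℕ, ∀ g : R[X], g.natDegree ≤ D → (C s) ^ N * g ∈ A := by
  choose n hn using fun k : ℕ => hloc (X ^ k)
  refine ⟨∑ k ∈ Finset.range (D + 1), n k, fun g hg => ?_⟩
  rw [g.as_sum_range_C_mul_X_pow' (Nat.lt_succ_of_le hg), Finset.mul_sum]
  refine sum_mem fun k hk => ?_
  obtain ⟨m, hm⟩ := Nat.exists_eq_add_of_le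
    (Finset.single_le_sum (f := n) (fun _ _ => Nat.zero_le _) hk)
  rw [hm]
  have : (C s) ^ (n k + m) * (C (g.coeff k) * X ^ k) =
      algebraMap R R[X] (s ^ m * g.coeff k) * ((C s) ^ n k * X ^ k) := by
    simp only [Polynomial.algebraMap_eq, C_mul, C_pow]; ring
  rw [this]
  exact A.mul_mem (A.algebraMap_mem _) (hn k)

lemma comp_sub (f : R[X]) (t : R) : ∃ q : R[X], q.natDegree ≤ f.natDegree ∧
    f.comp (C t * X) = f + C (1 - t) * q := by
  refine ⟨- ∑ k ∈ Finset.range (f.natDegree + 1),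
    C (f.coeff k * ∑ j ∈ Finset.range k, t ^ j) * X ^ k, ?_, ?_⟩
  · rw [natDegree_neg]
    refine natDegree_sum_le_of_forall_le _ _ fun k hk => ?_
    exact (natDegree_C_mul_X_pow_le _ _).trans (Nat.lt_succ_iff.1 (Finset.mem_range.1 hk))
  · conv_lhs => rw [f.as_sum_range_C_mul_X_pow]
    conv_rhs => lhs; rw [f.as_sum_range_C_mul_X_pow]
    rw [mul_neg, Finset.mul_sum, ← sub_eq_add_neg, ← Finset.sum_sub_distrib, Polynomial.sum_comp]
    refine Finset.sum_congr rfl fun k _ => ?_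
    have hg : (∑ j ∈ Finset.range k, t ^ j) * (1 - t) = 1 - t ^ k := by
      have := geom_sum_mul_neg t k
      simpa using this
    have : C (1 - t) * (C (f.coeff k * ∑ j ∈ Finset.range k, t ^ j) * X ^ k) =
      C (f.coeff k) * C ((∑ j ∈ Finset.range k, t ^ j) * (1 - t)) * X ^ k := by
      simp only [C_mul]; ring
    rw [this, hg]
    simp [mul_pow]
    ring

lemma comp_zero (f : R[X]) (t : R) : ∃ q : R[X],
    f.comp (C t * X) = C (f.eval 0) + C t * q := by
  refine ⟨X * f.divX.comp (C t * X), ?_⟩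
  conv_lhs => rw [← f.divX_mul_X_add]
  simp [coeff_zero_eq_eval_zero]
  ring

/-- The height bound. -/
lemma height_contract [IsNoetherianRing R]
    (d : ℕ) (hR : ringKrullDim R = (d : WithBot ℕ∞))
    (A : Subalgebra R R[X]) (s : R)
    (hloc : ∀ g : R[X], ∃ n : ℕ, (C s) ^ n * g ∈ A)
    (P : Ideal A) [hP : P.IsPrime] (hs : algebraMap R A s ∉ P)
    (hht : ((d + 1 : ℕ) : ℕ∞) ≤ P.height) :
    (d : ℕ∞) ≤ (P.comap (algebraMap R A)).height := by
  let L := Localization.Away (C s : R[X])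
  let _ : Algebra A L := ((algebraMap R[X] L).comp A.val.toRingHom).toAlgebra
  have hmap : ∀ x : A, algebraMap A L x = algebraMap R[X] L (x : R[X]) := fun _ => rfl
  have hval : ∀ n : ℕ, ((algebraMap R A s ^ n : A) : R[X]) = C s ^ n := fun _ => rfl
  have hloc1 : IsLocalization.Away (algebraMap R A s) L := by
    refine ⟨?_, ?_, ?_⟩
    · rintro ⟨_, n, rfl⟩
      simp only [hmap, hval, map_pow]
      exact (IsLocalization.Away.algebraMap_isUnit (S := L) (C s)).pow n
    · intro z
      obtain ⟨⟨g, ⟨_, n, rfl⟩⟩, hz⟩ := IsLocalization.surj (Submonoid.powers (C s)) z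
      obtain ⟨m, hm⟩ := hloc g
      refine ⟨(⟨_, hm⟩, ⟨_, n + m, rfl⟩), ?_⟩
      simp only [hmap, hval, map_mul, map_pow] at hz ⊢
      rw [← hz]; ring
    · intro x y hxy
      simp only [hmap] at hxy
      obtain ⟨⟨_, n, rfl⟩, h⟩ := (IsLocalization.eq_iff_exists (Submonoid.powers (C s)) L).1 hxy
      refine ⟨⟨_, n, rfl⟩, ?_⟩
      apply Subtype.ext
      simpa [hval] using h
  have hdisj : Disjoint ((Submonoid.powers (algebraMap R A s) : Submonoid A) : Set A) (P : Set A) := by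
    rw [Set.disjoint_left]
    rintro _ ⟨n, rfl⟩ h
    exact hs (hP.mem_of_pow_mem n h)
  let PL : Ideal L := P.map (algebraMap A L)
  have hPL : PL.IsPrime := IsLocalization.isPrime_of_isPrime_disjoint
    (Submonoid.powers (algebraMap R A s)) L P hP hdisj
  have hc : PL.comap (algebraMap A L) = P := IsLocalization.under_map_of_isPrime_disjoint
    (Submonoid.powers (algebraMap R A s)) L hP hdisj
  have h1 : P.height = PL.height := by
    have := IsLocalization.height_under (Submonoid.powers (algebraMap R A s)) PL
    rw [← this]
    conv_lhs => rw [← hc]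
  let Q : Ideal R[X] := PL.comap (algebraMap R[X] L)
  have h2 : Q.height = PL.height := IsLocalization.height_under (Submonoid.powers (C s)) PL
  have hQ : Q.IsPrime := inferInstance
  have hdim : ringKrullDim R[X] = ((d + 1 : ℕ) : WithBot ℕ∞) := by
    rw [Polynomial.ringKrullDim_of_isNoetherianRing, hR]; rfl
  have hQge : ((d + 1 : ℕ) : ℕ∞) ≤ Q.height := by rw [h2, ← h1]; exact hht
  have hQle : (Q.height : WithBot ℕ∞) ≤ ringKrullDim R[X] := Ideal.height_le_ringKrullDim_of_isPrime
  have hQeq : (Q.height : WithBot ℕ∞) = ringKrullDim R[X] := by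
    refine le_antisymm hQle ?_
    rw [hdim]
    exact_mod_cast hQge
  have hQmax : Q.IsMaximal := by
    have : FiniteRingKrullDim R[X] := by
      rw [finiteRingKrullDim_iff_ne_bot_and_top, hdim]
      exact ⟨by simp, fun h => ENat.natCast_ne_top (d + 1) (WithBot.coe_injective h)⟩
    exact Ideal.isMaximal_of_height_eq_ringKrullDim hQeq
  have hPQ : P.comap (algebraMap R A) = Q.under R := by
    conv_lhs => rw [← hc]
    rfl
  have h3 := Polynomial.height_eq_height_add_one (Q.under R) Q
  rw [hPQ]
  rw [h3, Nat.cast_add] at hQge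
  exact (ENat.add_le_add_iff_right (by simp)).1 hQge

end

lemma span_perturb {A : Type*} [CommRing A] {n : ℕ} (f h : Fin n → A) (e : A) (K : Ideal A)
    (he : e ∈ K) : Ideal.span (Set.range f) ≤
      Ideal.span (Set.range fun i => f i + e * h i) ⊔ K := by
  rw [Ideal.span_le]
  rintro _ ⟨i, rfl⟩
  have h1 : f i + e * h i ∈ Ideal.span (Set.range fun i => f i + e * h i) :=
    Ideal.subset_span ⟨i, rfl⟩
  have h2 : f i = (f i + e * h i) + (-(h i)) * e := by ring
  rw [h2]
  exact add_mem (Ideal.mem_sup_left h1) (Ideal.mem_sup_right (K.mul_mem_left _ he))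

/-- In a geometric subring `A` of `R[T]`, every ideal `I` of height `d+1` such that
`I/I²` is generated by `d+1` elements is generated by `d+1` elements (it is a complete
intersection ideal). -/
theorem stmt_18 {R : Type*} [CommRing R] [IsNoetherianRing R]
    (d : ℕ) (hd1 : 1 ≤ d) (hR : ringKrullDim R = (d : WithBot ℕ∞))
    (A : Subalgebra R (Polynomial R)) [IsNoetherianRing A]
    (hA : ringKrullDim A = ((d + 1 : ℕ) : WithBot ℕ∞))
    (s : R) (hs : s ∈ nonZeroDivisors R)
    (hloc : ∀ g : Polynomial R, ∃ n : ℕ, (Polynomial.C s) ^ n * g ∈ A)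
    (I : Ideal A) (hht : idealHeight I = ((d + 1 : ℕ) : ℕ∞))
    (hgen : ∃ f : Fin (d + 1) → A, (∀ i, f i ∈ I) ∧
      I = Ideal.span (Set.range f) ⊔ I ^ 2) :
    ∃ g : Fin (d + 1) → A, I = Ideal.span (Set.range g) := by
  classical
  obtain ⟨f, hfI, hI⟩ := hgen
  have hFG : I.FG := IsNoetherian.noetherian I
  have hIP : ∀ P : Ideal A, P.IsPrime → I ≤ P → ((d + 1 : ℕ) : ℕ∞) ≤ P.height := by
    intro P hP hle
    rw [← hht]
    refine (iInf₂_le (⟨P, hP⟩ : PrimeSpectrum A) hle).trans ?_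
    exact (PrimeSpectrum.height_eq_orderHeight (⟨P, hP⟩ : PrimeSpectrum A)).ge
  let ι : R →+* A := algebraMap R A
  have hιv : ∀ x, ((ι x : A) : R[X]) = C x := fun _ => rfl
  -- choice of a
  have hJ : ∀ q ∈ minimalPrimes R, ¬ I.comap ι ≤ q := by
    intro q hq hle
    have hqp : q.IsPrime := hq.1.1
    obtain ⟨P, hIPle, hP, hPq⟩ := Ideal.exists_ideal_comap_le_prime q I hle
    by_cases hsP : ι s ∈ P
    · exact notMem_nonZeroDivisors_of_mem_mem_minimalPrimes (hPq hsP) hq hs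
    · have h1 := height_contract d hR A s hloc P hsP (hIP P hP hIPle)
      have h2 := h1.trans (Ideal.height_mono hPq)
      rw [Ideal.height_eq_zero_iff.2 hq] at h2
      have : d ≤ 0 := by exact_mod_cast h2
      omega
  obtain ⟨c, hcI, hc⟩ : ∃ c, ι c ∈ I ∧ ∀ q ∈ minimalPrimes R, c ∉ q := by
    have hav : ¬ ((I.comap ι : Set R) ⊆ ⋃ q ∈ minimalPrimes R, ((id q : Ideal R) : Set R)) := by
      rw [Ideal.subset_union_prime_finite (minimalPrimes.finite_of_isNoetherianRing R) (f := id)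
        ⊥ ⊥ (fun q hq _ _ => hq.1.1)]
      rintro ⟨q, hq, hle⟩
      exact hJ q hq hle
    obtain ⟨c, hc1, hc2⟩ := Set.not_subset.1 hav
    simp only [Set.mem_iUnion, not_exists] at hc2
    exact ⟨c, hc1, fun q hq h => hc2 q hq h⟩
  obtain ⟨a, ha⟩ : ∃ a, a = s * c ^ 2 := ⟨_, rfl⟩
  have haI2 : ι a ∈ I ^ 2 := by
    rw [ha, map_mul, map_pow]
    exact Ideal.mul_mem_left _ _ (Ideal.pow_mem_pow hcI 2)
  have haI : ι a ∈ I := Ideal.pow_le_self two_ne_zero haI2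
  have haq : ∀ q ∈ minimalPrimes R, a ∉ q := by
    intro q hq h
    have hqp : q.IsPrime := hq.1.1
    rw [ha] at h
    rcases hqp.mem_or_mem h with h | h
    · exact notMem_nonZeroDivisors_of_mem_mem_minimalPrimes h hq hs
    · exact hc q hq (hqp.mem_of_pow_mem 2 h)
  have hsP : ∀ P : Ideal A, ι a ∉ P → ι s ∉ P := by
    intro P h h'
    apply h
    rw [ha, map_mul]
    exact P.mul_mem_right _ h'
  have ha1 : ∀ P : Ideal A, P.IsPrime → ι a ∈ P → 1 ≤ P.height := by
    intro P hP haP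
    rw [Order.one_le_iff_ne_zero]
    intro h0
    have hmin := Ideal.height_eq_zero_iff.1 h0
    obtain ⟨Q, hQ, hQP⟩ := Ideal.exists_comap_eq_of_mem_minimalPrimes_of_injective
      (f := A.val.toRingHom) Subtype.val_injective P hmin
    obtain ⟨p0, hp0, hp0le⟩ := Ideal.exists_minimalPrimes_le (bot_le : ⊥ ≤ Q.comap C)
    have hp0p : p0.IsPrime := hp0.1.1
    have hprime : (p0.map (C : R →+* R[X])).IsPrime := Ideal.isPrime_map_C_of_isPrime
    have hle : (p0.map (C : R →+* R[X])).comap A.val.toRingHom ≤ P := by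
      rw [← hQP]
      exact Ideal.comap_mono (Ideal.map_le_iff_le_comap.2 hp0le)
    have hge : P ≤ (p0.map (C : R →+* R[X])).comap A.val.toRingHom :=
      hmin.2 ⟨inferInstance, bot_le⟩ hle
    have h1 : C a ∈ p0.map (C : R →+* R[X]) := hge haP
    have h2 := Ideal.mem_map_C_iff.1 h1 0
    rw [coeff_C_zero] at h2
    exact haq p0 hp0 h2
  -- step 1
  obtain ⟨e, he2, heN⟩ := exists_e I (Ideal.span (Set.range f)) hFG hI.le
  obtain ⟨b, hb, -⟩ := gen_pos (RingHom.id A) (RingHom.id A) e (Ideal.span {ι a}) 1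
    (fun P hP h _ => by exact_mod_cast ha1 P hP (h (Ideal.mem_span_singleton_self _))) (d + 1) f
  let f1 : Fin (d + 1) → A := fun i => f i + e * b i
  have hf1I : ∀ i, f1 i ∈ I := fun i =>
    add_mem (hfI i) (I.mul_mem_right _ (Ideal.pow_le_self two_ne_zero he2))
  have hI1 : I ≤ Ideal.span (Set.range f1) ⊔ I ^ 2 := by
    conv_lhs => rw [hI]
    exact sup_le (span_perturb f b e _ he2) le_sup_right
  have hI1a : I ≤ Ideal.span (Set.range f1) ⊔ Ideal.span {ι a} := by
    refine nak _ _ hFG (hI1.trans (sup_le_sup_right le_sup_left _)) ?_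
    intro P hP hle
    have hf1P : ∀ i, f1 i ∈ P := fun i =>
      hle (Ideal.mem_sup_left (Ideal.subset_span ⟨i, rfl⟩))
    have heP : e ∈ P := by
      by_contra heP
      have h1 := hb P hP (le_sup_right.trans hle) hf1P heP
      have h2 : (P.height : WithBot ℕ∞) ≤ ringKrullDim A := Ideal.height_le_ringKrullDim_of_isPrime
      rw [hA] at h2
      have h3 : P.height ≤ ((d + 1 : ℕ) : ℕ∞) := by exact_mod_cast h2
      have h4 : 1 + (d + 1) ≤ d + 1 := by exact_mod_cast h1.trans h3
      omega
    have hfP : Ideal.span (Set.range f) ≤ P := by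
      rw [Ideal.span_le]
      rintro _ ⟨i, rfl⟩
      exact (Ideal.add_mem_iff_left _ (P.mul_mem_right _ heP)).1 (hf1P i)
    intro x hx
    have : x = (1 - e) * x + e * x := by ring
    rw [this]
    exact add_mem (hfP (heN x hx)) (P.mul_mem_right _ heP)
  -- step 2
  let ev : A →+* R := (evalRingHom 0).comp A.val.toRingHom
  have hevι : ∀ x, ev (ι x) = x := fun x => eval_C
  obtain ⟨b2, hb2, hb2'⟩ := gen_pos (RingHom.id A) ev (ι a) ⊥ 0
    (fun P hP h _ => by simp) (d + 1) f1
  let f2 : Fin (d + 1) → A := fun i => f1 i + ι a * b2 i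
  have hf2I : ∀ i, f2 i ∈ I := fun i => add_mem (hf1I i) (I.mul_mem_right _ haI)
  have hI2 : I ≤ Ideal.span (Set.range f2) ⊔ I ^ 2 :=
    hI1.trans (sup_le (span_perturb f1 b2 _ _ haI2) le_sup_right)
  have hI2a : I ≤ Ideal.span (Set.range f2) ⊔ Ideal.span {ι a} :=
    hI1a.trans (sup_le (span_perturb f1 b2 _ _ (Ideal.mem_span_singleton_self _)) le_sup_right)
  obtain ⟨k, r, hkr⟩ : ∃ (k : ℕ) (r : R), ι (a ^ k * (1 + a * r)) ∈ Ideal.span (Set.range f2) := by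
    by_contra! hcon
    let M : Submonoid A :=
      { carrier := {x | ∃ (k : ℕ) (r : R), x = ι (a ^ k * (1 + a * r))}
        one_mem' := ⟨0, 0, by simp⟩
        mul_mem' := by
          rintro _ _ ⟨k, r, rfl⟩ ⟨k', r', rfl⟩
          refine ⟨k + k', r + r' + a * r * r', ?_⟩
          rw [← map_mul]
          congr 1
          ring }
    obtain ⟨P, hP, hle, hdis⟩ := Ideal.exists_le_prime_disjoint (Ideal.span (Set.range f2)) M (by
      rw [Set.disjoint_left]
      rintro _ hx ⟨k, r, rfl⟩
      exact hcon k r hx)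
    have hM : ∀ k r, ι (a ^ k * (1 + a * r)) ∉ P := fun k r h =>
      Set.disjoint_left.1 hdis h ⟨k, r, rfl⟩
    have haP : ι a ∉ P := by simpa using hM 1 0
    have h1 := hb2 P hP bot_le (fun i => hle (Ideal.subset_span ⟨i, rfl⟩)) haP
    rw [zero_add] at h1
    have h2 := height_contract d hR A s hloc P (hsP P haP) h1
    let p := P.comap ι
    have hpp : p.IsPrime := inferInstance
    have hmax : p.IsMaximal := by
      obtain ⟨m, hm, hpm⟩ := Ideal.exists_le_maximal p hpp.ne_top
      rcases hpm.eq_or_lt with h | h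
      · rw [h]; exact hm
      · have hmp := hm.isPrime
        have h3 := Ideal.height_add_one_le_of_lt_of_isPrime h
        have h4 : (m.height : WithBot ℕ∞) ≤ ringKrullDim R :=
          Ideal.height_le_ringKrullDim_of_isPrime
        rw [hR] at h4
        have h5 : m.height ≤ (d : ℕ∞) := by exact_mod_cast h4
        have h6 : (d : ℕ∞) + 1 ≤ d := ((add_le_add_left h2 1).trans h3).trans h5
        have : d + 1 ≤ d := by exact_mod_cast h6
        omega
    obtain ⟨y, z, hz, hyz⟩ := hmax.exists_inv (show a ∉ p from haP)
    apply hM 0 (-y)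
    have : a ^ 0 * (1 + a * -y) = z := by linear_combination -hyz
    rw [this]
    exact hz
  obtain ⟨m, hm⟩ : a ∈ (Ideal.span (Set.range fun i => ev (f2 i))).radical := by
    rw [Ideal.radical_eq_sInf, Ideal.mem_sInf]
    rintro q ⟨hle, hq⟩
    by_contra haq
    have h1 := hb2' q hq (fun i => hle (Ideal.subset_span ⟨i, rfl⟩)) (by rwa [hevι])
    have h4 : (q.height : WithBot ℕ∞) ≤ ringKrullDim R :=
      Ideal.height_le_ringKrullDim_of_isPrime
    rw [hR] at h4
    have h5 : q.height ≤ (d : ℕ∞) := by exact_mod_cast h4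
    have : d + 1 ≤ d := by exact_mod_cast h1.trans h5
    omega
  -- step 3: the homotopy
  obtain ⟨N, hN⟩ := denom A s hloc (Finset.univ.sup fun i => (f2 i : R[X]).natDegree)
  obtain ⟨t, ht⟩ : ∃ t, t = 1 - (-(a * r)) ^ (N + 1) := ⟨_, rfl⟩
  have hut : (1 + a * r) ∣ t := by
    have := sub_dvd_pow_sub_pow 1 (-(a * r)) (N + 1)
    rwa [one_pow, ← ht, sub_neg_eq_add] at this
  have hexh : ∀ i, ∃ h : A, ((f2 i + ι a * h : A) : R[X]) = (f2 i : R[X]).comp (C t * X) := by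
    intro i
    obtain ⟨q, hq, hcomp⟩ := comp_sub (f2 i : R[X]) t
    have hqA := hN q (hq.trans (Finset.le_sup (f := fun i => (f2 i : R[X]).natDegree)
      (Finset.mem_univ i)))
    refine ⟨ι ((-r) ^ (N + 1) * c ^ (2 * N)) * ⟨_, hqA⟩, ?_⟩
    rw [hcomp]
    have : 1 - t = a * (((-r) ^ (N + 1) * c ^ (2 * N)) * s ^ N) := by
      rw [ht, ha]; ring
    rw [this]
    simp only [Subalgebra.coe_add, Subalgebra.coe_mul, hιv, C_mul, C_pow]
    ring
  choose h hh using hexh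
  let g : Fin (d + 1) → A := fun i => f2 i + ι a * h i
  have hgI : ∀ i, g i ∈ I := fun i => add_mem (hf2I i) (I.mul_mem_right _ haI)
  have hIg : I ≤ Ideal.span (Set.range g) ⊔ I ^ 2 :=
    hI2.trans (sup_le (span_perturb f2 h _ _ haI2) le_sup_right)
  refine ⟨g, le_antisymm (nak _ _ hFG hIg ?_) ?_⟩
  swap
  · rw [Ideal.span_le]
    rintro _ ⟨i, rfl⟩
    exact hgI i
  intro P hP hle
  have hgP : ∀ i, g i ∈ P := fun i => hle (Ideal.subset_span ⟨i, rfl⟩)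
  by_cases haP : ι a ∈ P
  · refine hI2a.trans (sup_le ((span_perturb f2 h (ι a) P haP).trans (sup_le hle le_rfl)) ?_)
    rwa [Ideal.span_singleton_le_iff_mem]
  exfalso
  have hsn : ∀ (n : ℕ) (x : A), ι s ^ n * x ∈ P → x ∈ P := by
    intro n x hx
    rcases hP.mem_or_mem hx with h1 | h1
    · exact absurd (hP.mem_of_pow_mem n h1) (hsP P haP)
    · exact h1
  have hu : ι (1 + a * r) ∈ P := by
    obtain ⟨w, hw⟩ := Ideal.mem_span_range_iff_exists_fun.1 hkr
    obtain ⟨M, hM⟩ := denom A s hloc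
      (Finset.univ.sup fun i => ((w i : R[X]).comp (C t * X)).natDegree)
    have hM' := fun i => hM ((w i : R[X]).comp (C t * X)) (Finset.le_sup
      (f := fun i => ((w i : R[X]).comp (C t * X)).natDegree) (Finset.mem_univ i))
    have hw2 : ∑ i, (w i : R[X]).comp (C t * X) * (g i : R[X]) = C (a ^ k * (1 + a * r)) := by
      have h1 := congrArg (fun x : A => (x : R[X]).comp (C t * X)) hw
      simp only [hιv, C_comp] at h1
      rw [← h1, AddSubmonoidClass.coe_finsetSum, Polynomial.sum_comp]
      refine Finset.sum_congr rfl fun i _ => ?_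
      rw [Subalgebra.coe_mul, mul_comp, hh]
    have hw3 : ι s ^ M * ι (a ^ k * (1 + a * r)) = ∑ i, (⟨_, hM' i⟩ : A) * g i := by
      apply Subtype.ext
      rw [Subalgebra.coe_mul, AddSubmonoidClass.coe_finsetSum, hιv, ← hw2, Finset.mul_sum]
      refine Finset.sum_congr rfl fun i _ => ?_
      rw [Subalgebra.coe_mul, mul_assoc]
      rfl
    have hw4 : ι (a ^ k * (1 + a * r)) ∈ P := by
      apply hsn M
      rw [hw3]
      exact sum_mem fun i _ => P.mul_mem_left _ (hgP i)
    rw [map_mul, map_pow] at hw4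
    rcases hP.mem_or_mem hw4 with h1 | h1
    · exact absurd (hP.mem_of_pow_mem k h1) haP
    · exact h1
  have htP : ι t ∈ P := by
    obtain ⟨v, hv⟩ := hut
    rw [hv, map_mul]
    exact P.mul_mem_right _ hu
  have h0 : ∀ i, ι (ev (f2 i)) ∈ P := by
    intro i
    obtain ⟨q, hq⟩ := comp_zero (f2 i : R[X]) t
    obtain ⟨n, hn⟩ := hloc q
    apply hsn n
    have : ι s ^ n * ι (ev (f2 i)) = ι s ^ n * g i - ι t * ⟨_, hn⟩ := by
      apply Subtype.ext
      have h1 : (g i : R[X]) = C (ev (f2 i)) + C t * q := (hh i).trans hq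
      have h2 : ((ι s ^ n : A) : R[X]) = C s ^ n := rfl
      simp only [Subalgebra.coe_sub, Subalgebra.coe_mul, h1, h2, hιv]
      ring
    rw [this]
    exact sub_mem (P.mul_mem_left _ (hgP i)) (P.mul_mem_right _ htP)
  have hspan : Ideal.span (Set.range fun i => ev (f2 i)) ≤ P.comap ι := by
    rw [Ideal.span_le]
    rintro _ ⟨i, rfl⟩
    exact h0 i
  have h1 : ι (a ^ m) ∈ P := hspan hm
  rw [map_pow] at h1
  exact haP (hP.mem_of_pow_mem m h1)
end

section
/- Let A be a commutative Noetherian ring of dimension d+1 with R ⊆ A ⊆ R[T] where R is Noetherian of dimension d ≥ 1, and A_s = R_s[T] for some non-zerodivisor s ∈ R. Then every finitely generated ideal I of A with ht(I) ≥ 2 is set-theoretically generated by at most d+1 elements: there exist g₁,…,g_{d+1} ∈ A with √I = √(g₁,…,g_{d+1}). -/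
open Polynomial

namespace Stmt19Aux

/-- Primes containing all `φ (g i)` either contain the image of `I` or have height at least `k`. -/
def Prop1 {A B : Type*} [CommRing A] [CommRing B] (φ : A →+* B) (I : Ideal A) (k : ℕ)
    (g : Fin k → A) : Prop :=
  ∀ P : Ideal B, P.IsPrime → (∀ i, φ (g i) ∈ P) → I ≤ P.comap φ ∨ (k : ℕ∞) ≤ P.height

lemma step {A B : Type*} [CommRing A] [CommRing B] [IsNoetherianRing B] (φ : A →+* B)
    (I : Ideal A) (k : ℕ) (g : Fin k → A) (h : Prop1 φ I k g) :
    ∃ F : Set (Ideal A), F.Finite ∧ (∀ p ∈ F, p.IsPrime ∧ ¬ I ≤ p) ∧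
      ∀ x ∈ I, (∀ p ∈ F, x ∉ p) → Prop1 φ I (k + 1) (Fin.snoc g x) := by
  let J : Ideal B := Ideal.span (Set.range fun i => φ (g i))
  refine ⟨(fun P => P.comap φ) '' {P | P ∈ J.minimalPrimes ∧ ¬ I ≤ P.comap φ}, ?_, ?_, ?_⟩
  · exact Set.Finite.image _ ((Ideal.finite_minimalPrimes_of_isNoetherianRing B J).subset
      fun P hP => hP.1)
  · rintro p ⟨P, ⟨hP, hI⟩, rfl⟩
    have := hP.isPrime
    exact ⟨Ideal.comap_isPrime φ P, hI⟩
  · intro x hx hF P hP hg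
    have hJ : J ≤ P := by
      rw [Ideal.span_le]
      rintro _ ⟨i, rfl⟩
      simpa using hg i.castSucc
    obtain ⟨Q, hQ, hQP⟩ := Ideal.exists_minimalPrimes_le hJ
    have hQp := hQ.isPrime
    by_cases hI : I ≤ Q.comap φ
    · exact Or.inl (hI.trans (Ideal.comap_mono hQP))
    · have hxQ := hF _ ⟨Q, ⟨hQ, hI⟩, rfl⟩
      have hxP : φ x ∈ P := by simpa using hg (Fin.last k)
      have hlt : Q < P := lt_of_le_of_ne hQP fun e => hxQ (by simpa [e] using hxP)
      right
      have hk : (k : ℕ∞) ≤ Q.height := (h Q hQp (fun i => hQ.le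
        (Ideal.subset_span ⟨i, rfl⟩))).resolve_left hI
      calc ((k + 1 : ℕ) : ℕ∞) = k + 1 := by push_cast; rfl
        _ ≤ Q.height + 1 := by gcongr
        _ ≤ P.height := Ideal.height_add_one_le_of_lt_of_isPrime hlt

lemma avoid {A : Type*} [CommRing A] (I : Ideal A) (F : Set (Ideal A)) (hF : F.Finite)
    (h : ∀ p ∈ F, p.IsPrime ∧ ¬ I ≤ p) : ∃ x ∈ I, ∀ p ∈ F, x ∉ p := by
  by_contra! hc
  have hsub : (I : Set A) ⊆ ⋃ p ∈ (hF.toFinset : Set (Ideal A)), (p : Set A) := by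
    intro x hx
    obtain ⟨p, hp, hxp⟩ := hc x hx
    simp only [Set.mem_iUnion]
    exact ⟨p, by simpa using hp, hxp⟩
  have := (Ideal.subset_union_prime (s := hF.toFinset) (f := fun p : Ideal A => p) ⊤ ⊤
    (fun p hp _ _ => (h p (by simpa using hp)).1)).1 hsub
  obtain ⟨p, hp, hle⟩ := this
  exact (h p (by simpa using hp)).2 hle

lemma select {A B₁ B₂ B₃ : Type*} [CommRing A] [CommRing B₁] [CommRing B₂] [CommRing B₃]
    [IsNoetherianRing B₁] [IsNoetherianRing B₂] [IsNoetherianRing B₃]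
    (φ₁ : A →+* B₁) (φ₂ : A →+* B₂) (φ₃ : A →+* B₃) (I : Ideal A) (k : ℕ) :
    ∃ g : Fin k → A, (∀ i, g i ∈ I) ∧ Prop1 φ₁ I k g ∧ Prop1 φ₂ I k g ∧ Prop1 φ₃ I k g := by
  induction k with
  | zero =>
    exact ⟨Fin.elim0, fun i => i.elim0, fun _ _ _ => Or.inr (by simp),
      fun _ _ _ => Or.inr (by simp), fun _ _ _ => Or.inr (by simp)⟩
  | succ k ih =>
    obtain ⟨g, hg, h1, h2, h3⟩ := ih
    obtain ⟨F1, f1, p1, s1⟩ := step φ₁ I k g h1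
    obtain ⟨F2, f2, p2, s2⟩ := step φ₂ I k g h2
    obtain ⟨F3, f3, p3, s3⟩ := step φ₃ I k g h3
    obtain ⟨x, hx, hxF⟩ := avoid I (F1 ∪ (F2 ∪ F3)) (f1.union (f2.union f3)) (by
      rintro p (h | h | h)
      exacts [p1 p h, p2 p h, p3 p h])
    refine ⟨Fin.snoc g x, ?_, s1 x hx fun p hp => hxF p (Or.inl hp),
      s2 x hx fun p hp => hxF p (Or.inr (Or.inl hp)),
      s3 x hx fun p hp => hxF p (Or.inr (Or.inr hp))⟩
    intro i
    refine Fin.lastCases ?_ (fun i => ?_) i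
    · simpa using hx
    · simpa using hg i

lemma Prop1.final {A B : Type*} [CommRing A] [CommRing B] {φ : A →+* B} {I : Ideal A} {d : ℕ}
    {g : Fin (d + 1) → A} (h : Prop1 φ I (d + 1) g) (hB : ringKrullDim B ≤ (d : WithBot ℕ∞))
    (P : Ideal B) (hP : P.IsPrime) (hg : ∀ i, φ (g i) ∈ P) : I ≤ P.comap φ := by
  refine (h P hP hg).resolve_right fun hk => ?_
  have h1 : (P.height : WithBot ℕ∞) ≤ (d : WithBot ℕ∞) :=
    (Ideal.height_le_ringKrullDim_of_isPrime).trans hB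
  have h2 : P.height ≤ (d : ℕ∞) := by exact_mod_cast h1
  have h3 := hk.trans h2
  have : d + 1 ≤ d := by exact_mod_cast h3
  omega

lemma dim_lower {R B : Type*} [CommRing R] [CommRing B] (φ : R →+* B)
    (hinj : Function.Injective (PrimeSpectrum.comap φ))
    (H : (∀ P : PrimeSpectrum B, ∃ q : PrimeSpectrum R, q < PrimeSpectrum.comap φ P) ∨
      (∀ P : PrimeSpectrum B, ∃ q : PrimeSpectrum R, PrimeSpectrum.comap φ P < q)) :
    ringKrullDim B + 1 ≤ ringKrullDim R := by
  have hmono : StrictMono (PrimeSpectrum.comap φ) :=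
    Monotone.strictMono_of_injective (fun _ _ h => Ideal.comap_mono h) hinj
  cases isEmpty_or_nonempty (PrimeSpectrum B) with
  | inl h => simp [ringKrullDim, Order.krullDim_eq_bot]
  | inr h =>
    have hne : Nonempty (PrimeSpectrum R) := h.map (PrimeSpectrum.comap φ)
    rw [ringKrullDim, ringKrullDim, Order.krullDim_eq_iSup_length, Order.krullDim_eq_iSup_length,
      ← WithBot.coe_one, ← WithBot.coe_add, ENat.iSup_add, WithBot.coe_le_coe, iSup_le_iff]
    intro l
    have : ∃ l' : LTSeries (PrimeSpectrum R), l'.length = l.length + 1 := by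
      rcases H with H | H
      · obtain ⟨q, hq⟩ := H l.head
        exact ⟨(l.map _ hmono).cons q (by simpa using hq), by simp⟩
      · obtain ⟨q, hq⟩ := H l.last
        exact ⟨(l.map _ hmono).snoc q (by simpa using hq), by simp⟩
    obtain ⟨l', hl'⟩ := this
    refine le_trans ?_ (le_iSup _ l')
    rw [hl']
    push_cast
    rfl

lemma fiber_chain {R : Type*} [CommRing R] (p : Ideal R) [p.IsPrime] (Q : Fin 3 → Ideal R[X])
    (hQ : ∀ i, (Q i).IsPrime) (h01 : Q 0 < Q 1) (h12 : Q 1 < Q 2)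
    (hc : ∀ i, (Q i).comap C = p) : False := by
  let p' : PrimeSpectrum R := ⟨p, inferInstance⟩
  have hdim : Order.krullDim ((PrimeSpectrum.comap (algebraMap R R[X])) ⁻¹' {p'}) ≤ 1 := by
    rw [Order.krullDim_eq_of_orderIso
      (PrimeSpectrum.preimageOrderIsoFiber R (Polynomial R) p'), ← ringKrullDim,
      ← ringKrullDim_eq_of_ringEquiv (polyEquivTensor R (p'.asIdeal.ResidueField)).toRingEquiv]
    exact (Ring.krullDimLE_iff (n := 1)).1 inferInstance
  let x : Fin 3 → ((PrimeSpectrum.comap (algebraMap R R[X])) ⁻¹' {p'}) :=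
    fun i => ⟨⟨Q i, hQ i⟩, by
      simp only [Set.mem_preimage, Set.mem_singleton_iff]
      exact PrimeSpectrum.ext (hc i)⟩
  let l : LTSeries ((PrimeSpectrum.comap (algebraMap R R[X])) ⁻¹' {p'}) :=
    { length := 2, toFun := x, step := by
        intro i
        fin_cases i
        · exact h01
        · exact h12 }
  have := (Order.LTSeries.length_le_krullDim l).trans hdim
  have h2 : ((2 : ℕ) : WithBot ℕ∞) ≤ ((1 : ℕ) : WithBot ℕ∞) := by exact_mod_cast this
  have : 2 ≤ 1 := by exact_mod_cast h2
  omega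

lemma poly_loc {R : Type*} [CommRing R] (M : Submonoid R) (J : Ideal R[X])
    (h : J.map (mapRingHom (algebraMap R (Localization M))) = ⊤) : ∃ m ∈ M, C m ∈ J := by
  letI : Algebra R[X] (Localization M)[X] := Polynomial.algebra R (Localization M)
  haveI : IsLocalization (M.map (C : R →+* R[X])) (Localization M)[X] :=
    Polynomial.isLocalization M (Localization M)
  have h' : J.map (algebraMap R[X] (Localization M)[X]) = ⊤ := h
  by_contra! hc
  refine (IsLocalization.map_algebraMap_ne_top_iff_disjoint (M.map (C : R →+* R[X])) (Localization M)[X] J).2 ?_ h'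
  rw [Set.disjoint_left]
  rintro _ ⟨m, hm, rfl⟩ hJ
  exact hc m hm hJ

lemma loc_top {R : Type*} [CommRing R] (M : Submonoid R) (J : Ideal R)
    (h : J.map (algebraMap R (Localization M)) = ⊤) : ∃ m ∈ M, m ∈ J := by
  by_contra! hc
  refine (IsLocalization.map_algebraMap_ne_top_iff_disjoint M (Localization M) J).2 ?_ h
  rw [Set.disjoint_left]
  exact hc

lemma dim_quot {A : Type*} [CommRing A] (r : A) (hr : ∀ p ∈ minimalPrimes A, r ∉ p) :
    ringKrullDim (A ⧸ Ideal.span {r}) + 1 ≤ ringKrullDim A := by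
  refine dim_lower (Ideal.Quotient.mk (Ideal.span {r}))
    (PrimeSpectrum.comap_injective_of_surjective _ Ideal.Quotient.mk_surjective) (Or.inl ?_)
  intro P
  set P' := PrimeSpectrum.comap (Ideal.Quotient.mk (Ideal.span {r})) P with hP'
  obtain ⟨q, hq, hle⟩ := Ideal.exists_minimalPrimes_le (I := ⊥) (J := P'.asIdeal) bot_le
  have hqp := hq.isPrime
  refine ⟨⟨q, hqp⟩, lt_of_le_of_ne hle fun e => hr q hq ?_⟩
  have : q = P'.asIdeal := congrArg PrimeSpectrum.asIdeal e
  rw [this, hP']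
  change (Ideal.Quotient.mk (Ideal.span {r})) r ∈ P.asIdeal
  rw [Ideal.Quotient.eq_zero_iff_mem.2 (Ideal.mem_span_singleton_self r)]
  exact zero_mem _

lemma select' {A B₂ B₃ : Type*} [CommRing A] [IsNoetherianRing A] [CommRing B₂] [CommRing B₃]
    [IsNoetherianRing B₂] [IsNoetherianRing B₃]
    (r : A) (φ₂ : A →+* B₂) (φ₃ : A →+* B₃) (I : Ideal A) (d : ℕ)
    (hrmin : ∀ P ∈ minimalPrimes A, r ∉ P)
    (hA : ringKrullDim A = ((d + 1 : ℕ) : WithBot ℕ∞)) :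
    ∃ g : Fin (d + 1) → A, (∀ i, g i ∈ I) ∧
      (∀ P : Ideal A, P.IsPrime → r ∈ P → (∀ i, g i ∈ P) → I ≤ P) ∧
      Prop1 φ₂ I (d + 1) g ∧ Prop1 φ₃ I (d + 1) g := by
  obtain ⟨g, hgI, p1, p2, p3⟩ := select (Ideal.Quotient.mk (Ideal.span {r})) φ₂ φ₃ I (d + 1)
  have hd1' : ringKrullDim (A ⧸ Ideal.span {r}) ≤ (d : WithBot ℕ∞) := by
    have := dim_quot r hrmin
    rw [hA] at this
    generalize ringKrullDim (A ⧸ Ideal.span {r}) = y at this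
    cases y with
    | bot => exact bot_le
    | coe y =>
      have h1 : y + 1 ≤ ((d + 1 : ℕ) : ℕ∞) := by exact_mod_cast this
      push_cast at h1
      have h2 : y ≤ (d : ℕ∞) := (ENat.add_le_add_iff_right ENat.one_ne_top).1 h1
      exact_mod_cast h2
  refine ⟨g, hgI, ?_, p2, p3⟩
  intro P hP hrP hg
  have hker : RingHom.ker (Ideal.Quotient.mk (Ideal.span {r})) ≤ P := by
    rw [Ideal.mk_ker, Ideal.span_singleton_le_iff_mem]
    exact hrP
  have hPm := Ideal.map_isPrime_of_surjective Ideal.Quotient.mk_surjective hker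
  have h1 := p1.final hd1' _ hPm (fun i => Ideal.mem_map_of_mem _ (hg i))
  rw [Ideal.comap_map_of_surjective _ Ideal.Quotient.mk_surjective] at h1
  exact h1.trans (sup_le le_rfl hker)

/-- the multiplicative set of all `r ^ n * (1 + r * x)` -/
def M (R : Type*) [CommRing R] (r : R) : Submonoid R :=
  Submonoid.powers r ⊔ (⊥ : Submonoid (R ⧸ Ideal.span {r})).comap (Ideal.Quotient.mk _)

lemma mem_M {R : Type*} [CommRing R] (r m : R) (hm : m ∈ M R r) :
    ∃ n x, m = r ^ n * (1 + r * x) := by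
  obtain ⟨y, ⟨n, rfl⟩, z, hz, rfl⟩ := Submonoid.mem_sup.1 hm
  have hz' : (Ideal.Quotient.mk (Ideal.span {r})) z = (Ideal.Quotient.mk (Ideal.span {r})) 1 := by
    simpa using hz
  obtain ⟨x, hx⟩ := Ideal.mem_span_singleton.1 (Ideal.Quotient.eq.1 hz')
  exact ⟨n, x, by rw [← hx]; simp⟩

lemma M_mem {R : Type*} [CommRing R] (r x : R) : 1 + r * x ∈ M R r := by
  refine Submonoid.mem_sup_right ?_
  simp

lemma dim_M {R : Type*} [CommRing R] (r : R) :
    ringKrullDim (Localization (M R r)) + 1 ≤ ringKrullDim R := by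
  refine dim_lower (algebraMap R (Localization (M R r)))
    (PrimeSpectrum.localization_comap_injective _ (M R r)) (Or.inr ?_)
  intro P
  set p := PrimeSpectrum.comap (algebraMap R (Localization (M R r))) P with hp
  have hdis : ∀ m ∈ M R r, m ∉ p.asIdeal := by
    intro m hm h
    have h' : algebraMap R (Localization (M R r)) m ∈ P.asIdeal := h
    exact P.isPrime.ne_top (Ideal.eq_top_of_isUnit_mem _ h' (IsLocalization.map_units _ ⟨m, hm⟩))
  have hrM : r ∈ M R r := Submonoid.mem_sup_left (Submonoid.mem_powers r)
  have hne : p.asIdeal ⊔ Ideal.span {r} ≠ ⊤ := by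
    intro h
    have h1 := (Ideal.eq_top_iff_one _).1 h
    obtain ⟨a, ha, b, hb, hab⟩ := Submodule.mem_sup.1 h1
    obtain ⟨c, rfl⟩ := Ideal.mem_span_singleton.1 hb
    refine hdis (1 + r * (-c)) (M_mem r (-c)) ?_
    have : 1 + r * (-c) = a := by rw [← hab]; ring
    rwa [this]
  obtain ⟨m, hm, hle⟩ := Ideal.exists_le_maximal _ hne
  refine ⟨⟨m, hm.isPrime⟩, lt_of_le_of_ne (le_sup_left.trans hle) fun e => hdis r hrM ?_⟩
  have : p.asIdeal = m := congrArg PrimeSpectrum.asIdeal e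
  rw [this]
  exact hle (Ideal.mem_sup_right (Ideal.mem_span_singleton_self r))

section Geo

variable {R : Type*} [CommRing R] {A : Subalgebra R R[X]} {s : R}

lemma pow_mem_mono {h : R[X]} {n m : ℕ} (hn : C s ^ n * h ∈ A) (hnm : n ≤ m) :
    C s ^ m * h ∈ A := by
  obtain ⟨k, rfl⟩ := Nat.exists_eq_add_of_le hnm
  have : C s ^ (n + k) * h = C (s ^ k) * (C s ^ n * h) := by rw [C_pow]; ring
  rw [this]
  exact A.mul_mem (A.algebraMap_mem _) hn

lemma exists_uniform (hloc : ∀ g : R[X], ∃ n : ℕ, C s ^ n * g ∈ A) {ι : Type*} (F : Finset ι)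
    (h : ι → R[X]) : ∃ n : ℕ, ∀ i ∈ F, C s ^ n * h i ∈ A := by
  choose n hn using fun i => hloc (h i)
  exact ⟨F.sup n, fun i hi => pow_mem_mono (hn i) (Finset.le_sup hi)⟩

/-- Extension of an ideal of `A` to `R[X]`, saturated with respect to `s`. -/
def extI (hloc : ∀ g : R[X], ∃ n : ℕ, C s ^ n * g ∈ A) (Q : Ideal A) : Ideal R[X] where
  carrier := {f | ∃ n : ℕ, ∃ a ∈ Q, (a : R[X]) = C s ^ n * f}
  zero_mem' := ⟨0, 0, zero_mem _, by simp⟩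
  add_mem' := by
    rintro f g ⟨n, a, ha, hf⟩ ⟨m, b, hb, hg⟩
    refine ⟨n + m, algebraMap R A s ^ m * a + algebraMap R A s ^ n * b,
      add_mem (Ideal.mul_mem_left _ _ ha) (Ideal.mul_mem_left _ _ hb), ?_⟩
    have e : ((algebraMap R A s : A) : R[X]) = C s := rfl
    change ((algebraMap R A s : A) : R[X]) ^ m * (a : R[X]) +
      ((algebraMap R A s : A) : R[X]) ^ n * (b : R[X]) = _
    rw [e, hf, hg]
    ring
  smul_mem' := by
    rintro c f ⟨n, a, ha, hf⟩
    obtain ⟨m, hm⟩ := hloc c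
    refine ⟨m + n, ⟨_, hm⟩ * a, Ideal.mul_mem_left _ _ ha, ?_⟩
    push_cast
    rw [hf, smul_eq_mul]
    ring

lemma mem_extI (hloc : ∀ g : R[X], ∃ n : ℕ, C s ^ n * g ∈ A) (Q : Ideal A) [Q.IsPrime]
    (hs : algebraMap R A s ∉ Q) (a : A) : (a : R[X]) ∈ extI hloc Q ↔ a ∈ Q := by
  constructor
  · rintro ⟨n, b, hb, h⟩
    have e : b = algebraMap R A s ^ n * a := Subtype.ext (by push_cast; exact h)
    rw [e] at hb
    exact (Ideal.IsPrime.mem_or_mem ‹_› hb).resolve_left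
      fun h => hs (Ideal.IsPrime.mem_of_pow_mem ‹_› _ h)
  · exact fun h => ⟨0, a, h, by simp⟩

lemma extI_prime (hloc : ∀ g : R[X], ∃ n : ℕ, C s ^ n * g ∈ A) (Q : Ideal A) [Q.IsPrime]
    (hs : algebraMap R A s ∉ Q) : (extI hloc Q).IsPrime := by
  refine ⟨fun h => ?_, fun {f g} hfg => ?_⟩
  · have : ((1 : A) : R[X]) ∈ extI hloc Q := by rw [h]; trivial
    rw [mem_extI hloc Q hs] at this
    exact Ideal.IsPrime.ne_top ‹_› ((Ideal.eq_top_iff_one _).2 this)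
  · obtain ⟨n, hn⟩ := hloc f
    obtain ⟨m, hm⟩ := hloc g
    have h : (((⟨_, hn⟩ * ⟨_, hm⟩ : A)) : R[X]) ∈ extI hloc Q := by
      have : (((⟨_, hn⟩ * ⟨_, hm⟩ : A)) : R[X]) = C s ^ (n + m) * (f * g) := by
        push_cast; ring
      rw [this]
      exact Ideal.mul_mem_left _ _ hfg
    rw [mem_extI hloc Q hs] at h
    rcases Ideal.IsPrime.mem_or_mem ‹_› h with h | h
    · exact Or.inl ⟨n, _, h, rfl⟩
    · exact Or.inr ⟨m, _, h, rfl⟩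

lemma exists_r [IsNoetherianRing R] (hs : s ∈ nonZeroDivisors R)
    (hloc : ∀ g : R[X], ∃ n : ℕ, C s ^ n * g ∈ A) (I : Ideal A)
    (hht : ∀ p : PrimeSpectrum A, I ≤ p.asIdeal → 2 ≤ Order.height p) :
    ∃ t : R, algebraMap R A (s * t) ∈ I ∧ ∀ P ∈ minimalPrimes A, algebraMap R A (s * t) ∉ P := by
  have hsp : ∀ p ∈ minimalPrimes R, s ∉ p := fun p hp h =>
    notMem_nonZeroDivisors_of_mem_mem_minimalPrimes h hp hs
  obtain ⟨t, ht, htp⟩ := avoid (I.comap (algebraMap R A)) (minimalPrimes R)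
    (minimalPrimes.finite_of_isNoetherianRing R) (by
      intro p hp
      have hpp : p.IsPrime := hp.isPrime
      refine ⟨hpp, fun hle => ?_⟩
      have hdis : Disjoint (I : Set A) (p.primeCompl.map (algebraMap R A)) := by
        rw [Set.disjoint_left]
        rintro _ ha ⟨x, hx, rfl⟩
        exact hx (hle ha)
      obtain ⟨Q, hQ, hIQ, hQd⟩ := Ideal.exists_le_prime_disjoint I _ hdis
      have hQp : Q.comap (algebraMap R A) ≤ p := fun x hx => by
        by_contra hxp
        exact Set.disjoint_left.1 hQd hx ⟨x, hxp, rfl⟩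
      have hmin : ∀ Q' : Ideal A, Q'.IsPrime → Q' ≤ Q → Q'.comap (algebraMap R A) = p := by
        intro Q' hQ' h
        have h1 : Q'.comap (algebraMap R A) ≤ p := (Ideal.comap_mono h).trans hQp
        exact le_antisymm h1 (hp.2 ⟨Ideal.comap_isPrime _ _, bot_le⟩ h1)
      obtain ⟨y, z, hzy, hyx⟩ := Order.one_lt_height_iff.1
        (lt_of_lt_of_le (by norm_num : (1 : ℕ∞) < 2) (hht ⟨Q, hQ⟩ hIQ))
      let q : Fin 3 → PrimeSpectrum A := ![z, y, ⟨Q, hQ⟩]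
      have h01 : q 0 < q 1 := hzy
      have h12 : q 1 < q 2 := hyx
      have hqQ : ∀ i, (q i).asIdeal ≤ Q := by
        intro i
        fin_cases i
        · exact (hzy.trans hyx).le
        · exact hyx.le
        · exact le_rfl
      have hqc : ∀ i, (q i).asIdeal.comap (algebraMap R A) = p :=
        fun i => hmin _ (q i).isPrime (hqQ i)
      have hsq : ∀ i, algebraMap R A s ∉ (q i).asIdeal := by
        intro i h
        have : s ∈ (q i).asIdeal.comap (algebraMap R A) := h
        rw [hqc i] at this
        exact hsp p hp this
      have hlt : ∀ i j, q i < q j →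
          extI hloc (q i).asIdeal < extI hloc (q j).asIdeal := by
        intro i j hij
        have hle : (q i).asIdeal ≤ (q j).asIdeal := hij.le
        obtain ⟨a, haj, hai⟩ := Set.exists_of_ssubset
          (show ((q i).asIdeal : Set A) ⊂ (q j).asIdeal from hij)
        refine lt_of_le_of_ne ?_ ?_
        · rintro f ⟨n, a, ha, h⟩
          exact ⟨n, a, hle ha, h⟩
        · intro e
          have := (mem_extI hloc _ (hsq j) a).2 haj
          rw [← e, mem_extI hloc _ (hsq i)] at this
          exact hai this
      refine fiber_chain p (fun i => extI hloc (q i).asIdeal)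
        (fun i => extI_prime hloc _ (hsq i)) (hlt 0 1 h01) (hlt 1 2 h12) ?_
      intro i
      rw [← hqc i]
      ext x
      exact mem_extI hloc _ (hsq i) (algebraMap R A x))
  refine ⟨t, ?_, ?_⟩
  · rw [map_mul]
    exact Ideal.mul_mem_left _ _ ht
  · intro P hP h
    have hPp : P.IsPrime := hP.isPrime
    rw [map_mul] at h
    have hsA : algebraMap R A s ∈ nonZeroDivisors A := by
      rw [mem_nonZeroDivisors_iff_right]
      intro a ha
      have h1 : (a : R[X]) * C s = 0 := congrArg Subtype.val ha
      apply Subtype.ext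
      ext n
      have h2 := congrArg (fun f => coeff f n) h1
      simp only [coeff_mul_C, coeff_zero] at h2
      simpa using (mem_nonZeroDivisors_iff_right.1 hs) _ h2
    have hsP : algebraMap R A s ∉ P := fun h =>
      notMem_nonZeroDivisors_of_mem_mem_minimalPrimes h hP hsA
    have htP := (hPp.mem_or_mem h).resolve_left hsP
    have hprime : (P.comap (algebraMap R A)).IsPrime := Ideal.comap_isPrime _ _
    obtain ⟨q, hq, hle⟩ := Ideal.exists_minimalPrimes_le (I := ⊥)
      (J := P.comap (algebraMap R A)) bot_le
    have hqp : q.IsPrime := hq.isPrime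
    have hle' : q.map C ≤ extI hloc P := by
      rw [Ideal.map_le_iff_le_comap]
      intro x hx
      exact (mem_extI hloc P hsP (algebraMap R A x)).2 (hle hx)
    have hqC : (q.map (C : R →+* R[X])).IsPrime := Ideal.isPrime_map_C_of_isPrime
    have hcP : (q.map (C : R →+* R[X])).comap (A.val : A →+* R[X]) ≤ P := fun a ha =>
      (mem_extI hloc P hsP a).1 (hle' ha)
    have hPle := hP.2 ⟨Ideal.comap_isPrime _ _, bot_le⟩ hcP
    have h3 : C t ∈ q.map (C : R →+* R[X]) := hPle htP
    have h4 := Ideal.mem_map_C_iff.1 h3 0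
    rw [coeff_C_zero] at h4
    exact htp q hq h4

lemma map_top {A S B : Type*} [CommRing A] [CommRing S] [CommRing B] (ι : A →+* S) (ψ : S →+* B)
    {I : Ideal A} {d : ℕ} {g : Fin (d + 1) → A} (h : Prop1 (ψ.comp ι) I (d + 1) g)
    (hB : ringKrullDim B ≤ (d : WithBot ℕ∞)) (r : A) (hr : r ∈ I) (hu : IsUnit (ψ (ι r))) :
    (Ideal.span (Set.range fun i => ι (g i))).map ψ = ⊤ := by
  by_contra hne
  obtain ⟨P, hP, hle⟩ := Ideal.exists_le_maximal _ hne
  have := h.final hB P hP.isPrime (fun i => hle (Ideal.mem_map_of_mem ψ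
    (Ideal.subset_span ⟨i, rfl⟩)))
  exact hP.ne_top (Ideal.eq_top_of_isUnit_mem _ (this hr) hu)

/-- The change under the substitution `X ↦ e X` lies in `r A`. -/
lemma subst_sub (M : ℕ) (r t e z : R) (hr : r = s * t) (he : e - 1 = r ^ (M + 1) * z) (f : R[X])
    (hf : ∀ j ∈ Finset.range (f.natDegree + 1), C s ^ M * X ^ j ∈ A) :
    ∃ b : A, f.comp (C e * X) - f = C r * b := by
  have key : ∀ j : ℕ, ∃ y, e ^ j - 1 = (e - 1) * y := fun j => by
    have : e - 1 ∣ e ^ j - 1 := by simpa using sub_dvd_pow_sub_pow e 1 j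
    exact this
  choose y hy using key
  have h1 : f.comp (C e * X) - f
      = ∑ j ∈ Finset.range (f.natDegree + 1), C (f.coeff j * (e ^ j - 1)) * X ^ j := by
    ext n
    simp only [coeff_sub, comp_C_mul_X_coeff, finsetSum_coeff, coeff_C_mul, coeff_X_pow,
      mul_ite, mul_one, mul_zero, Finset.sum_ite_eq, Finset.mem_range]
    split_ifs with h
    · ring
    · rw [coeff_eq_zero_of_natDegree_lt (by omega)]; ring
  have h2 : ∀ j ∈ Finset.range (f.natDegree + 1),
      C (f.coeff j * y j * z * t ^ M) * (C s ^ M * X ^ j) ∈ A := fun j hj =>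
    A.mul_mem (A.algebraMap_mem _) (hf j hj)
  refine ⟨⟨_, A.sum_mem h2⟩, ?_⟩
  rw [h1]
  simp only
  rw [Finset.mul_sum]
  refine Finset.sum_congr rfl fun j _ => ?_
  rw [hy, he, hr, ← C_pow]
  simp only [← mul_assoc, ← C_mul]
  congr 2
  ring

end Geo

end Stmt19Aux

open Stmt19Aux



/-- In a geometric subring `A` of `R[T]`, every finitely generated ideal of height
`≥ 2` is set-theoretically generated by at most `d+1` elements. -/
theorem stmt_19 {R : Type*} [CommRing R] [IsNoetherianRing R]
    (d : ℕ) (hd1 : 1 ≤ d) (hR : ringKrullDim R = (d : WithBot ℕ∞))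
    (A : Subalgebra R (Polynomial R)) [IsNoetherianRing A]
    (hA : ringKrullDim A = ((d + 1 : ℕ) : WithBot ℕ∞))
    (s : R) (hs : s ∈ nonZeroDivisors R)
    (hloc : ∀ g : Polynomial R, ∃ n : ℕ, (Polynomial.C s) ^ n * g ∈ A)
    (I : Ideal A) (hfg : I.FG) (hht : 2 ≤ idealHeight I) :
    ∃ g : Fin (d + 1) → A,
      I.radical = (Ideal.span (Set.range g)).radical := by
  have hht' : ∀ p : PrimeSpectrum A, I ≤ p.asIdeal → 2 ≤ Order.height p := fun p hp =>
    hht.trans (iInf₂_le p hp)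
  obtain ⟨t, hrI, hrmin⟩ := exists_r hs hloc I hht'
  obtain ⟨r, hr⟩ : ∃ r, r = s * t := ⟨_, rfl⟩
  rw [← hr] at hrI hrmin
  let ι : A →+* R[X] := A.val
  let ι₀ : A →+* R := (evalRingHom 0).comp ι
  let ψ₂ : R[X] →+* (Localization (M R r))[X] := mapRingHom (algebraMap R (Localization (M R r)))
  let ψ₃ : R →+* Localization (Submonoid.powers r) := algebraMap R _
  have hN2 : IsNoetherianRing (Localization (M R r)) :=
    IsLocalization.isNoetherianRing (M R r) _ inferInstance
  have hN3 : IsNoetherianRing (Localization (Submonoid.powers r)) :=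
    IsLocalization.isNoetherianRing (Submonoid.powers r) _ inferInstance
  -- dimensions
  have hd2 : ringKrullDim (Localization (M R r))[X] ≤ (d : WithBot ℕ∞) := by
    rw [Polynomial.ringKrullDim_of_isNoetherianRing, ← hR]
    exact dim_M r
  have hd3 : ringKrullDim (Localization (Submonoid.powers r)) ≤ (d : WithBot ℕ∞) := by
    rw [← hR]
    exact Order.krullDim_le_of_strictMono (PrimeSpectrum.comap ψ₃)
      (Monotone.strictMono_of_injective (fun _ _ h => Ideal.comap_mono h)
        (PrimeSpectrum.localization_comap_injective _ (Submonoid.powers r)))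
  obtain ⟨g, hgI, p1, p2, p3⟩ := select' (algebraMap R A r)
    (ψ₂.comp ι) (ψ₃.comp ι₀) I d hrmin hA
  -- unimodularity over the second and third ring
  have ht2 := map_top ι ψ₂ p2 hd2 _ hrI (by
    have e : ψ₂ (ι (algebraMap R A r)) = C (algebraMap R (Localization (M R r)) r) := by
      change mapRingHom _ (C r) = _
      simp
    rw [e]
    exact (IsLocalization.map_units (Localization (M R r)) (⟨r, Submonoid.mem_sup_left (Submonoid.mem_powers r)⟩ : M R r)).map C)
  have ht3 := map_top ι₀ ψ₃ p3 hd3 _ hrI (by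
    have e : ι₀ (algebraMap R A r) = r := by
      change eval 0 (C r) = _
      simp
    rw [e]
    exact IsLocalization.map_units (Localization (Submonoid.powers r)) (⟨r, Submonoid.mem_powers r⟩ : Submonoid.powers r))
  obtain ⟨m2, hm2, hJ2⟩ := poly_loc _ _ ht2
  obtain ⟨n, x, rfl⟩ := mem_M r _ hm2
  obtain ⟨_, ⟨m, rfl⟩, hJ3⟩ := loc_top _ _ ht3
  -- the substitution
  obtain ⟨K, hK⟩ := exists_uniform (A := A) hloc
    (Finset.range ((Finset.univ.sup fun i => (g i : R[X]).natDegree) + 1)) (fun j => X ^ j)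
  obtain ⟨e, he⟩ : ∃ e, e = 1 - (-(r * x)) ^ (K + 1) := ⟨_, rfl⟩
  have he1 : e - 1 = r ^ (K + 1) * (-(-x) ^ (K + 1)) := by
    rw [he, ← mul_neg, mul_pow]; ring
  have hue : (1 + r * x) ∣ e := by
    have := sub_dvd_pow_sub_pow 1 (-(r * x)) (K + 1)
    rw [he]
    simpa using this
  have hb : ∀ i, ∃ b : A, (g i : R[X]).comp (C e * X) - g i = C r * b := fun i => by
    refine subst_sub K r t e _ hr he1 _ fun j hj => hK j ?_
    have := Finset.le_sup (f := fun i => (g i : R[X]).natDegree) (Finset.mem_univ i)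
    simp only [Finset.mem_range] at hj ⊢
    omega
  choose b hb using hb
  let g' : Fin (d + 1) → A := fun i => g i + algebraMap R A r * b i
  have hg' : ∀ i, (g' i : R[X]) = (g i : R[X]).comp (C e * X) := fun i => by
    have h1 : (g' i : R[X]) = g i + C r * b i := rfl
    rw [h1, ← hb i]; ring
  have hg'I : ∀ i, g' i ∈ I := fun i => add_mem (hgI i) (Ideal.mul_mem_right _ _ hrI)
  -- a power of `r` lies in the extended ideal
  let J' : Ideal R[X] := Ideal.span (Set.range fun i => (g' i : R[X]))
  have hJa : C (r ^ n * (1 + r * x)) ∈ J' := by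
    have := Ideal.mem_map_of_mem (compRingHom (C e * X)) hJ2
    rw [Ideal.map_span, ← Set.range_comp] at this
    simp only [coe_compRingHom_apply, C_comp] at this
    convert this using 3
    funext i
    exact hg' i
  have hJb : C (r ^ m) ∈ J' ⊔ Ideal.span {C (1 + r * x)} := by
    have := Ideal.mem_map_of_mem (C : R →+* R[X]) hJ3
    refine (?_ : Ideal.map C _ ≤ _) this
    rw [Ideal.map_span, Ideal.span_le]
    rintro _ ⟨_, ⟨i, rfl⟩, rfl⟩
    have h1 : C (1 + r * x) ∣ (g' i : R[X]) - C (ι₀ (g i)) := by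
      rw [hg' i, C_dvd_iff_dvd_coeff]
      intro j
      have e0 : ι₀ (g i) = (g i : R[X]).coeff 0 := (coeff_zero_eq_eval_zero _).symm
      rw [coeff_sub, comp_C_mul_X_coeff, e0, coeff_C]
      split_ifs with hj
      · simp [hj]
      · rw [sub_zero]
        exact Dvd.dvd.mul_left (hue.trans (dvd_pow_self e hj)) _
    have h2 : C (ι₀ (g i)) = (g' i : R[X]) - ((g' i : R[X]) - C (ι₀ (g i))) := by ring
    rw [SetLike.mem_coe, h2]
    exact sub_mem (Ideal.mem_sup_left (Ideal.subset_span ⟨i, rfl⟩))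
      (Ideal.mem_sup_right (Ideal.mem_span_singleton.2 h1))
  have hJc : C r ^ (n + m) ∈ J' := by
    obtain ⟨j, hj, w, hw, hjw⟩ := Submodule.mem_sup.1 hJb
    obtain ⟨y, rfl⟩ := Ideal.mem_span_singleton.1 hw
    have : C r ^ (n + m) = C (r ^ n) * j + y * C (r ^ n * (1 + r * x)) := by
      rw [pow_add, ← C_pow, ← C_pow, ← hjw]
      simp only [C_mul]
      ring
    rw [this]
    exact add_mem (Ideal.mul_mem_left _ _ hj) (Ideal.mul_mem_left _ _ hJa)
  obtain ⟨c, hc⟩ := (Ideal.mem_span_range_iff_exists_fun).1 hJc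
  obtain ⟨L, hL⟩ := exists_uniform (A := A) hloc Finset.univ c
  have hfin : algebraMap R A r ^ (n + m + L) ∈ Ideal.span (Set.range g') := by
    have : algebraMap R A r ^ (n + m + L) =
        ∑ i, (algebraMap R A t ^ L * ⟨_, hL i (Finset.mem_univ i)⟩) * g' i := by
      apply Subtype.ext
      push_cast
      simp only [Polynomial.algebraMap_eq]
      rw [pow_add, ← hc, Finset.sum_mul]
      refine Finset.sum_congr rfl fun i _ => ?_
      rw [hr, C_mul]
      ring
    rw [this]
    exact sum_mem fun i _ => Ideal.mul_mem_left _ _ (Ideal.subset_span ⟨i, rfl⟩)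
  refine ⟨g', le_antisymm ?_ ?_⟩
  · rw [Ideal.radical_le_radical_iff, Ideal.radical_eq_sInf]
    refine le_sInf ?_
    rintro P ⟨hle, hP⟩
    have hrP : algebraMap R A r ∈ P := hP.mem_of_pow_mem _ (hle hfin)
    refine p1 P hP hrP fun i => ?_
    have h2 : g i = g' i - algebraMap R A r * b i := by simp [g']
    rw [h2]
    exact sub_mem (hle (Ideal.subset_span ⟨i, rfl⟩)) (Ideal.mul_mem_right _ _ hrP)
  · refine Ideal.radical_mono (Ideal.span_le.2 ?_)
    rintro _ ⟨i, rfl⟩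
    exact hg'I i
end
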